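/- arXiv:1912.02618 — 2 statements merged into one kernel-verified Lean document; each statement's English description precedes it below -/
import Mathlib

section
/- Let M be a subset of ℂⁿ contained in a generic smooth real submanifold of ℂⁿ of real codimension d, and let p₀ ∈ M be a point of finite type, i.e., Δ(M, p₀) < ∞. Then there exists a neighborhood V of p₀ in ℂⁿ such that Δ(M, p) ≤ 2·(Δ(M, p₀))^{n−d} for all p ∈ M ∩ V. -/
open scoped ENNReal Topology

/-- Order of vanishing at `0` of a function `f` between real normed spaces:
the least `m` such that the `m`-th iterated (real) Fréchet derivative of `f` at `0`
is nonzero, and `∞` if all iterated derivatives vanish. -/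
noncomputable def vOrder {E F : Type*} [NormedAddCommGroup E] [NormedSpace ℝ E]
    [NormedAddCommGroup F] [NormedSpace ℝ F] (f : E → F) : ℝ≥0∞ :=
  ⨅ m ∈ {m : ℕ | iteratedFDeriv ℝ m f 0 ≠ 0}, (m : ℝ≥0∞)

/-- `ν(γ)` for a curve `γ : ℂ → ℂⁿ` through `p`: the minimum over the components of
the order of vanishing of `γ i - p i` at `0`. -/
noncomputable def nuCurve {n : ℕ} (γ : ℂ → Fin n → ℂ) (p : Fin n → ℂ) : ℝ≥0∞ :=
  ⨅ i : Fin n, vOrder (fun t => γ t i - p i)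

/-- The set `𝒞` of (representatives of) nonconstant germs at `0 ∈ ℂ` of holomorphic
curves `γ` with `γ 0 = p`. -/
def Curves (n : ℕ) (p : Fin n → ℂ) : Set (ℂ → Fin n → ℂ) :=
  {γ | AnalyticAt ℂ γ 0 ∧ γ 0 = p ∧ ¬ (∀ᶠ t in 𝓝 (0 : ℂ), γ t = p)}

/-- The set `I_M(p)` of (representatives of) germs at `p` of real-valued `C^∞` functions
defined in a neighborhood of `p` and vanishing on `M` near `p`. -/
def IMp (n : ℕ) (M : Set (Fin n → ℂ)) (p : Fin n → ℂ) : Set ((Fin n → ℂ) → ℝ) :=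
  {r | ∃ U : Set (Fin n → ℂ), IsOpen U ∧ p ∈ U ∧ ContDiffOn ℝ (⊤ : ℕ∞) r U ∧
    ∀ z ∈ M ∩ U, r z = 0}

/-- The D'Angelo type `Δ(M,p)` of an arbitrary set `M ⊆ ℂⁿ` at `p`:
`Δ(M,p) = sup_{γ ∈ 𝒞} inf_{r ∈ I_M(p)} ν(r∘γ)/ν(γ)`. -/
noncomputable def Delta (n : ℕ) (M : Set (Fin n → ℂ)) (p : Fin n → ℂ) : ℝ≥0∞ :=
  ⨆ γ ∈ Curves n p, ⨅ r ∈ IMp n M p,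
    vOrder (fun t => r (γ t) - r p) / nuCurve γ p

/-- The Taylor polynomial `r_k` of order `k` of `r` at `p`. -/
noncomputable def taylorPoly (n k : ℕ) (r : (Fin n → ℂ) → ℝ) (p : Fin n → ℂ) :
    (Fin n → ℂ) → ℝ :=
  fun z => ∑ j ∈ Finset.range (k + 1),
    ((j.factorial : ℝ))⁻¹ • iteratedFDeriv ℝ j r p (fun _ => z - p)

/-- `Δ(M_k,p) = sup_{γ ∈ 𝒞} inf_{r ∈ I_M(p)} ν(r_k∘γ)/ν(γ)`. -/
noncomputable def DeltaK (n : ℕ) (M : Set (Fin n → ℂ)) (p : Fin n → ℂ) (k : ℕ) : ℝ≥0∞ :=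
  ⨆ γ ∈ Curves n p, ⨅ r ∈ IMp n M p,
    vOrder (fun t => taylorPoly n k r p (γ t) - taylorPoly n k r p p) / nuCurve γ p

/-- The complex differential `∂ρ` of a real-valued function `ρ` at `z`, written as the vector
of coefficients `∂ρ/∂zᵢ(z) = (1/2)(∂ρ/∂xᵢ(z) - i ∂ρ/∂yᵢ(z))`. -/
noncomputable def delVec (n : ℕ) (ρ : (Fin n → ℂ) → ℝ) (z : Fin n → ℂ) : Fin n → ℂ :=
  fun i => (1 / 2 : ℂ) *
    (((fderiv ℝ ρ z (Pi.single i 1) : ℝ) : ℂ) -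
      Complex.I * ((fderiv ℝ ρ z (Pi.single i Complex.I) : ℝ) : ℂ))

/-- `N ⊆ ℂⁿ` is a generic smooth real submanifold of real codimension `d` if near each of its
points it is the common zero set of `d` real-valued `C^∞` functions `ρ₁, …, ρ_d` whose complex
differentials `∂ρ₁, …, ∂ρ_d` are `ℂ`-linearly independent at each point of a neighborhood. -/
def IsGenericSubmanifold (n d : ℕ) (N : Set (Fin n → ℂ)) : Prop :=
  ∀ p ∈ N, ∃ (U : Set (Fin n → ℂ)) (ρ : Fin d → (Fin n → ℂ) → ℝ),
    IsOpen U ∧ p ∈ U ∧ (∀ j, ContDiffOn ℝ (⊤ : ℕ∞) (ρ j) U) ∧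
    (N ∩ U = {z ∈ U | ∀ j, ρ j z = 0}) ∧
    ∀ z ∈ U, LinearIndependent ℂ (fun j : Fin d => delVec n (ρ j) z)

section

open Polynomial

/-- Over an algebraically closed field the residue fields of a finite type algebra are trivial. -/
theorem exists_sub_algebraMap_mem_of_isMaximal {C : Type*} [CommRing C] [Algebra ℂ C]
    [Algebra.FiniteType ℂ C] (Q : Ideal C) [Q.IsMaximal] (x : C) :
    ∃ c : ℂ, x - algebraMap ℂ C c ∈ Q := by
  let := Ideal.Quotient.field Q
  have : Module.Finite ℂ (C ⧸ Q) := finite_of_finite_type_of_isJacobsonRing ℂ (C ⧸ Q)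
  have hs := IsAlgClosed.algebraMap_bijective_of_isIntegral (k := ℂ) (K := C ⧸ Q)
  obtain ⟨c, hc⟩ := hs.2 (Ideal.Quotient.mk Q x)
  refine ⟨c, ?_⟩
  rw [← Ideal.Quotient.eq, ← hc]
  rfl

theorem exists_sub_algebraMap_mem_maximalIdeal {C L : Type*} [CommRing C] [Algebra ℂ C]
    [Algebra.FiniteType ℂ C] (Q : Ideal C) [Q.IsMaximal] [CommRing L] [IsLocalRing L]
    [Algebra C L] [Algebra ℂ L] [IsScalarTower ℂ C L] [IsLocalization.AtPrime L Q] (x : L) :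
    ∃ c : ℂ, x - algebraMap ℂ L c ∈ IsLocalRing.maximalIdeal L := by
  obtain ⟨a, s, rfl⟩ := IsLocalization.exists_mk'_eq Q.primeCompl x
  obtain ⟨c, hc⟩ := exists_sub_algebraMap_mem_of_isMaximal Q a
  obtain ⟨e, he⟩ := exists_sub_algebraMap_mem_of_isMaximal Q (s : C)
  have he0 : e ≠ 0 := fun h => s.2 (by simpa [h] using he)
  refine ⟨c / e, ?_⟩
  have hs : IsUnit (algebraMap C L s) := IsLocalization.map_units _ s
  rw [← Ideal.mul_unit_mem_iff_mem _ hs]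
  have h1 : (IsLocalization.mk' L a s - algebraMap ℂ L (c / e)) * algebraMap C L s
      = algebraMap C L (a - algebraMap ℂ C c - algebraMap ℂ C (c / e) * (s - algebraMap ℂ C e)) := by
    have h2 : IsLocalization.mk' L a s * algebraMap C L s = algebraMap C L a :=
      IsLocalization.mk'_spec _ _ _
    have h3 : algebraMap ℂ L c = algebraMap ℂ L (c / e) * algebraMap ℂ L e := by
      rw [← map_mul, div_mul_cancel₀ _ he0]
    rw [sub_mul, h2]
    simp only [map_sub, map_mul, ← IsScalarTower.algebraMap_apply, h3]
    ring
  rw [h1, IsLocalization.AtPrime.to_map_mem_maximal_iff L Q]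
  exact sub_mem hc (Ideal.mul_mem_left _ _ he)

theorem exists_dvr_of_finite_polynomial {A : Type} [CommRing A] [IsDomain A] [Algebra ℂ A]
    (g : ℂ[X] →ₐ[ℂ] A) (hg : Function.Injective g) (hfin : g.Finite)
    (Q : Ideal A) [Q.IsMaximal] :
    ∃ (V : Type) (_ : CommRing V) (_ : IsDomain V) (_ : IsDiscreteValuationRing V)
      (_ : Algebra ℂ V) (ψ : A →ₐ[ℂ] V), Function.Injective ψ ∧
      (∀ b ∈ Q, ψ b ∈ IsLocalRing.maximalIdeal V) ∧
      ∀ x : V, ∃ c : ℂ, x - algebraMap ℂ V c ∈ IsLocalRing.maximalIdeal V := by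
  let : Algebra ℂ[X] A := g.toRingHom.toAlgebra
  have : IsScalarTower ℂ ℂ[X] A := IsScalarTower.of_algebraMap_eq fun c => by
    exact (g.commutes c).symm
  have : Module.Finite ℂ[X] A := hfin
  have : FaithfulSMul ℂ[X] A := (faithfulSMul_iff_algebraMap_injective _ _).2 hg
  let K := FractionRing A
  have : FaithfulSMul ℂ[X] K := (faithfulSMul_iff_algebraMap_injective _ _).2 (by
    rw [IsScalarTower.algebraMap_eq ℂ[X] A K]
    exact (IsFractionRing.injective A K).comp hg)
  let : Algebra (FractionRing ℂ[X]) K := FractionRing.liftAlgebra ℂ[X] K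
  have : IsScalarTower ℂ[X] (FractionRing ℂ[X]) K := FractionRing.isScalarTower_liftAlgebra _ _
  have : FiniteDimensional (FractionRing ℂ[X]) K := by
    infer_instance
  let C := integralClosure ℂ[X] K
  have : IsDedekindDomain C := integralClosure.isDedekindDomain_fractionRing ℂ[X] K
  have : Module.Finite ℂ[X] C :=
    IsIntegralClosure.finite ℂ[X] (FractionRing ℂ[X]) K C
  let φ : A →ₐ[ℂ[X]] C := IsIntegralClosure.lift ℂ[X] C K
  have hφc : ∀ a, algebraMap C K (φ a) = algebraMap A K a := fun a =>
    IsIntegralClosure.algebraMap_lift ℂ[X] C K a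
  have hφ : Function.Injective φ := fun a b hab => by
    apply IsFractionRing.injective A K
    rw [← hφc, ← hφc, hab]
  have hφint : φ.toRingHom.IsIntegral := by
    intro x
    obtain ⟨p, hp, hpx⟩ := Algebra.IsIntegral.isIntegral (R := ℂ[X]) x
    refine ⟨p.map (algebraMap ℂ[X] A), hp.map _, ?_⟩
    have hc : φ.toRingHom.comp (algebraMap ℂ[X] A) = algebraMap ℂ[X] C :=
      RingHom.ext fun r => φ.commutes r
    rw [eval₂_map]
    exact hc ▸ hpx
  let : Algebra A C := φ.toRingHom.toAlgebra
  have : Algebra.IsIntegral A C := ⟨hφint⟩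
  obtain ⟨𝔮, h𝔮, h𝔮Q⟩ := Ideal.exists_ideal_over_maximal_of_isIntegral (S := C) Q (by
    rw [(RingHom.injective_iff_ker_eq_bot _).1 (show Function.Injective (algebraMap A C) from hφ)]
    exact bot_le)
  have : Algebra.FiniteType ℂ C :=
    Algebra.FiniteType.trans (S := ℂ[X]) inferInstance inferInstance
  have hCf : ¬ IsField C := by
    intro hC
    have : IsField ℂ[X] := isField_of_isIntegral_of_isField
      (FaithfulSMul.algebraMap_injective ℂ[X] C) hC
    exact Polynomial.not_isField ℂ this
  have h𝔮0 : 𝔮 ≠ ⊥ := fun h => by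
    subst h
    exact hCf (Ring.isField_iff_maximal_bot.2 h𝔮)
  have hV : IsDiscreteValuationRing (Localization.AtPrime 𝔮) :=
    IsLocalization.AtPrime.isDiscreteValuationRing_of_dedekind_domain C h𝔮0 _
  have hCA : IsScalarTower ℂ ℂ[X] C := inferInstance
  let φ' : A →ₐ[ℂ] C := φ.restrictScalars ℂ
  let ι : C →ₐ[ℂ] Localization.AtPrime 𝔮 := IsScalarTower.toAlgHom ℂ C _
  have hι : Function.Injective ι := IsLocalization.injective (Localization.AtPrime 𝔮)
    𝔮.primeCompl_le_nonZeroDivisors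
  have hιm : ∀ x : C, ι x ∈ IsLocalRing.maximalIdeal (Localization.AtPrime 𝔮) ↔ x ∈ 𝔮 := fun x =>
    IsLocalization.AtPrime.to_map_mem_maximal_iff (Localization.AtPrime 𝔮) 𝔮 x
  refine ⟨Localization.AtPrime 𝔮, inferInstance, inferInstance, hV, inferInstance, ι.comp φ',
    hι.comp hφ, fun b hb => ?_, fun x => ?_⟩
  · refine (hιm _).2 ?_
    rw [← h𝔮Q] at hb
    exact hb
  · exact exists_sub_algebraMap_mem_maximalIdeal 𝔮 x

theorem exists_dvr_arc {B : Type} [CommRing B] [IsDomain B] [Algebra ℂ B] [Algebra.FiniteType ℂ B]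
    (Q : Ideal B) [Q.IsMaximal] {y : B} (hyQ : y ∈ Q) (hy : y ≠ 0) :
    ∃ (V : Type) (_ : CommRing V) (_ : IsDomain V) (_ : IsDiscreteValuationRing V)
      (_ : Algebra ℂ V) (ψ : B →ₐ[ℂ] V), ψ y ≠ 0 ∧
      (∀ b ∈ Q, ψ b ∈ IsLocalRing.maximalIdeal V) ∧
      ∀ x : V, ∃ c : ℂ, x - algebraMap ℂ V c ∈ IsLocalRing.maximalIdeal V := by
  obtain ⟨s, g, hg, hfin⟩ := exists_finite_inj_algHom_of_fg ℂ B
  let : Algebra (MvPolynomial (Fin s) ℂ) B := g.toRingHom.toAlgebra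
  have : IsScalarTower ℂ (MvPolynomial (Fin s) ℂ) B := IsScalarTower.of_algebraMap_eq fun c => (g.commutes c).symm
  have : Module.Finite (MvPolynomial (Fin s) ℂ) B := hfin
  have : FaithfulSMul (MvPolynomial (Fin s) ℂ) B := (faithfulSMul_iff_algebraMap_injective _ _).2 hg
  have hmax : (Q.under (MvPolynomial (Fin s) ℂ)).IsMaximal := Ideal.isMaximal_comap_of_isIntegral_of_isMaximal Q
  obtain ⟨c, hc⟩ := MvPolynomial.isMaximal_iff_eq_vanishingIdeal_singleton.1 hmax
  have hQR : ∀ p : (MvPolynomial (Fin s) ℂ), p ∈ Q.under (MvPolynomial (Fin s) ℂ) ↔ MvPolynomial.eval c p = 0 := fun p => by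
    rw [hc]; simp [MvPolynomial.mem_vanishingIdeal_iff, MvPolynomial.aeval_eq_eval]
  have hne : (Ideal.span {y}).comap (algebraMap (MvPolynomial (Fin s) ℂ) B) ≠ ⊥ :=
    Ideal.comap_ne_bot_of_integral_mem hy (Ideal.mem_span_singleton_self y)
      (Algebra.IsIntegral.isIntegral y)
  obtain ⟨h, hhy, hh0⟩ := Submodule.exists_mem_ne_zero_of_ne_bot hne
  have hhy' : y ∣ g h := Ideal.mem_span_singleton.1 hhy
  obtain ⟨w, hw⟩ : ∃ w, MvPolynomial.eval w h ≠ 0 := by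
    by_contra! hcon
    exact hh0 (MvPolynomial.funext fun w => by simpa using hcon w)
  have hch : MvPolynomial.eval c h = 0 :=
    (hQR h).1 (Q.mem_of_dvd hhy' hyQ)
  obtain ⟨i₀, hi₀⟩ : ∃ i, w i - c i ≠ 0 := by
    by_contra! hcon
    have : w = c := funext fun i => sub_eq_zero.1 (hcon i)
    exact hw (this ▸ hch)
  let θ : (MvPolynomial (Fin s) ℂ) →ₐ[ℂ] ℂ[X] := MvPolynomial.aeval fun i => C (c i) + C (w i - c i) * X
  have hθeval : ∀ (z : ℂ) (p : (MvPolynomial (Fin s) ℂ)), (θ p).eval z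
      = MvPolynomial.eval (fun i => c i + (w i - c i) * z) p := fun z p => by
    induction p using MvPolynomial.induction_on with
    | C a => simp [θ]
    | add p q hp hq => simp [hp, hq]
    | mul_X p i hp => rw [map_mul, eval_mul, hp, map_mul]; simp [θ]
  let p := RingHom.ker θ
  have hp : p.IsPrime := RingHom.ker_isPrime _
  have hpQ : p ≤ Q.under (MvPolynomial (Fin s) ℂ) := fun f hf => by
    rw [hQR]
    have := hθeval 0 f
    rw [show θ f = 0 from hf] at this
    simpa using this.symm
  have : Q.LiesOver (Q.under (MvPolynomial (Fin s) ℂ)) := ⟨rfl⟩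
  obtain ⟨𝔓, h𝔓Q, h𝔓, hover⟩ := Ideal.exists_ideal_le_liesOver_of_le (p := p) (q := Q.under (MvPolynomial (Fin s) ℂ)) Q hpQ
  have hmem : ∀ f : (MvPolynomial (Fin s) ℂ), g f ∈ 𝔓 ↔ θ f = 0 := fun f => by
    have : f ∈ p ↔ f ∈ 𝔓.under (MvPolynomial (Fin s) ℂ) := by rw [← hover.over]
    exact this.symm
  have hy𝔓 : y ∉ 𝔓 := fun hy' => by
    have h1 : θ h = 0 := (hmem h).1 (𝔓.mem_of_dvd hhy' hy')
    have h2 := hθeval 1 h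
    rw [h1] at h2
    apply hw
    simpa using h2.symm
  let A := B ⧸ 𝔓
  let q : B →ₐ[ℂ] A := Ideal.Quotient.mkₐ ℂ 𝔓
  let τ : (MvPolynomial (Fin s) ℂ) := MvPolynomial.C (w i₀ - c i₀)⁻¹ * (MvPolynomial.X i₀ - MvPolynomial.C (c i₀))
  have hτ : θ τ = X := by
    rw [map_mul, map_sub, MvPolynomial.aeval_X, MvPolynomial.algHom_C, MvPolynomial.algHom_C,
      Polynomial.algebraMap_eq, add_sub_cancel_left, ← mul_assoc, ← C_mul, inv_mul_cancel₀ hi₀, C_1,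
      one_mul]
  let g' : ℂ[X] →ₐ[ℂ] A := aeval (q (g τ))
  have hlift : ∀ r : (MvPolynomial (Fin s) ℂ), q (g r) = g' (θ r) := by
    intro r
    have h1 : θ (aeval τ (θ r)) = θ r := by
      rw [← Polynomial.aeval_algHom_apply, hτ, aeval_X_left_apply]
    have h2 : q (g (r - aeval τ (θ r))) = 0 := by
      refine Ideal.Quotient.eq_zero_iff_mem.2 ((hmem _).2 ?_)
      rw [map_sub, h1, sub_self]
    rw [map_sub, map_sub, sub_eq_zero] at h2
    rw [h2]
    simp only [g', Polynomial.aeval_algHom_apply]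
  have hg'inj : Function.Injective g' := by
    rw [injective_iff_map_eq_zero]
    intro f hf
    have h1 : θ (aeval τ f) = f := by
      rw [← Polynomial.aeval_algHom_apply, hτ, aeval_X_left_apply]
    rw [← h1] at hf ⊢
    rw [← hlift] at hf
    exact (hmem _).1 (Ideal.Quotient.eq_zero_iff_mem.1 hf)
  have hg'fin : g'.Finite := by
    have h1 : ((q.comp g : (MvPolynomial (Fin s) ℂ) →ₐ[ℂ] A)).Finite :=
      AlgHom.Finite.comp (AlgHom.Finite.of_surjective _ (Ideal.Quotient.mkₐ_surjective ℂ 𝔓)) hfin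
    have h2 : q.comp g = g'.comp θ := AlgHom.ext hlift
    rw [h2] at h1
    exact AlgHom.Finite.of_comp_finite h1
  have hqsurj : Function.Surjective q := Ideal.Quotient.mkₐ_surjective ℂ 𝔓
  have hQ' : (Q.map q).IsMaximal := by
    refine (Ideal.map_eq_top_or_isMaximal_of_surjective q hqsurj inferInstance).resolve_left ?_
    intro htop
    have h1 := Ideal.comap_map_of_surjective q hqsurj Q
    rw [htop, Ideal.comap_top] at h1
    have h2 : Ideal.comap q ⊥ ≤ Q := fun x hx => h𝔓Q (Ideal.Quotient.eq_zero_iff_mem.1 hx)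
    exact Ideal.IsMaximal.ne_top inferInstance ((sup_eq_left.2 h2).symm.trans h1.symm)
  have hQmax : ∀ b ∈ Q, q b ∈ Q.map q := fun b hb => Ideal.mem_map_of_mem _ hb
  obtain ⟨V, i1, i2, i3, i4, ψ, hψ, hψQ, hres⟩ := exists_dvr_of_finite_polynomial g' hg'inj hg'fin
    (Q.map q)
  refine ⟨V, i1, i2, i3, i4, ψ.comp q, fun h0 => ?_, fun b hb => hψQ _ (hQmax b hb), hres⟩
  exact hy𝔓 (Ideal.Quotient.eq_zero_iff_mem.1 (hψ (h0.trans (map_zero ψ).symm)))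

section
variable {V : Type*} [CommRing V] [IsDomain V] [Algebra ℂ V]

theorem exists_aeval_sub_dvd [IsDiscreteValuationRing V] (hres : ∀ x : V, ∃ c : ℂ,
      x - algebraMap ℂ V c ∈ IsLocalRing.maximalIdeal V) {π : V} (hπ : Irreducible π) (x : V)
    (N : ℕ) : ∃ p : ℂ[X], π ^ N ∣ x - aeval π p := by
  induction N generalizing x with
  | zero => exact ⟨0, by simp⟩
  | succ N ih =>
    obtain ⟨c, hc⟩ := hres x
    rw [hπ.maximalIdeal_eq, Ideal.mem_span_singleton] at hc
    obtain ⟨u, hu⟩ := hc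
    obtain ⟨p, hp⟩ := ih u
    refine ⟨C c + X * p, ?_⟩
    have : x - aeval π (C c + X * p) = π * (u - aeval π p) := by
      simp only [map_add, map_mul, aeval_C, aeval_X, mul_sub, ← hu]
      ring
    rw [this, pow_succ']
    exact mul_dvd_mul_left _ hp

theorem pow_dvd_aeval_iff {π : V} (hπ : Irreducible π) (q : ℂ[X]) (m : ℕ) :
    π ^ m ∣ aeval π q ↔ X ^ m ∣ q := by
  constructor
  · intro h
    induction m generalizing q with
    | zero => simp
    | succ m ih =>
      have hq : aeval π q = π * aeval π q.divX + algebraMap ℂ V (q.coeff 0) := by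
        conv_lhs => rw [← X_mul_divX_add q, map_add, map_mul, aeval_X, aeval_C]
      have h0 : q.coeff 0 = 0 := by
        by_contra h0
        have h1 : π ∣ algebraMap ℂ V (q.coeff 0) :=
          (dvd_add_right (dvd_mul_right _ _)).1 (hq ▸ (dvd_pow_self π m.succ_ne_zero).trans h)
        exact hπ.not_isUnit (isUnit_of_dvd_unit h1 ((Ne.isUnit h0).map (algebraMap ℂ V)))
      rw [hq, h0, map_zero, add_zero, pow_succ', mul_dvd_mul_iff_left hπ.ne_zero] at h
      rw [← X_mul_divX_add q, h0, C_0, add_zero, pow_succ']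
      exact mul_dvd_mul_left _ (ih _ h)
  · rintro ⟨r, rfl⟩
    simp

theorem exists_polynomial_arc [IsDiscreteValuationRing V] {n : ℕ} (hres : ∀ x : V, ∃ c : ℂ,
      x - algebraMap ℂ V c ∈ IsLocalRing.maximalIdeal V) {π : V} (hπ : Irreducible π)
    (z : Fin n → V) (hz : ∀ i, z i ∈ IsLocalRing.maximalIdeal V) {N : ℕ} (hN : 1 ≤ N) :
    ∃ γ : Fin n → ℂ[X], (∀ i, X ∣ γ i) ∧ ∀ (F : MvPolynomial (Fin n) ℂ) (m : ℕ), m ≤ N →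
      (X ^ m ∣ MvPolynomial.aeval γ F ↔ π ^ m ∣ MvPolynomial.aeval z F) := by
  choose γ hγ using fun i => exists_aeval_sub_dvd hres hπ (z i) N
  have hcomp : ∀ F : MvPolynomial (Fin n) ℂ, aeval π (MvPolynomial.aeval γ F)
      = MvPolynomial.aeval (fun i => aeval π (γ i)) F := fun F => by
    rw [← MvPolynomial.comp_aeval_apply]
  refine ⟨γ, fun i => ?_, fun F m hm => ?_⟩
  · have h1 : π ^ 1 ∣ aeval π (γ i) := by
      have h2 : π ^ 1 ∣ z i - aeval π (γ i) := (pow_dvd_pow _ hN).trans (hγ i)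
      have h3 := hz i
      rw [hπ.maximalIdeal_eq, Ideal.mem_span_singleton] at h3
      rw [pow_one] at h2 ⊢
      exact (dvd_sub_right h3).1 h2
    simpa using (pow_dvd_aeval_iff hπ _ _).1 h1
  · rw [← pow_dvd_aeval_iff hπ, hcomp]
    have h1 : π ^ m ∣ MvPolynomial.aeval z F - MvPolynomial.aeval (fun i => aeval π (γ i)) F := by
      rw [← Ideal.mem_span_singleton, ← Ideal.Quotient.eq_zero_iff_mem, map_sub, sub_eq_zero]
      have h2 := fun (w : Fin n → V) => MvPolynomial.comp_aeval_apply (φ := Ideal.Quotient.mkₐ ℂ (Ideal.span {π ^ m})) w F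
      refine (h2 z).trans (Eq.trans ?_ (h2 _).symm)
      congr 2
      ext i
      refine Ideal.Quotient.eq.2 (Ideal.mem_span_singleton.2 ?_)
      exact (pow_dvd_pow _ hm).trans (hγ i)
    exact (dvd_iff_dvd_of_dvd_sub h1).symm
end

end

section

open scoped Polynomial

theorem sup_pow_le_mul_sup_pow {R : Type*} [CommRing R] (J K : Ideal R) (M : ℕ) :
    (J ⊔ K) ^ (M + 1) ≤ J * (J ⊔ K) ^ M ⊔ K ^ (M + 1) := by
  induction M with
  | zero => simp
  | succ M ih =>
    calc (J ⊔ K) ^ (M + 1 + 1) = J * (J ⊔ K) ^ (M + 1) ⊔ K * (J ⊔ K) ^ (M + 1) := by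
          rw [pow_succ' _ (M + 1), Ideal.sup_mul]
      _ ≤ J * (J ⊔ K) ^ (M + 1) ⊔ K * (J * (J ⊔ K) ^ M ⊔ K ^ (M + 1)) := by gcongr
      _ ≤ _ := by
          rw [Ideal.mul_sup, ← pow_succ' K]
          refine sup_le le_sup_left (sup_le (le_sup_of_le_left ?_) le_sup_right)
          calc K * (J * (J ⊔ K) ^ M) = J * (K * (J ⊔ K) ^ M) := by ring
            _ ≤ J * ((J ⊔ K) * (J ⊔ K) ^ M) := by gcongr; exact le_sup_right
            _ = _ := by rw [pow_succ']

theorem pow_le_of_pow_le_mul_sup {R : Type*} [CommRing R] (J H m : Ideal R) (M : ℕ)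
    (h : H ^ (M + 1) ≤ J * H ^ M ⊔ m * H ^ (M + 1)) (l N : ℕ) :
    H ^ (M + l) ≤ J ^ l ⊔ m ^ N := by
  have h1 : H ^ (M + 1) ≤ J * H ^ M ⊔ m ^ N := by
    induction N with
    | zero => simp
    | succ N ih =>
      calc H ^ (M + 1) ≤ J * H ^ M ⊔ m * H ^ (M + 1) := h
        _ ≤ J * H ^ M ⊔ m * (J * H ^ M ⊔ m ^ N) := by gcongr
        _ ≤ _ := by
          rw [Ideal.mul_sup, ← pow_succ']
          exact sup_le le_sup_left (sup_le (le_sup_of_le_left Ideal.mul_le_right) le_sup_right)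
  have h2 : H ^ (M + l) ≤ J ^ l * H ^ M ⊔ m ^ N := by
    induction l with
    | zero => simp
    | succ l ih =>
      calc H ^ (M + (l + 1)) = H ^ l * H ^ (M + 1) := by ring
        _ ≤ H ^ l * (J * H ^ M ⊔ m ^ N) := by gcongr
        _ = J * H ^ (M + l) ⊔ H ^ l * m ^ N := by rw [Ideal.mul_sup]; ring_nf
        _ ≤ J * (J ^ l * H ^ M ⊔ m ^ N) ⊔ m ^ N := by gcongr; exact Ideal.mul_le_right
        _ ≤ _ := by
          rw [Ideal.mul_sup, pow_succ', mul_assoc]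
          exact sup_le (sup_le le_sup_left (le_sup_of_le_right Ideal.mul_le_right)) le_sup_right
  exact h2.trans (sup_le_sup_right Ideal.mul_le_left _)

open MvPolynomial in
theorem exists_rees_relation {n : ℕ} {κ : Type} (G : κ → MvPolynomial (Fin n) ℂ)
    (Y : MvPolynomial (Fin n) ℂ) (φ : MvPolynomial (Fin n ⊕ κ) ℂ →ₐ[ℂ] FractionRing (MvPolynomial (Fin n) ℂ))
    (hl : ∀ j, φ (X (Sum.inl j)) = algebraMap _ _ (X j : MvPolynomial (Fin n) ℂ))
    (hr : ∀ l, φ (X (Sum.inr l)) * algebraMap _ _ Y = algebraMap _ _ (G l))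
    (s : MvPolynomial (Fin n ⊕ κ) ℂ) :
    ∃ M₀, ∀ M ≥ M₀, ∃ p : MvPolynomial (Fin n) ℂ,
      algebraMap _ _ p = φ s * algebraMap _ (FractionRing (MvPolynomial (Fin n) ℂ)) Y ^ (M + 1) ∧
      p ∈ (Ideal.span (Set.range G) ⊔ Ideal.span {Y}) ^ (M + 1) ∧
      p - C (constantCoeff s) * Y ^ (M + 1) ∈
        Ideal.span (Set.range G) * (Ideal.span (Set.range G) ⊔ Ideal.span {Y}) ^ M ⊔
        idealOfVars (Fin n) ℂ * (Ideal.span (Set.range G) ⊔ Ideal.span {Y}) ^ (M + 1) := by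
  set J := Ideal.span (Set.range G)
  set H := J ⊔ Ideal.span {Y}
  have hYH : Y ∈ H := Ideal.mem_sup_right (Ideal.mem_span_singleton_self Y)
  induction s using MvPolynomial.induction_on with
  | C c =>
    refine ⟨0, fun M _ => ⟨C c * Y ^ (M + 1), ?_, ?_, ?_⟩⟩
    · rw [map_mul, map_pow, algHom_C]
      rfl
    · exact Ideal.mul_mem_left _ _ (Ideal.pow_mem_pow hYH _)
    · simp
  | add s t hs ht =>
    obtain ⟨M₁, h₁⟩ := hs
    obtain ⟨M₂, h₂⟩ := ht
    refine ⟨max M₁ M₂, fun M hM => ?_⟩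
    obtain ⟨p, hp1, hp2, hp3⟩ := h₁ M (le_of_max_le_left hM)
    obtain ⟨q, hq1, hq2, hq3⟩ := h₂ M (le_of_max_le_right hM)
    refine ⟨p + q, ?_, add_mem hp2 hq2, ?_⟩
    · rw [map_add, map_add, hp1, hq1, add_mul]
    · convert add_mem hp3 hq3 using 1
      rw [map_add, C_add]
      ring
  | mul_X s i hs =>
    obtain ⟨M₁, h₁⟩ := hs
    rcases i with j | l
    · refine ⟨M₁, fun M hM => ?_⟩
      obtain ⟨p, hp1, hp2, hp3⟩ := h₁ M hM
      refine ⟨p * X j, ?_, Ideal.mul_mem_right _ _ hp2, ?_⟩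
      · rw [map_mul, map_mul, hp1, hl]
        ring
      · rw [map_mul, constantCoeff_X, mul_zero, C_0, zero_mul, sub_zero, mul_comm p]
        exact Ideal.mem_sup_right (Ideal.mul_mem_mul (Ideal.subset_span ⟨j, rfl⟩) hp2)
    · refine ⟨M₁ + 1, fun M hM => ?_⟩
      obtain ⟨M, rfl⟩ : ∃ M', M = M' + 1 := ⟨M - 1, by omega⟩
      obtain ⟨p, hp1, hp2, hp3⟩ := h₁ M (by omega)
      have hGJ : G l ∈ J := Ideal.subset_span ⟨l, rfl⟩
      refine ⟨G l * p, ?_, ?_, ?_⟩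
      · rw [map_mul, map_mul, hp1, ← hr]
        ring
      · rw [pow_succ' _ (M + 1)]
        exact Ideal.mul_mem_mul (Ideal.mem_sup_left hGJ) hp2
      · rw [map_mul, constantCoeff_X, mul_zero, C_0, zero_mul, sub_zero]
        exact Ideal.mem_sup_left (Ideal.mul_mem_mul hGJ hp2)

open MvPolynomial in
theorem X_pow_mem_of_forall_arc {n : ℕ} {κ : Type} [Finite κ] (G : κ → MvPolynomial (Fin n) ℂ)
    (i : Fin n) (a : ℕ)
    (harc : ∀ γ : Fin n → ℂ[X], (∀ j, Polynomial.X ∣ γ j) → ∀ e, Polynomial.X ^ e ∣ γ i →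
      ¬ Polynomial.X ^ (e + 1) ∣ γ i → ∃ l, ¬ Polynomial.X ^ (a * e + 1) ∣ aeval γ (G l)) :
    ∃ M, ∀ l N, (X i : MvPolynomial (Fin n) ℂ) ^ (a * (M + l)) ∈
      Ideal.span (Set.range G) ^ l ⊔ idealOfVars (Fin n) ℂ ^ N := by
  let F := FractionRing (MvPolynomial (Fin n) ℂ)
  let ι : MvPolynomial (Fin n) ℂ →ₐ[ℂ] F := IsScalarTower.toAlgHom _ _ _
  have hι : Function.Injective ι := IsFractionRing.injective (MvPolynomial (Fin n) ℂ) F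
  have hXi : ι (X i) ≠ 0 := fun h => MvPolynomial.X_ne_zero i (hι (h.trans (map_zero ι).symm))
  let φ : MvPolynomial (Fin n ⊕ κ) ℂ →ₐ[ℂ] F :=
    aeval (Sum.elim (fun j => ι (X j)) (fun l => ι (G l) / ι (X i) ^ a))
  have hl : ∀ j, φ (X (Sum.inl j)) = ι (X j) := fun j => by simp [φ]
  have hr : ∀ l, φ (X (Sum.inr l)) * ι (X i ^ a) = ι (G l) := fun l => by
    simp only [φ, aeval_X, Sum.elim_inr, map_pow]
    exact div_mul_cancel₀ _ (pow_ne_zero _ hXi)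
  by_cases hker : ∀ s, φ s = 0 → constantCoeff s = 0
  · exfalso
    let 𝔐 : Ideal (MvPolynomial (Fin n ⊕ κ) ℂ) := RingHom.ker (constantCoeff (R := ℂ))
    have h𝔐 : 𝔐.IsMaximal := RingHom.ker_isMaximal_of_surjective _ fun c => ⟨C c, by simp⟩
    have hprime : (RingHom.ker φ).IsPrime := RingHom.ker_isPrime _
    let q : MvPolynomial (Fin n ⊕ κ) ℂ →ₐ[ℂ] (MvPolynomial (Fin n ⊕ κ) ℂ ⧸ RingHom.ker φ) :=
      Ideal.Quotient.mkₐ ℂ (RingHom.ker φ)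
    have hqs : Function.Surjective q := Ideal.Quotient.mkₐ_surjective ℂ _
    have hQ : (𝔐.map q).IsMaximal := by
      refine (Ideal.map_eq_top_or_isMaximal_of_surjective q hqs h𝔐).resolve_left ?_
      intro htop
      have h1 := Ideal.comap_map_of_surjective q hqs 𝔐
      rw [htop, Ideal.comap_top] at h1
      have h2 : Ideal.comap q ⊥ ≤ 𝔐 := fun x hx => hker x (Ideal.Quotient.eq_zero_iff_mem.1 hx)
      exact h𝔐.ne_top ((sup_eq_left.2 h2).symm.trans h1.symm)
    have hX𝔐 : ∀ j, q (X j) ∈ 𝔐.map q := fun j =>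
      Ideal.mem_map_of_mem _ (show constantCoeff (X j) = 0 by simp)
    obtain ⟨V, i1, i2, i3, i4, ψ, hψ, hψQ, hres⟩ := exists_dvr_arc (𝔐.map q) (hX𝔐 (Sum.inl i))
      (fun h0 => hXi (by rw [← hl]; exact Ideal.Quotient.eq_zero_iff_mem.1 h0))
    let z : Fin n → V := fun j => ψ (q (X (Sum.inl j)))
    have hφι : φ.comp (rename Sum.inl) = ι := MvPolynomial.algHom_ext fun j => by
      rw [AlgHom.comp_apply, rename_X, hl]
    have hψz : (ψ.comp q).comp (rename Sum.inl) = aeval z := MvPolynomial.algHom_ext fun j => by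
      rw [AlgHom.comp_apply, rename_X, aeval_X]
      rfl
    have hrel : ∀ l, ψ (q (X (Sum.inr l))) * z i ^ a = aeval z (G l) := fun l => by
      have h1 : X (Sum.inr l) * X (Sum.inl i) ^ a - rename Sum.inl (G l) ∈ RingHom.ker φ := by
        rw [RingHom.mem_ker, map_sub, map_mul, map_pow, hl, ← map_pow, hr, sub_eq_zero]
        exact (DFunLike.congr_fun hφι (G l)).symm
      have h2 : q _ = 0 := Ideal.Quotient.eq_zero_iff_mem.2 h1
      have h3 := congrArg ψ h2
      rw [map_sub, map_sub, map_zero, sub_eq_zero, map_mul, map_mul, map_pow, map_pow] at h3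
      rw [h3]
      exact DFunLike.congr_fun hψz (G l)
    obtain ⟨π, hπ⟩ := IsDiscreteValuationRing.exists_irreducible V
    obtain ⟨e, u, hu⟩ := IsDiscreteValuationRing.eq_unit_mul_pow_irreducible hψ hπ
    have hu' : z i = u * π ^ e := hu
    obtain ⟨γ, hγ0, hγ⟩ := exists_polynomial_arc hres hπ z (fun j => hψQ _ (hX𝔐 _))
      (N := a * e + e + 1) (by omega)
    have hγi : ∀ m ≤ a * e + e + 1, Polynomial.X ^ m ∣ γ i ↔ m ≤ e := fun m hm => by
      have h1 := hγ (X i) m hm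
      rw [aeval_X, aeval_X, hu', u.isUnit.dvd_mul_left,
        pow_dvd_pow_iff hπ.ne_zero hπ.not_isUnit] at h1
      exact h1
    obtain ⟨l, hl'⟩ := harc γ hγ0 e ((hγi e (by omega)).2 le_rfl)
      (fun h => by have := (hγi (e + 1) (by omega)).1 h; omega)
    refine hl' ((hγ (G l) _ (by omega)).2 ?_)
    rw [← hrel, hu', pow_succ']
    refine mul_dvd_mul ?_ ?_
    · have := hψQ _ (hX𝔐 (Sum.inr l))
      rwa [hπ.maximalIdeal_eq, Ideal.mem_span_singleton] at this
    · rw [mul_pow, ← pow_mul, mul_comm e a]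
      exact dvd_mul_left _ _
  · push Not at hker
    obtain ⟨s, hs, hs0⟩ := hker
    obtain ⟨M, hM⟩ := exists_rees_relation G (X i ^ a) φ hl hr s
    obtain ⟨p, hp1, -, hp3⟩ := hM M le_rfl
    rw [hs, zero_mul] at hp1
    have hp0 : p = 0 := hι (hp1.trans (map_zero ι).symm)
    rw [hp0, zero_sub, neg_mem_iff] at hp3
    have hY := Ideal.mul_mem_left _ (C (constantCoeff s)⁻¹) hp3
    rw [← mul_assoc, ← C_mul, inv_mul_cancel₀ hs0, C_1, one_mul] at hY
    refine ⟨M, fun l N => ?_⟩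
    refine pow_le_of_pow_le_mul_sup (Ideal.span (Set.range G))
      (Ideal.span (Set.range G) ⊔ Ideal.span {X i ^ a}) _ M ?_ l N ?_
    · refine (sup_pow_le_mul_sup_pow _ _ _).trans (sup_le le_sup_left ?_)
      rwa [Ideal.span_singleton_pow, Ideal.span_singleton_le_iff_mem]
    · rw [pow_mul]
      exact Ideal.pow_mem_pow (Ideal.mem_sup_right (Ideal.mem_span_singleton_self _)) _

end

section

open MvPolynomial Filter
open scoped Topology Polynomial

/-- Coefficientwise convergence of a sequence of polynomials of bounded degree. -/
def PolyTendsto {n : ℕ} (g : ℕ → MvPolynomial (Fin n) ℂ) (Q : MvPolynomial (Fin n) ℂ) : Prop :=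
  (∃ D, ∀ j, (g j).totalDegree ≤ D) ∧
    ∀ d, Tendsto (fun j => coeff d (g j)) atTop (𝓝 (coeff d Q))

namespace PolyTendsto
variable {n : ℕ} {f g : ℕ → MvPolynomial (Fin n) ℂ} {P Q : MvPolynomial (Fin n) ℂ}

theorem const (Q : MvPolynomial (Fin n) ℂ) : PolyTendsto (fun _ => Q) Q :=
  ⟨⟨_, fun _ => le_rfl⟩, fun _ => tendsto_const_nhds⟩

theorem add (hf : PolyTendsto f P) (hg : PolyTendsto g Q) :
    PolyTendsto (fun j => f j + g j) (P + Q) := by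
  obtain ⟨⟨D, hD⟩, hf⟩ := hf
  obtain ⟨⟨E, hE⟩, hg⟩ := hg
  exact ⟨⟨max D E, fun j => (totalDegree_add _ _).trans (max_le_max (hD j) (hE j))⟩,
    fun d => by simpa using (hf d).add (hg d)⟩

theorem mul (hf : PolyTendsto f P) (hg : PolyTendsto g Q) :
    PolyTendsto (fun j => f j * g j) (P * Q) := by
  obtain ⟨⟨D, hD⟩, hf⟩ := hf
  obtain ⟨⟨E, hE⟩, hg⟩ := hg
  refine ⟨⟨D + E, fun j => (totalDegree_mul _ _).trans (add_le_add (hD j) (hE j))⟩, fun d => ?_⟩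
  simp only [coeff_mul]
  exact tendsto_finsetSum _ fun x _ => (hf _).mul (hg _)

theorem C {c : ℕ → ℂ} {a : ℂ} (h : Tendsto c atTop (𝓝 a)) :
    PolyTendsto (fun j => (MvPolynomial.C (c j) : MvPolynomial (Fin n) ℂ)) (MvPolynomial.C a) := by
  refine ⟨⟨0, fun j => by simp⟩, fun d => ?_⟩
  simp only [coeff_C]
  split_ifs
  · exact h
  · exact tendsto_const_nhds

theorem sum {ι : Type*} (s : Finset ι) {f : ι → ℕ → MvPolynomial (Fin n) ℂ}
    {P : ι → MvPolynomial (Fin n) ℂ} (h : ∀ i ∈ s, PolyTendsto (f i) (P i)) :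
    PolyTendsto (fun j => ∑ i ∈ s, f i j) (∑ i ∈ s, P i) := by
  induction s using Finset.cons_induction with
  | empty => simpa using const 0
  | cons i s hi ih =>
    simp only [Finset.sum_cons]
    exact (h i (by simp)).add (ih fun i hi => h i (by simp [hi]))

end PolyTendsto

/-- The ideal of limits of elements of a sequence of ideals. -/
def limIdeal {n : ℕ} (W : ℕ → Ideal (MvPolynomial (Fin n) ℂ)) : Ideal (MvPolynomial (Fin n) ℂ) where
  carrier := {Q | ∃ g : ℕ → MvPolynomial (Fin n) ℂ, (∀ j, g j ∈ W j) ∧ PolyTendsto g Q}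
  add_mem' := by
    rintro P Q ⟨f, hf, hf'⟩ ⟨g, hg, hg'⟩
    exact ⟨_, fun j => add_mem (hf j) (hg j), hf'.add hg'⟩
  zero_mem' := ⟨_, fun j => zero_mem _, PolyTendsto.const 0⟩
  smul_mem' := by
    rintro P Q ⟨g, hg, hg'⟩
    exact ⟨_, fun j => Ideal.mul_mem_left _ P (hg j), (PolyTendsto.const P).mul hg'⟩

theorem limIdeal_mul_le {n : ℕ} (W W' : ℕ → Ideal (MvPolynomial (Fin n) ℂ)) :
    limIdeal W * limIdeal W' ≤ limIdeal (fun j => W j * W' j) := by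
  refine Ideal.mul_le.2 ?_
  rintro P ⟨f, hf, hf'⟩ Q ⟨g, hg, hg'⟩
  exact ⟨_, fun j => Ideal.mul_mem_mul (hf j) (hg j), hf'.mul hg'⟩

theorem limIdeal_pow_le {n : ℕ} (W : ℕ → Ideal (MvPolynomial (Fin n) ℂ)) (k : ℕ) :
    limIdeal W ^ k ≤ limIdeal (fun j => W j ^ k) := by
  induction k with
  | zero =>
    intro P _
    exact ⟨_, fun j => by simp, PolyTendsto.const P⟩
  | succ k ih =>
    simp only [pow_succ]
    exact (Ideal.mul_mono_left ih).trans (limIdeal_mul_le _ _)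

/-- Monomials of degree at least `a` are limits of elements of `W j`, with differences of
smaller degree. -/
def MonomialsApprox {n : ℕ} (W : ℕ → Ideal (MvPolynomial (Fin n) ℂ)) (a : ℕ) : Prop :=
  ∀ β : Fin n →₀ ℕ, a ≤ β.degree → ∃ v : ℕ → MvPolynomial (Fin n) ℂ, (∀ j, v j ∈ W j) ∧
    PolyTendsto v (monomial β 1) ∧
    ∀ j, v j = monomial β 1 ∨ (monomial β 1 - v j).totalDegree + 1 ≤ β.degree

theorem MonomialsApprox.mul_ker_eval {n : ℕ} {W : ℕ → Ideal (MvPolynomial (Fin n) ℂ)} {a : ℕ}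
    (h : MonomialsApprox W a) {p : ℕ → Fin n → ℂ} (hp : Tendsto p atTop (𝓝 0)) :
    MonomialsApprox (fun j => RingHom.ker (eval (p j)) * W j) (a + 1) := by
  intro β hβ
  obtain ⟨i, hi⟩ : ∃ i, β i ≠ 0 := by
    by_contra! hcon
    have : β = 0 := Finsupp.ext hcon
    simp [this] at hβ
  obtain ⟨β', rfl⟩ : ∃ β', β = Finsupp.single i 1 + β' :=
    exists_add_of_le (Finsupp.single_le_iff.2 (Nat.one_le_iff_ne_zero.2 hi))
  have hdeg : (Finsupp.single i 1 + β').degree = β'.degree + 1 := by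
    rw [map_add, Finsupp.degree_single, add_comm]
  rw [hdeg] at hβ ⊢
  obtain ⟨v, hv, hlim, hd⟩ := h β' (by omega)
  have hmon : (monomial (Finsupp.single i 1 + β') 1 : MvPolynomial (Fin n) ℂ)
      = X i * monomial β' 1 := by
    rw [X, monomial_mul, one_mul]
  have hpi : Tendsto (fun j => -p j i) atTop (𝓝 0) := by
    simpa using ((tendsto_pi_nhds.1 hp) i).neg
  refine ⟨fun j => (X i + C (-p j i)) * v j, fun j => Ideal.mul_mem_mul ?_ (hv j), ?_, fun j => ?_⟩
  · simp [RingHom.mem_ker]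
  · rw [hmon]
    have h1 := (PolyTendsto.const (X i)).add (PolyTendsto.C (n := n) hpi)
    rw [C_0, add_zero] at h1
    exact h1.mul hlim
  · right
    have h1 : (monomial (Finsupp.single i 1 + β') 1 : MvPolynomial (Fin n) ℂ)
        - (X i + C (-p j i)) * v j = X i * (monomial β' 1 - v j) + C (p j i) * v j := by
      rw [hmon, C_neg]; ring
    have h2 : (v j).totalDegree ≤ β'.degree := by
      rcases hd j with h | h
      · rw [h]
        refine (totalDegree_monomial_le _ _).trans_eq rfl
      · have h3 : v j = monomial β' 1 - (monomial β' 1 - v j) := by ring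
        rw [h3]
        refine (totalDegree_sub _ _).trans (max_le ?_ (by omega))
        refine (totalDegree_monomial_le _ _).trans_eq rfl
    have h4 : (C (p j i) * v j).totalDegree ≤ β'.degree := by
      refine (totalDegree_mul _ _).trans ?_
      rw [totalDegree_C, zero_add]
      exact h2
    rw [h1]
    refine Nat.add_le_add_right ((totalDegree_add _ _).trans (max_le ?_ h4)) 1
    rcases hd j with h | h
    · simp [h]
    · refine (totalDegree_mul _ _).trans ?_
      rw [totalDegree_X]
      omega

theorem exists_sup_eq_top_of_limIdeal {n : ℕ} {W : ℕ → Ideal (MvPolynomial (Fin n) ℂ)} {a : ℕ}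
    (hW : MonomialsApprox W a) (A : Submodule ℂ (MvPolynomial (Fin n) ℂ))
    (hA : ∀ f, ∃ e ∈ A, f - e ∈ limIdeal W) :
    ∃ j, ∀ f, ∃ e ∈ A, f - e ∈ W j := by
  have hfin : ∀ L : ℕ, {β : Fin n →₀ ℕ | β.degree ≤ L}.Finite := fun L => by
    exact Finsupp.finite_of_degree_le L
  choose e he w hw hlim using fun β : Fin n →₀ ℕ => hA (monomial β 1)
  choose D hD using fun β => (hlim β).1
  obtain ⟨L, haL, hL⟩ : ∃ L, a ≤ L ∧ ∀ β : Fin n →₀ ℕ, β.degree ≤ a → D β ≤ L := by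
    refine ⟨max a ((hfin a).toFinset.sup D), le_max_left _ _, fun β hβ => le_max_of_le_right ?_⟩
    exact Finset.le_sup (by simpa using hβ)
  have key : ∀ β : Fin n →₀ ℕ, β.degree ≤ L → ∃ e ∈ A, ∃ v : ℕ → MvPolynomial (Fin n) ℂ,
      (∀ j, v j ∈ W j) ∧ PolyTendsto v (monomial β 1 - e) ∧ ∀ j, (v j).totalDegree ≤ L := by
    intro β hβ
    rcases le_total a β.degree with h | h
    · obtain ⟨v, hv, hvl, hd⟩ := hW β h
      refine ⟨0, zero_mem _, v, hv, by rwa [sub_zero], fun j => ?_⟩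
      have hm : (monomial β (1 : ℂ)).totalDegree ≤ β.degree :=
        (totalDegree_monomial_le _ _).trans_eq rfl
      rcases hd j with h | h
      · rw [h]
        exact hm.trans hβ
      · have h3 : v j = monomial β 1 - (monomial β 1 - v j) := by ring
        rw [h3]
        refine (totalDegree_sub _ _).trans (max_le (hm.trans hβ) (by omega))
    · exact ⟨e β, he β, w β, hw β, hlim β, fun j => (hD β j).trans (hL β h)⟩
  choose! e he v hv hlim hdeg using key
  have hev : ∀ᶠ j in atTop, ∀ β ∈ (hfin L).toFinset,
      ∑ d ∈ (hfin L).toFinset, ‖coeff d (monomial β 1 - e β - v β j)‖ < 1 := by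
    refine (Finset.eventually_all _).2 fun β hβ => ?_
    have hβ' : β.degree ≤ L := by simpa using hβ
    have : Tendsto (fun j => ∑ d ∈ (hfin L).toFinset, ‖coeff d (monomial β 1 - e β - v β j)‖)
        atTop (𝓝 (∑ d ∈ (hfin L).toFinset, 0)) := by
      refine tendsto_finsetSum _ fun d _ => ?_
      have h1 := ((hlim β hβ').2 d).const_sub (coeff d (monomial β 1 - e β))
      rw [sub_self] at h1
      simpa only [coeff_sub, norm_zero] using h1.norm
    rw [Finset.sum_const_zero] at this
    exact this.eventually (gt_mem_nhds one_pos)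
  obtain ⟨j, hj⟩ := hev.exists
  refine ⟨j, ?_⟩
  by_contra hcon
  have hlt : A ⊔ (W j).restrictScalars ℂ < ⊤ := by
    refine lt_top_iff_ne_top.2 fun htop => hcon fun f => ?_
    have hf : f ∈ A ⊔ (W j).restrictScalars ℂ := htop ▸ Submodule.mem_top
    obtain ⟨e, he, w, hw, rfl⟩ := Submodule.mem_sup.1 hf
    exact ⟨e, he, by simpa using hw⟩
  obtain ⟨Λ, hΛ0, hΛ⟩ := Submodule.exists_le_ker_of_lt_top _ hlt
  have hΛA : ∀ f ∈ A, Λ f = 0 := fun f hf => hΛ (Submodule.mem_sup_left hf)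
  have hΛW : ∀ f ∈ W j, Λ f = 0 := fun f hf => hΛ (Submodule.mem_sup_right hf)
  have hbound : ∀ f : MvPolynomial (Fin n) ℂ, ∀ c : ℝ, ∀ s : Finset (Fin n →₀ ℕ), f.support ⊆ s →
      (∀ β ∈ s, ‖Λ (monomial β 1)‖ ≤ c) → ‖Λ f‖ ≤ (∑ d ∈ s, ‖coeff d f‖) * c := by
    intro f c s hs hc
    have h1 : f = ∑ d ∈ s, coeff d f • monomial d (1 : ℂ) := by
      conv_lhs => rw [f.as_sum]
      refine (Finset.sum_subset hs fun d _ hd => ?_).trans (Finset.sum_congr rfl fun d _ => ?_)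
      · rw [notMem_support_iff.1 hd, monomial_zero]
      · rw [smul_monomial, smul_eq_mul, mul_one]
    conv_lhs => rw [h1]
    rw [map_sum, Finset.sum_mul]
    refine (norm_sum_le _ _).trans (Finset.sum_le_sum fun d hd => ?_)
    rw [map_smul, norm_smul]
    exact mul_le_mul_of_nonneg_left (hc d hd) (norm_nonneg _)
  have hall : ∀ β : Fin n →₀ ℕ, β.degree ≤ L → Λ (monomial β 1) = 0 := by
    by_contra! hne
    obtain ⟨β₀, hβ₀, hβ₀'⟩ := hne
    obtain ⟨β, hβ, hmax⟩ := Finset.exists_max_image (hfin L).toFinset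
      (fun β => ‖Λ (monomial β 1)‖) ⟨β₀, by simpa using hβ₀⟩
    have hβL : β.degree ≤ L := by simpa using hβ
    have hpos : 0 < ‖Λ (monomial β 1)‖ :=
      (norm_pos_iff.2 hβ₀').trans_le (hmax β₀ (by simpa using hβ₀))
    have h1 : Λ (monomial β 1 - e β - v β j) = Λ (monomial β 1) := by
      rw [map_sub, map_sub, hΛA _ (he β hβL), hΛW _ (hv β hβL j), sub_zero, sub_zero]
    have hsupp : (monomial β 1 - e β - v β j).support ⊆ (hfin L).toFinset := by
      intro d hd
      by_contra hdL
      have hdL' : L < d.degree := by simpa using hdL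
      have hv0 : ∀ i, coeff d (v β i) = 0 := fun i =>
        coeff_eq_zero_of_totalDegree_lt ((hdeg β hβL i).trans_lt hdL')
      have h2 : coeff d (monomial β 1 - e β) = 0 := by
        have h3 := (hlim β hβL).2 d
        simp only [hv0] at h3
        exact tendsto_nhds_unique h3 tendsto_const_nhds
      rw [mem_support_iff, coeff_sub, h2, hv0, sub_zero] at hd
      exact hd rfl
    have h2 := hbound _ _ _ hsupp hmax
    rw [h1] at h2
    have h3 := hj β hβ
    nlinarith
  refine hΛ0 ?_
  have hmono : ∀ N, ∀ β : Fin n →₀ ℕ, β.degree = N → Λ (monomial β 1) = 0 := by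
    intro N
    induction N using Nat.strong_induction_on with
    | _ N ih =>
      intro β hβ
      rcases le_or_gt N L with h | h
      · exact hall β (hβ ▸ h)
      · obtain ⟨u, hu, -, hd⟩ := hW β (by omega)
        rcases hd j with h' | h'
        · rw [← h']
          exact hΛW _ (hu j)
        · have h1 := hbound (monomial β 1 - u j) 0 _ subset_rfl fun d hd => by
            have h3 : d.degree ≤ _ := le_totalDegree hd
            rw [ih d.degree (by omega) d rfl, norm_zero]
          rw [mul_zero, map_sub, hΛW _ (hu j), sub_zero] at h1
          exact norm_le_zero_iff.1 h1
  refine LinearMap.ext fun f => ?_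
  have h1 := hbound f 0 _ subset_rfl fun d _ => by rw [hmono _ d rfl, norm_zero]
  rw [mul_zero] at h1
  exact norm_le_zero_iff.1 h1

end

section

open Filter
open scoped Topology

/-- The number of exponents in `n` variables of degree less than `k`. -/
noncomputable def numExponents (n k : ℕ) : ℕ := Nat.card {q : Fin n → ℕ // ∑ i, q i < k}

instance finite_exponents (n k : ℕ) : Finite {q : Fin n → ℕ // ∑ i, q i < k} := by
  refine Finite.of_injective (β := Fin n → Fin k) (fun q i => ⟨q.1 i, ?_⟩) fun p q h => ?_
  · exact (Finset.single_le_sum (fun _ _ => Nat.zero_le _) (Finset.mem_univ i)).trans_lt q.2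
  · ext i
    simpa using congrFun h i

theorem numExponents_le_pow (n k : ℕ) : numExponents n k ≤ k ^ n := by
  have h : Nat.card (Fin n → Fin k) = k ^ n := by simp
  rw [← h]
  refine Nat.card_le_card_of_injective (fun q : {q : Fin n → ℕ // ∑ i, q i < k} =>
    fun i => (⟨q.1 i, ?_⟩ : Fin k)) fun p q h => ?_
  · exact (Finset.single_le_sum (fun _ _ => Nat.zero_le _) (Finset.mem_univ i)).trans_lt q.2
  · ext i
    simpa using congrFun h i

theorem one_le_numExponents {n k : ℕ} (hk : 0 < k) : 1 ≤ numExponents n k := by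
  have : Nonempty {q : Fin n → ℕ // ∑ i, q i < k} := ⟨⟨0, by simpa⟩⟩
  exact Nat.card_pos

theorem pow_mul_numExponents_le (n b k : ℕ) (hb : 0 < b) :
    b ^ n * numExponents n k ≤ numExponents n (b * (k + n)) := by
  have h : Nat.card ((Fin n → Fin b) × {q : Fin n → ℕ // ∑ i, q i < k})
      = b ^ n * numExponents n k := by simp [numExponents, Nat.card_prod]
  rw [← h]
  refine Nat.card_le_card_of_injective (fun x => ⟨fun i => b * x.2.1 i + x.1 i, ?_⟩)
    fun x y hxy => ?_
  · have h1 : ∑ i, (b * x.2.1 i + (x.1 i : ℕ)) ≤ b * ∑ i, x.2.1 i + n * (b - 1) := by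
      rw [Finset.sum_add_distrib, Finset.mul_sum]
      refine Nat.add_le_add_left ?_ _
      refine (Finset.sum_le_card_nsmul _ _ (b - 1) fun i _ => ?_).trans (by simp)
      have := (x.1 i).2
      omega
    have h2 := x.2.2
    have h3 : n * (b - 1) ≤ b * n := by
      rw [mul_comm]; exact Nat.mul_le_mul_right _ (Nat.sub_le _ _)
    have h4 : b * ∑ i, x.2.1 i < b * k := Nat.mul_lt_mul_of_pos_left h2 hb
    rw [mul_add]
    exact h1.trans_lt (by omega)
  · have h1 := fun i => congrFun (congrArg Subtype.val hxy) i
    simp only at h1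
    have h2 : ∀ i, x.2.1 i = y.2.1 i ∧ (x.1 i : ℕ) = y.1 i := fun i => by
      have e1 := congrArg (· / b) (h1 i)
      have e2 := congrArg (· % b) (h1 i)
      simp only [Nat.mul_add_div hb, Nat.mul_add_mod, Nat.div_eq_of_lt (x.1 i).2,
        Nat.div_eq_of_lt (y.1 i).2, Nat.mod_eq_of_lt (x.1 i).2, Nat.mod_eq_of_lt (y.1 i).2,
        add_zero] at e1 e2
      exact ⟨e1, e2⟩
    refine Prod.ext (funext fun i => Fin.ext (h2 i).2) (Subtype.ext (funext fun i => (h2 i).1))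

/-- Exponents whose quotient by the weights `w` has degree less than `Q`. -/
abbrev WeightedExponents {n : ℕ} (w : Fin n → ℕ) (Q : ℕ) : Type :=
  {α : Fin n → ℕ // ∑ i, α i / w i < Q}

theorem weightedExponents_finite_and_card_le {n : ℕ} (w : Fin n → ℕ) (hw : ∀ i, 0 < w i) (Q : ℕ) :
    Finite (WeightedExponents w Q) ∧
      Nat.card (WeightedExponents w Q) ≤ (∏ i, w i) * numExponents n Q := by
  have h : Nat.card ((∀ i, Fin (w i)) × {q : Fin n → ℕ // ∑ i, q i < Q})
      = (∏ i, w i) * numExponents n Q := by simp [numExponents, Nat.card_prod]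
  let f : WeightedExponents w Q → (∀ i, Fin (w i)) × {q : Fin n → ℕ // ∑ i, q i < Q} :=
    fun α => (fun i => ⟨α.1 i % w i, Nat.mod_lt _ (hw i)⟩, ⟨fun i => α.1 i / w i, α.2⟩)
  have hf : Function.Injective f := fun α β h => by
    ext i
    have h1 := congrArg (fun x => (x.1 i : ℕ)) h
    have h2 := congrArg (fun x => x.2.1 i) h
    simp only [f] at h1 h2
    rw [← Nat.div_add_mod (α.1 i) (w i), ← Nat.div_add_mod (β.1 i) (w i), h1, h2]
  exact ⟨Finite.of_injective f hf, h ▸ Nat.card_le_card_of_injective f hf⟩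

theorem mul_pow_le_of_forall_numExponents {n K b B c : ℕ} (hb : 0 < b)
    (h : ∀ k, K * numExponents n (b * k) ≤ B * numExponents n (k + c)) : K * b ^ n ≤ B := by
  by_contra! hlt
  have hstep : ∀ k, (B + 1) * numExponents n k ≤ B * numExponents n (k + (c + n)) := fun k =>
    calc (B + 1) * numExponents n k ≤ K * b ^ n * numExponents n k := Nat.mul_le_mul_right _ hlt
      _ = K * (b ^ n * numExponents n k) := mul_assoc _ _ _
      _ ≤ K * numExponents n (b * (k + n)) :=
        Nat.mul_le_mul_left _ (pow_mul_numExponents_le n b k hb)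
      _ ≤ B * numExponents n (k + n + c) := h _
      _ = _ := by rw [add_assoc, add_comm n c]
  have hB : 0 < B := by
    rcases Nat.eq_zero_or_pos B with h0 | h0
    · have := hstep 1
      have h1 := one_le_numExponents (n := n) (k := 1) one_pos
      rw [h0] at this
      omega
    · exact h0
  have hiter : ∀ m, (B + 1) ^ m ≤ B ^ m * numExponents n (1 + m * (c + n)) := by
    intro m
    induction m with
    | zero => simpa using one_le_numExponents (n := n) (k := 1) one_pos
    | succ m ih =>
      calc (B + 1) ^ (m + 1) = (B + 1) ^ m * (B + 1) := pow_succ _ _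
        _ ≤ B ^ m * numExponents n (1 + m * (c + n)) * (B + 1) := Nat.mul_le_mul_right _ ih
        _ = B ^ m * ((B + 1) * numExponents n (1 + m * (c + n))) := by ring
        _ ≤ B ^ m * (B * numExponents n (1 + m * (c + n) + (c + n))) :=
          Nat.mul_le_mul_left _ (hstep _)
        _ = _ := by rw [pow_succ, mul_assoc, add_assoc, Nat.succ_mul]
  have hr0 : (0 : ℝ) < (B : ℝ) / (B + 1) := by positivity
  have hr1 : |(B : ℝ) / (B + 1)| < 1 := by
    rw [abs_of_pos hr0, div_lt_one (by positivity)]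
    linarith
  have hlim := (tendsto_pow_const_mul_const_pow_of_abs_lt_one n hr1).const_mul
    ((1 + c + n : ℝ) ^ n)
  rw [mul_zero] at hlim
  obtain ⟨m, hm, hm1⟩ := ((hlim.eventually (gt_mem_nhds one_pos)).and (eventually_ge_atTop 1)).exists
  have h1 : ((B + 1 : ℕ) : ℝ) ^ m ≤ (B : ℝ) ^ m * ((1 + c + n) ^ n * m ^ n) := by
    have h2 := (hiter m).trans (Nat.mul_le_mul_left _ (numExponents_le_pow n _))
    have h3 : (1 + m * (c + n)) ^ n ≤ (1 + c + n) ^ n * m ^ n := by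
      rw [← mul_pow]
      exact Nat.pow_le_pow_left (by nlinarith) _
    exact_mod_cast h2.trans (Nat.mul_le_mul_left _ h3)
  rw [div_pow] at hm
  have hp : (0 : ℝ) < ((B : ℝ) + 1) ^ m := by positivity
  have h4 : (1 + c + n : ℝ) ^ n * (m ^ n * (B ^ m / (B + 1) ^ m)) * (B + 1) ^ m < 1 * (B + 1) ^ m :=
    mul_lt_mul_of_pos_right hm hp
  have h5 : (1 + c + n : ℝ) ^ n * (m ^ n * (B ^ m / (B + 1) ^ m)) * (B + 1) ^ m
      = (B : ℝ) ^ m * ((1 + c + n) ^ n * m ^ n) := by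
    field_simp
  push_cast at h1
  linarith

end

section

open MvPolynomial Filter
open scoped Topology

theorem mem_idealOfVars_iff {n : ℕ} {f : MvPolynomial (Fin n) ℂ} :
    f ∈ idealOfVars (Fin n) ℂ ↔ constantCoeff f = 0 := by
  have h := mem_pow_idealOfVars_iff' 1 f
  rw [pow_one] at h
  rw [h, constantCoeff_eq]
  refine ⟨fun h => h 0 (by simp), fun h x hx => ?_⟩
  have : x = 0 := (Finsupp.degree_eq_zero_iff x).1 (by omega)
  rwa [this]

/-- Translation of polynomials by `p`. -/
noncomputable def polyTranslate {n : ℕ} (p : Fin n → ℂ) :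
    MvPolynomial (Fin n) ℂ →ₐ[ℂ] MvPolynomial (Fin n) ℂ :=
  aeval fun i => X i + C (p i)

theorem constantCoeff_polyTranslate {n : ℕ} (p : Fin n → ℂ) (f : MvPolynomial (Fin n) ℂ) :
    constantCoeff (polyTranslate p f) = eval p f := by
  induction f using MvPolynomial.induction_on with
  | C a => simp [polyTranslate]
  | add f g hf hg => rw [map_add, map_add, map_add, hf, hg]
  | mul_X f i hf => rw [map_mul, map_mul, map_mul, hf]; simp [polyTranslate]

theorem polyTranslate_neg {n : ℕ} (p : Fin n → ℂ) (f : MvPolynomial (Fin n) ℂ) :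
    polyTranslate p (polyTranslate (-p) f) = f := by
  induction f using MvPolynomial.induction_on with
  | C a => simp [polyTranslate]
  | add f g hf hg => rw [map_add, map_add, hf, hg]
  | mul_X f i hf => rw [map_mul, map_mul, hf]; simp [polyTranslate]

theorem polyTranslate_mem_pow {n k : ℕ} {p : Fin n → ℂ} {f : MvPolynomial (Fin n) ℂ}
    (hf : f ∈ RingHom.ker (eval p) ^ k) : polyTranslate p f ∈ idealOfVars (Fin n) ℂ ^ k := by
  have h1 : Ideal.map (polyTranslate p).toRingHom (RingHom.ker (eval p)) ≤ idealOfVars (Fin n) ℂ := by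
    rw [Ideal.map_le_iff_le_comap]
    intro g hg
    rw [Ideal.mem_comap, mem_idealOfVars_iff]
    exact (constantCoeff_polyTranslate p g).trans hg
  have h2 := Ideal.mem_map_of_mem (polyTranslate p).toRingHom hf
  rw [Ideal.map_pow] at h2
  exact Ideal.pow_right_mono h1 k h2

theorem isCoprime_ker_eval {n : ℕ} {p q : Fin n → ℂ} (h : p ≠ q) :
    IsCoprime (RingHom.ker (eval p)) (RingHom.ker (eval q)) := by
  obtain ⟨i, hi⟩ := Function.ne_iff.1 h
  have hi' : q i - p i ≠ 0 := sub_ne_zero.2 hi.symm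
  rw [Ideal.isCoprime_iff_exists]
  refine ⟨C (q i - p i)⁻¹ * (X i - C (p i)), by simp [RingHom.mem_ker],
    -(C (q i - p i)⁻¹ * (X i - C (q i))), by simp [RingHom.mem_ker], ?_⟩
  have : (C (q i - p i)⁻¹ * (X i - C (p i)) + -(C (q i - p i)⁻¹ * (X i - C (q i))) :
      MvPolynomial (Fin n) ℂ) = C ((q i - p i)⁻¹ * (q i - p i)) := by
    rw [C_mul, C_sub]; ring
  rw [this, inv_mul_cancel₀ hi', C_1]

theorem mul_numExponents_le_card {n K k : ℕ} {p : Fin K → Fin n → ℂ} (hp : Function.Injective p)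
    {E : Type} [Finite E] (μ : E → MvPolynomial (Fin n) ℂ)
    (h : ∀ f, ∃ e ∈ Submodule.span ℂ (Set.range μ), f - e ∈ ∏ s, RingHom.ker (eval (p s)) ^ k) :
    K * numExponents n k ≤ Nat.card E := by
  have : Fintype E := Fintype.ofFinite E
  have : Fintype {q : Fin n → ℕ // ∑ i, q i < k} := Fintype.ofFinite _
  let Φ : MvPolynomial (Fin n) ℂ →ₗ[ℂ] (Fin K × {q : Fin n → ℕ // ∑ i, q i < k} → ℂ) :=
    LinearMap.pi fun x => (lcoeff ℂ (Finsupp.equivFunOnFinite.symm x.2.1)) ∘ₗ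
      (polyTranslate (p x.1)).toLinearMap
  have hΦ : ∀ f s q, Φ f (s, q) = coeff (Finsupp.equivFunOnFinite.symm q.1) (polyTranslate (p s) f) :=
    fun _ _ _ => rfl
  have hdeg : ∀ q : {q : Fin n → ℕ // ∑ i, q i < k},
      (Finsupp.equivFunOnFinite.symm q.1).degree < k := fun q => by
    rw [Finsupp.degree_eq_sum]
    exact q.2
  have hker : ∀ f, ∀ s, ∀ q, f ∈ RingHom.ker (eval (p s)) ^ k → Φ f (s, q) = 0 := fun f s q hf =>
    (mem_pow_idealOfVars_iff' k _).1 (polyTranslate_mem_pow hf) _ (hdeg q)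
  have hsurj : ∀ y, ∃ f, Φ f = y := by
    intro y
    obtain ⟨f, hf⟩ := Ideal.exists_forall_sub_mem_ideal
      (I := fun s : Fin K => RingHom.ker (eval (p s)) ^ k)
      (fun s s' hs => IsCoprime.pow (isCoprime_ker_eval (hp.ne hs)))
      (fun s => polyTranslate (-p s) (∑ q : {q : Fin n → ℕ // ∑ i, q i < k},
        monomial (Finsupp.equivFunOnFinite.symm q.1) (y (s, q))))
    refine ⟨f, funext fun ⟨s, q⟩ => ?_⟩
    have h1 := hker _ s q (hf s)
    rw [map_sub, Pi.sub_apply, sub_eq_zero] at h1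
    rw [h1, hΦ, polyTranslate_neg, coeff_sum, Finset.sum_eq_single q]
    · simp
    · intro q' _ hq'
      rw [coeff_monomial, if_neg]
      exact fun h => hq' (Subtype.ext (Finsupp.equivFunOnFinite.symm.injective h))
    · simp
  have hsurj' : Function.Surjective (Φ.domRestrict (Submodule.span ℂ (Set.range μ))) := by
    intro y
    obtain ⟨f, rfl⟩ := hsurj y
    obtain ⟨e, he, hfe⟩ := h f
    refine ⟨⟨e, he⟩, funext fun ⟨s, q⟩ => ?_⟩
    have h2 : f - e ∈ RingHom.ker (eval (p s)) ^ k :=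
      (Ideal.prod_le_inf.trans (Finset.inf_le (Finset.mem_univ s))) hfe
    have h1 := hker _ s q h2
    rw [map_sub, Pi.sub_apply, sub_eq_zero] at h1
    exact h1.symm
  have hfin : Module.Finite ℂ (Submodule.span ℂ (Set.range μ)) :=
    Module.Finite.span_of_finite ℂ (Set.finite_range μ)
  have h1 := LinearMap.finrank_le_finrank_of_surjective hsurj'
  have h2 : Module.finrank ℂ (Submodule.span ℂ (Set.range μ)) ≤ Fintype.card E :=
    finrank_range_le_card μ
  rw [Module.finrank_fintype_fun_eq_card, Fintype.card_prod, Fintype.card_fin] at h1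
  rw [numExponents, Nat.card_eq_fintype_card, Nat.card_eq_fintype_card]
  exact h1.trans h2

theorem exists_coords_of_linearIndependent {n d : ℕ} (h : Fin d → MvPolynomial (Fin n) ℂ)
    (h0 : ∀ c, constantCoeff (h c) = 0)
    (hli : LinearIndependent ℂ fun c => fun i => coeff (Finsupp.single i 1) (h c)) :
    ∃ (u : Fin n → MvPolynomial (Fin n) ℂ) (S : Finset (Fin n)), S.card = d ∧
      (∀ i ∈ S, ∃ c, u i = h c) ∧ (∀ i ∉ S, ∃ j, u i = X j) ∧ (∀ i, constantCoeff (u i) = 0) ∧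
      ∀ i, ∃ c : Fin n → ℂ, X i - ∑ k, c k • u k ∈ idealOfVars (Fin n) ℂ ^ 2 := by
  classical
  set v : Fin d → Fin n → ℂ := fun c i => coeff (Finsupp.single i 1) (h c) with hv
  have hsub : Set.range v ⊆ Set.range v ∪ Set.range (fun j : Fin n => (Pi.single j 1 : Fin n → ℂ)) :=
    Set.subset_union_left
  obtain ⟨B, hBt, hsB, htB, hB⟩ := exists_linearIndepOn_id_extension hli.linearIndepOn_id hsub
  have hspan : ⊤ ≤ Submodule.span ℂ (Set.range ((↑) : B → Fin n → ℂ)) := by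
    rw [Subtype.range_coe]
    intro x _
    rw [← Finset.univ_sum_single x]
    refine Submodule.sum_mem _ fun i _ => ?_
    have : (Pi.single i (x i) : Fin n → ℂ) = x i • Pi.single i 1 := by
      rw [← Pi.single_smul, smul_eq_mul, mul_one]
    rw [this]
    exact Submodule.smul_mem _ _ (htB (Or.inr ⟨i, rfl⟩))
  let bas : Module.Basis B ℂ (Fin n → ℂ) := Module.Basis.mk hB hspan
  have : Finite B := Module.Finite.finite_basis bas
  have : Fintype B := Fintype.ofFinite B
  have hcard : Fintype.card B = n := by
    rw [← Module.finrank_eq_card_basis bas, Module.finrank_fin_fun]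
  let e : Fin n ≃ B := (Fintype.equivFinOfCardEq hcard).symm
  let S : Finset (Fin n) := Finset.univ.filter fun i => (e i : Fin n → ℂ) ∈ Set.range v
  have hS : S.card = d := by
    have h1 : Finset.card S = Fintype.card (Set.range v) := by
      have : Fintype {i // (e i : Fin n → ℂ) ∈ Set.range v} := Fintype.ofFinite _
      rw [← Fintype.card_subtype]
      refine Fintype.card_congr ⟨fun i => ⟨_, i.2⟩, fun x => ⟨e.symm ⟨x.1, hsB x.2⟩, by simp⟩,
        fun i => by simp, fun x => by simp⟩
    rw [h1, Set.card_range_of_injective hli.injective, Fintype.card_fin]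
  have hu : ∀ i, ∃ u : MvPolynomial (Fin n) ℂ, constantCoeff u = 0 ∧
      (∀ j, coeff (Finsupp.single j 1) u = (e i : Fin n → ℂ) j) ∧
      (i ∈ S → ∃ c, u = h c) ∧ (i ∉ S → ∃ j, u = X j) := by
    intro i
    by_cases hi : (e i : Fin n → ℂ) ∈ Set.range v
    · obtain ⟨c, hc⟩ := hi
      refine ⟨h c, h0 c, fun j => by rw [← hc], fun _ => ⟨c, rfl⟩, fun h => ?_⟩
      exact absurd (Finset.mem_filter.2 ⟨Finset.mem_univ i, ⟨c, hc⟩⟩) h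
    · obtain ⟨j, hj⟩ := (hBt (e i).2).resolve_left hi
      refine ⟨X j, constantCoeff_X ℂ j, fun k => ?_, fun h => ?_, fun _ => ⟨j, rfl⟩⟩
      · rw [← hj, coeff_X]
        simp only [Pi.single_apply, Finsupp.single_left_inj one_ne_zero, eq_comm]
      · exact absurd (Finset.mem_filter.1 h).2 hi
  choose u hu0 hu1 huS huS' using hu
  refine ⟨u, S, hS, fun i hi => huS i hi, fun i hi => huS' i hi, hu0, fun i => ?_⟩
  refine ⟨fun k => bas.repr (Pi.single i 1) (e k), ?_⟩
  rw [mem_pow_idealOfVars_iff']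
  intro x hx
  rw [coeff_sub, coeff_sum]
  simp only [coeff_smul]
  rcases Nat.lt_succ_iff_lt_or_eq.1 hx with hx0 | hx1
  · have : x = 0 := (Finsupp.degree_eq_zero_iff x).1 (by omega)
    have h2 : ∀ k, coeff 0 (u k) = 0 := fun k => by rw [← constantCoeff_eq]; exact hu0 k
    rw [this]
    simp [h2]
  · obtain ⟨j, rfl⟩ : ∃ j, x = Finsupp.single j 1 := by
      obtain ⟨i, hi⟩ : ∃ i, x i ≠ 0 := by
        by_contra! hcon
        have : x = 0 := Finsupp.ext hcon
        simp [this] at hx1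
      obtain ⟨x', rfl⟩ : ∃ x', x = Finsupp.single i 1 + x' :=
        exists_add_of_le (Finsupp.single_le_iff.2 (Nat.one_le_iff_ne_zero.2 hi))
      rw [map_add, Finsupp.degree_single] at hx1
      have : x' = 0 := (Finsupp.degree_eq_zero_iff x').1 (by omega)
      exact ⟨i, by rw [this, add_zero]⟩
    have h3 := congrFun (bas.sum_repr (Pi.single i 1)) j
    rw [Finset.sum_apply] at h3
    have h4 : ∑ k, bas.repr (Pi.single i 1) (e k) • coeff (Finsupp.single j 1) (u k)
        = (Pi.single i 1 : Fin n → ℂ) j := by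
      rw [← h3]
      refine Fintype.sum_equiv e _ _ fun k => ?_
      rw [hu1, Pi.smul_apply, show bas (e k) = (e k : Fin n → ℂ) from Module.Basis.mk_apply hB hspan _]
    rw [h4, coeff_X, Pi.single_apply, sub_eq_zero]
    simp only [Finsupp.single_left_inj one_ne_zero, eq_comm]

theorem exists_span_sub_mem_pow {n : ℕ} {u : Fin n → MvPolynomial (Fin n) ℂ}
    (hu0 : ∀ i, constantCoeff (u i) = 0)
    (hX : ∀ i, ∃ c : Fin n → ℂ, X i - ∑ k, c k • u k ∈ idealOfVars (Fin n) ℂ ^ 2) (N : ℕ)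
    (f : MvPolynomial (Fin n) ℂ) :
    ∃ g ∈ Submodule.span ℂ (Set.range fun α : Fin n → ℕ => ∏ i, u i ^ α i),
      f - g ∈ idealOfVars (Fin n) ℂ ^ N := by
  set m := idealOfVars (Fin n) ℂ with hm
  have hrange : ∀ p : MvPolynomial (Fin n) ℂ, aeval u p ∈
      Submodule.span ℂ (Set.range fun α : Fin n → ℕ => ∏ i, u i ^ α i) := by
    intro p
    rw [p.as_sum, map_sum]
    refine Submodule.sum_mem _ fun α _ => ?_
    rw [aeval_monomial, ← Algebra.smul_def]
    refine Submodule.smul_mem _ _ (Submodule.subset_span ⟨α, ?_⟩)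
    rw [Finsupp.prod_fintype _ _ fun i => pow_zero _]
  suffices h : ∃ p : MvPolynomial (Fin n) ℂ, f - aeval u p ∈ m ^ N from h.elim fun p hp => ⟨_, hrange p, hp⟩
  choose c hc using hX
  have hmon : ∀ L, ∀ β : Fin n →₀ ℕ, β.degree = L →
      ∃ p : MvPolynomial (Fin n) ℂ, aeval u p ∈ m ^ L ∧ monomial β 1 - aeval u p ∈ m ^ (L + 1) := by
    intro L
    induction L with
    | zero =>
      intro β hβ
      have : β = 0 := (Finsupp.degree_eq_zero_iff β).1 hβ
      exact ⟨1, by simp, by simp [this]⟩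
    | succ L ih =>
      intro β hβ
      obtain ⟨i, hi⟩ : ∃ i, β i ≠ 0 := by
        by_contra! hcon
        have : β = 0 := Finsupp.ext hcon
        simp [this] at hβ
      obtain ⟨β', rfl⟩ : ∃ β', β = Finsupp.single i 1 + β' :=
        exists_add_of_le (Finsupp.single_le_iff.2 (Nat.one_le_iff_ne_zero.2 hi))
      rw [map_add, Finsupp.degree_single] at hβ
      obtain ⟨p, hp, hp'⟩ := ih β' (by omega)
      have hy : aeval u (∑ k, c i k • X k : MvPolynomial (Fin n) ℂ) = ∑ k, c i k • u k := by simp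
      have hym : aeval u (∑ k, c i k • X k : MvPolynomial (Fin n) ℂ) ∈ m := by
        rw [hy]
        refine Submodule.sum_mem _ fun k _ => ?_
        rw [Algebra.smul_def]
        exact Ideal.mul_mem_left _ _ (mem_idealOfVars_iff.2 (hu0 k))
      have hmonm : (monomial β' 1 : MvPolynomial (Fin n) ℂ) ∈ m ^ L := by
        have h1 := add_mem (Ideal.pow_le_pow_right (Nat.le_succ L) hp') hp
        rwa [sub_add_cancel] at h1
      refine ⟨(∑ k, c i k • X k) * p, ?_, ?_⟩
      · rw [map_mul, pow_succ, mul_comm (m ^ L)]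
        exact Ideal.mul_mem_mul hym hp
      · have hX' : (monomial (Finsupp.single i 1 + β') 1 : MvPolynomial (Fin n) ℂ)
            = X i * monomial β' 1 := by rw [X, monomial_mul, one_mul]
        have h2 : X i * monomial β' 1 - aeval u ((∑ k, c i k • X k) * p)
            = (X i - ∑ k, c i k • u k) * monomial β' 1
              + aeval u (∑ k, c i k • X k : MvPolynomial (Fin n) ℂ) * (monomial β' 1 - aeval u p) := by
          rw [map_mul, hy]; ring
        rw [hX', h2]
        refine add_mem ?_ ?_
        · rw [show L + 1 + 1 = 2 + L by ring, pow_add]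
          exact Ideal.mul_mem_mul (hc i) hmonm
        · rw [pow_succ' m (L + 1)]
          exact Ideal.mul_mem_mul hym hp'
  induction N with
  | zero => exact ⟨0, by simp⟩
  | succ N ih =>
    obtain ⟨p, hp⟩ := ih
    set g := f - aeval u p with hg
    suffices h : ∃ q : MvPolynomial (Fin n) ℂ, g - aeval u q ∈ m ^ (N + 1) by
      obtain ⟨q, hq⟩ := h
      refine ⟨p + q, ?_⟩
      rwa [map_add, ← sub_sub]
    have hg0 := (mem_pow_idealOfVars_iff' N g).1 hp
    choose! y hy hy' using hmon
    refine ⟨∑ β ∈ g.support, coeff β g • (if β.degree = N then y N β else 0), ?_⟩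
    have h1 : g - aeval u (∑ β ∈ g.support, coeff β g • (if β.degree = N then y N β else 0))
        = ∑ β ∈ g.support, coeff β g •
          (monomial β 1 - aeval u (if β.degree = N then y N β else 0)) := by
      have hgs : g = ∑ β ∈ g.support, coeff β g • monomial β (1 : ℂ) := by
        conv_lhs => rw [g.as_sum]
        simp only [smul_monomial, smul_eq_mul, mul_one]
      nth_rewrite 1 [hgs]
      rw [map_sum, ← Finset.sum_sub_distrib]
      refine Finset.sum_congr rfl fun β _ => ?_
      rw [map_smul, smul_sub]
    rw [h1]
    refine Submodule.sum_mem _ fun β hβ => ?_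
    rw [Algebra.smul_def]
    refine Ideal.mul_mem_left _ _ ?_
    split_ifs with hd
    · exact hy' N β hd
    · have hd' : N + 1 ≤ β.degree := by
        by_contra hlt
        refine mem_support_iff.1 hβ (hg0 β ?_)
        omega
      rw [map_zero, sub_zero]
      rw [monomial_mem_pow_idealOfVars_iff _ _ one_ne_zero]
      exact hd'

end

section

open MvPolynomial Filter
open scoped Topology Polynomial

theorem not_X_pow_dvd_pow {q : ℂ[X]} {o b N : ℕ} (hq : ¬ Polynomial.X ^ (o + 1) ∣ q)
    (hN : b * o < N) : ¬ Polynomial.X ^ N ∣ q ^ b := by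
  have hq0 : q ≠ 0 := fun h => hq (h ▸ dvd_zero _)
  obtain ⟨r, q', hq', rfl⟩ : ∃ r q', ¬ Polynomial.X ∣ q' ∧ q = Polynomial.X ^ r * q' := by
    obtain ⟨r, q', h1, h2⟩ := WfDvdMonoid.max_power_factor hq0 Polynomial.irreducible_X
    exact ⟨r, q', h1, h2⟩
  intro h
  have hr : r ≤ o := by
    by_contra hlt
    exact hq ((pow_dvd_pow _ (by omega)).mul_right _)
  have h1 : (Polynomial.X : ℂ[X]) ^ (b * r + 1) ∣ Polynomial.X ^ (b * r) * q' ^ b := by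
    refine (pow_dvd_pow _ ?_).trans (h.trans (dvd_of_eq ?_))
    · have := Nat.mul_le_mul_left b hr
      omega
    · rw [mul_pow, ← pow_mul, mul_comm r b]
  rw [pow_succ] at h1
  exact hq' (Polynomial.prime_X.dvd_of_dvd_pow
    ((mul_dvd_mul_iff_left (pow_ne_zero _ Polynomial.X_ne_zero)).1 h1))

theorem prod_mem_pow_sup {R ι : Type*} [CommRing R] (J L : Ideal R) (s : Finset ι) (f : ι → R)
    (l : ι → ℕ) (h : ∀ i ∈ s, f i ∈ J ^ l i ⊔ L) : ∏ i ∈ s, f i ∈ J ^ (∑ i ∈ s, l i) ⊔ L := by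
  induction s using Finset.cons_induction with
  | empty => simp
  | cons i s hi ih =>
    rw [Finset.prod_cons, Finset.sum_cons]
    have h1 := Ideal.mul_mem_mul (h i (by simp)) (ih fun i hi => h i (by simp [hi]))
    refine (Ideal.mul_le.2 fun x hx y hy => ?_ :
      (J ^ l i ⊔ L) * (J ^ (∑ i ∈ s, l i) ⊔ L) ≤ J ^ (l i + ∑ i ∈ s, l i) ⊔ L) h1
    obtain ⟨x1, hx1, x2, hx2, rfl⟩ := Submodule.mem_sup.1 hx
    obtain ⟨y1, hy1, y2, hy2, rfl⟩ := Submodule.mem_sup.1 hy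
    have h2 : (x1 + x2) * (y1 + y2) = x1 * y1 + (x2 * (y1 + y2) + y2 * x1) := by ring
    rw [h2, pow_add]
    exact Submodule.add_mem_sup (Ideal.mul_mem_mul hx1 hy1)
      (add_mem (Ideal.mul_mem_right _ _ hx2) (Ideal.mul_mem_right _ _ hy2))

theorem monomialsApprox_prod_pow {n : ℕ} (k K : ℕ) (S : Fin K → ℕ → Fin n → ℂ)
    (hS : ∀ s, Tendsto (S s) atTop (𝓝 0)) :
    MonomialsApprox (fun j => ∏ s, RingHom.ker (eval (S s j)) ^ k) (k * K) := by
  induction K with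
  | zero =>
    intro β _
    exact ⟨fun _ => monomial β 1, fun j => by simp, PolyTendsto.const _, fun j => Or.inl rfl⟩
  | succ K ih =>
    simp only [Fin.prod_univ_succ]
    have h0 := ih (fun s => S s.succ) fun s => hS _
    have h1 : ∀ l, MonomialsApprox (fun j => RingHom.ker (eval (S 0 j)) ^ l *
        ∏ s : Fin K, RingHom.ker (eval (S s.succ j)) ^ k) (k * K + l) := by
      intro l
      induction l with
      | zero => simpa using h0
      | succ l ihl =>
        have := ihl.mul_ker_eval (hS 0)
        rw [← add_assoc]
        simpa only [pow_succ', mul_assoc] using this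
    simpa [mul_add] using h1 k

theorem prod_ker_eval_eq {n K : ℕ} {p : Fin K → Fin n → ℂ} (hp : Function.Injective p)
    {f : MvPolynomial (Fin n) ℂ} (hf : ∀ s, eval (p s) f = 0) :
    f ∈ ∏ s, RingHom.ker (eval (p s)) := by
  rw [Ideal.prod_eq_iInf_of_pairwise_isCoprime]
  · simpa [Ideal.mem_iInf, RingHom.mem_ker] using hf
  · intro s _ s' _ hs
    exact isCoprime_ker_eval (hp.ne hs)

theorem prod_limIdeal_le {n : ℕ} {ι : Type*} (s : Finset ι) (W : ι → ℕ → Ideal (MvPolynomial (Fin n) ℂ)) :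
    ∏ i ∈ s, limIdeal (W i) ≤ limIdeal (fun j => ∏ i ∈ s, W i j) := by
  induction s using Finset.cons_induction with
  | empty => exact fun f _ => ⟨fun _ => f, fun j => by simp, PolyTendsto.const f⟩
  | cons i s hi ih =>
    simp only [Finset.prod_cons]
    exact (Ideal.mul_mono_right ih).trans (limIdeal_mul_le _ _)

theorem idealOfVars_le_limIdeal {n : ℕ} {p : ℕ → Fin n → ℂ} (hp : Tendsto p atTop (𝓝 0)) :
    idealOfVars (Fin n) ℂ ≤ limIdeal (fun j => RingHom.ker (eval (p j))) := by
  refine Ideal.span_le.2 ?_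
  rintro _ ⟨i, rfl⟩
  refine ⟨fun j => X i + C (-p j i), fun j => by simp [RingHom.mem_ker], ?_⟩
  have hpi : Tendsto (fun j => -p j i) atTop (𝓝 0) := by
    simpa using ((tendsto_pi_nhds.1 hp) i).neg
  have h1 := (PolyTendsto.const (X i)).add (PolyTendsto.C (n := n) hpi)
  rwa [C_0, add_zero] at h1

theorem exists_rat_gt_pow_lt {T : ℝ} (hT : 0 ≤ T) {k K : ℕ} (h : T ^ k < K) :
    ∃ a b : ℕ, 0 < a ∧ 0 < b ∧ T * b ≤ a ∧ a ^ k < K * b ^ k := by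
  have h1 : ∀ᶠ x : ℝ in 𝓝[>] T, x ^ k < K :=
    ((continuous_pow k).continuousAt.eventually (gt_mem_nhds h)).filter_mono nhdsWithin_le_nhds
  obtain ⟨y, hy, hTy⟩ := (mem_nhdsGT_iff_exists_Ioo_subset.1 h1)
  obtain ⟨q, hq1, hq2⟩ := exists_rat_btwn (show T < y from hy)
  have hq0 : 0 < q := by exact_mod_cast hT.trans_lt hq1
  have hq3 : (q : ℝ) ^ k < K := hTy ⟨hq1, hq2⟩
  have hnum : ((q.num.toNat : ℕ) : ℝ) = q * q.den := by
    have h2 : ((q.num.toNat : ℕ) : ℤ) = q.num := Int.toNat_of_nonneg (Rat.num_pos.2 hq0).le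
    have h3 : (q.num : ℚ) = q * q.den := (Rat.mul_den_eq_num q).symm
    have h4 : ((q.num : ℤ) : ℝ) = q * q.den := by exact_mod_cast congrArg (fun x : ℚ => (x : ℝ)) h3
    rw [← h4]
    exact_mod_cast h2
  have hden : (0 : ℝ) < q.den := by exact_mod_cast q.den_pos
  refine ⟨q.num.toNat, q.den, ?_, q.den_pos, ?_, ?_⟩
  · have := Rat.num_pos.2 hq0
    omega
  · rw [hnum]
    exact mul_le_mul_of_nonneg_right hq1.le hden.le
  · have : ((q.num.toNat : ℕ) : ℝ) ^ k < K * (q.den : ℝ) ^ k := by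
      rw [hnum, mul_pow]
      exact mul_lt_mul_of_pos_right hq3 (by positivity)
    exact_mod_cast this

theorem card_le_of_deformation {n d K : ℕ} {ι : Type} [Finite ι] (F : ι → MvPolynomial (Fin n) ℂ)
    {T : ℝ} (hT : 0 ≤ T)
    (harc : ∀ γ : Fin n → ℂ[X], (∀ j, Polynomial.X ∣ γ j) → ∀ i, ∀ e : ℕ, Polynomial.X ^ e ∣ γ i →
      ¬ Polynomial.X ^ (e + 1) ∣ γ i → ∃ l, ∃ o : ℕ, (o : ℝ) ≤ T * e ∧
        ¬ Polynomial.X ^ (o + 1) ∣ aeval γ (F l))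
    (lin : Fin d → ι) (h0 : ∀ c, constantCoeff (F (lin c)) = 0)
    (hli : LinearIndependent ℂ fun c => fun i => coeff (Finsupp.single i 1) (F (lin c)))
    (F' : ι → ℕ → MvPolynomial (Fin n) ℂ) (hF' : ∀ l, PolyTendsto (F' l) (F l))
    (S : Fin K → ℕ → Fin n → ℂ) (hS : ∀ s, Tendsto (S s) atTop (𝓝 0))
    (hinj : ∀ j, Function.Injective fun s => S s j)
    (hzero : ∀ l s j, eval (S s j) (F' l j) = 0) : (K : ℝ) ≤ T ^ (n - d) := by
  classical
  by_contra! hlt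
  obtain ⟨a, b, ha, hb, hTab, hab⟩ := exists_rat_gt_pow_lt hT hlt
  set I := Ideal.span (Set.range F) with hI
  set m := idealOfVars (Fin n) ℂ with hm
  have hX : ∀ i, ∃ M, ∀ l N, (X i : MvPolynomial (Fin n) ℂ) ^ (a * (M + l)) ∈ (I ^ b) ^ l ⊔ m ^ N := by
    intro i
    obtain ⟨M, hM⟩ := X_pow_mem_of_forall_arc (fun l => F l ^ b) i a fun γ hγ e he he' => by
      obtain ⟨l, o, ho, hl⟩ := harc γ hγ i e he he'
      refine ⟨l, ?_⟩
      rw [map_pow]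
      refine not_X_pow_dvd_pow hl (Nat.lt_succ_of_le ?_)
      have h1 : (b : ℝ) * o ≤ a * e := by
        calc (b : ℝ) * o ≤ b * (T * e) := by gcongr
          _ = (T * b) * e := by ring
          _ ≤ a * e := by gcongr
      exact_mod_cast h1
    have hGI : Ideal.span (Set.range fun l => F l ^ b) ≤ I ^ b := by
      refine Ideal.span_le.2 ?_
      rintro _ ⟨l, rfl⟩
      have hl : F l ∈ I := Ideal.subset_span ⟨l, rfl⟩
      exact Ideal.pow_mem_pow hl b
    refine ⟨M, fun l N => ?_⟩
    have h1 : Ideal.span (Set.range fun l => F l ^ b) ^ l ⊔ m ^ N ≤ (I ^ b) ^ l ⊔ m ^ N :=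
      sup_le_sup_right (Ideal.pow_right_mono hGI l) _
    exact h1 (hM l N)
  choose Mx hMx using hX
  obtain ⟨u, Z, hZ, huZ, huZ', hu0, huX⟩ := exists_coords_of_linearIndependent _ h0 hli
  set w : Fin n → ℕ := fun i => if i ∈ Z then b else a with hw
  have hwpos : ∀ i, 0 < w i := fun i => by simp only [hw]; split_ifs <;> assumption
  have hdn : d ≤ n := by
    rw [← hZ]
    exact (Finset.card_le_univ Z).trans_eq (Fintype.card_fin n)
  have hwprod : ∏ i, w i = b ^ d * a ^ (n - d) := by
    simp only [hw]
    rw [Finset.prod_ite, Finset.prod_const, Finset.prod_const]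
    congr 2
    · rw [Finset.filter_mem_eq_inter, Finset.univ_inter, hZ]
    · rw [Finset.filter_not, Finset.filter_mem_eq_inter, Finset.univ_inter, ← Finset.compl_eq_univ_sdiff,
        Finset.card_compl, hZ, Fintype.card_fin]
  set M := ∑ i, Mx i with hM
  have hu : ∀ i l N, u i ^ (w i * (M + l)) ∈ (I ^ b) ^ l ⊔ m ^ N := by
    intro i l N
    by_cases hi : i ∈ Z
    · obtain ⟨c, hc⟩ := huZ i hi
      refine Ideal.mem_sup_left ?_
      have h1 : u i ∈ I := hc ▸ Ideal.subset_span ⟨_, rfl⟩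
      simp only [hw, if_pos hi]
      rw [← pow_mul]
      exact Ideal.pow_le_pow_right (Nat.mul_le_mul_left _ (Nat.le_add_left _ _))
        (Ideal.pow_mem_pow h1 _)
    · obtain ⟨j, hj⟩ := huZ' i hi
      simp only [hw, if_neg hi, hj]
      have h1 : Mx j ≤ M := Finset.single_le_sum (fun _ _ => Nat.zero_le _) (Finset.mem_univ j)
      obtain ⟨c, hc⟩ := exists_add_of_le h1
      have h2 : a * (M + l) = a * c + a * (Mx j + l) := by rw [hc]; ring
      rw [h2, pow_add]
      exact Ideal.mul_mem_left _ _ (hMx j l N)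
  have key : ∀ κ, K * numExponents n (b * κ) ≤ (∏ i, w i) * numExponents n (κ + n * M) := by
    intro κ
    set Q := κ + n * M with hQ
    set k := b * κ with hk
    obtain ⟨hfin, hcard⟩ := weightedExponents_finite_and_card_le w hwpos Q
    let W : ℕ → Ideal (MvPolynomial (Fin n) ℂ) := fun j => ∏ s, RingHom.ker (eval (S s j)) ^ k
    have hW : MonomialsApprox W (k * K) := monomialsApprox_prod_pow k K S hS
    have hIW : I ^ k ≤ limIdeal W := by
      have h1 : I ≤ limIdeal (fun j => ∏ s, RingHom.ker (eval (S s j))) := by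
        refine Ideal.span_le.2 ?_
        rintro _ ⟨l, rfl⟩
        exact ⟨F' l, fun j => prod_ker_eval_eq (hinj j) fun s => hzero l s j, hF' l⟩
      refine (Ideal.pow_right_mono h1 k).trans ((limIdeal_pow_le _ _).trans_eq ?_)
      simp only [W, Finset.prod_pow]
    have hmW : m ^ (k * K) ≤ limIdeal W := by
      refine le_trans ?_ (prod_limIdeal_le Finset.univ fun s j => RingHom.ker (eval (S s j)) ^ k)
      have h1 : m ^ (k * K) = ∏ _s : Fin K, m ^ k := by
        rw [Finset.prod_const, Finset.card_univ, Fintype.card_fin, pow_mul]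
      rw [h1]
      exact Finset.prod_le_prod' fun s _ =>
        (Ideal.pow_right_mono (idealOfVars_le_limIdeal (hS s)) k).trans (limIdeal_pow_le _ _)
    let μ : WeightedExponents w Q → MvPolynomial (Fin n) ℂ := fun α => ∏ i, u i ^ α.1 i
    have hA : ∀ f, ∃ e ∈ Submodule.span ℂ (Set.range μ), f - e ∈ limIdeal W := by
      intro f
      obtain ⟨g, hg, hfg⟩ := exists_span_sub_mem_pow hu0 huX (k * K) f
      suffices h : g ∈ Submodule.span ℂ (Set.range μ) ⊔ (limIdeal W).restrictScalars ℂ by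
        obtain ⟨e, he, v, hv, hev⟩ := Submodule.mem_sup.1 h
        refine ⟨e, he, ?_⟩
        have h2 : f - e = (f - g) + v := by rw [← hev]; ring
        rw [h2]
        exact add_mem (hmW hfg) hv
      refine (Submodule.span_le.2 ?_) hg
      rintro _ ⟨α, rfl⟩
      by_cases hα : ∑ i, α i / w i < Q
      · exact Submodule.mem_sup_left (Submodule.subset_span ⟨⟨α, hα⟩, rfl⟩)
      · refine Submodule.mem_sup_right ?_
        have h1 : ∀ i, u i ^ α i ∈ (I ^ b) ^ (α i / w i - M) ⊔ m ^ (k * K) := by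
          intro i
          rcases le_or_gt (α i / w i) M with h | h
          · rw [Nat.sub_eq_zero_of_le h, pow_zero, Ideal.one_eq_top, top_sup_eq]
            trivial
          · have h2 : α i = α i % w i + w i * (M + (α i / w i - M)) := by
              rw [Nat.add_sub_cancel' h.le, Nat.mod_add_div]
            rw [h2, pow_add, ← h2]
            exact Ideal.mul_mem_left _ _ (hu i _ _)
        have h2 := prod_mem_pow_sup (I ^ b) (m ^ (k * K)) Finset.univ _ _ fun i _ => h1 i
        have h3 : κ ≤ ∑ i, (α i / w i - M) := by
          have h4 : ∑ i, α i / w i ≤ ∑ i, ((α i / w i - M) + M) :=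
            Finset.sum_le_sum fun i _ => by omega
          rw [Finset.sum_add_distrib, Finset.sum_const, Finset.card_univ, Fintype.card_fin,
            smul_eq_mul] at h4
          omega
        have h5 : (I ^ b) ^ (∑ i, (α i / w i - M)) ⊔ m ^ (k * K) ≤ limIdeal W := by
          refine sup_le ((Ideal.pow_le_pow_right h3).trans ?_) hmW
          rw [← pow_mul]
          exact hIW
        exact h5 h2
    obtain ⟨j, hj⟩ := exists_sup_eq_top_of_limIdeal hW _ hA
    exact (mul_numExponents_le_card (hinj j) μ hj).trans hcard
  have h1 := mul_pow_le_of_forall_numExponents hb key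
  rw [hwprod] at h1
  have h2 : b ^ n = b ^ d * b ^ (n - d) := by rw [← pow_add, Nat.add_sub_cancel' hdn]
  rw [h2] at h1
  have h3 : b ^ d * a ^ (n - d) < b ^ d * (K * b ^ (n - d)) := Nat.mul_lt_mul_of_pos_left hab (by positivity)
  have h4 : K * (b ^ d * b ^ (n - d)) = b ^ d * (K * b ^ (n - d)) := by ring
  omega

theorem eval_aeval_arc {n : ℕ} (γ : Fin n → ℂ[X]) (t : ℂ) (f : MvPolynomial (Fin n) ℂ) :
    eval (fun k => (γ k).eval t) f = (aeval γ f).eval t := by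
  induction f using MvPolynomial.induction_on with
  | C a => simp
  | add f g hf hg => simp [hf, hg]
  | mul_X f i hf => simp [hf]

theorem PolyTendsto.prod {n : ℕ} {ι : Type*} (s : Finset ι) {f : ι → ℕ → MvPolynomial (Fin n) ℂ}
    {P : ι → MvPolynomial (Fin n) ℂ} (h : ∀ i ∈ s, PolyTendsto (f i) (P i)) :
    PolyTendsto (fun j => ∏ i ∈ s, f i j) (∏ i ∈ s, P i) := by
  induction s using Finset.cons_induction with
  | empty => simpa using const 1
  | cons i s hi ih =>
    simp only [Finset.prod_cons]
    exact (h i (by simp)).mul (ih fun i hi => h i (by simp [hi]))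

theorem PolyTendsto.eventually_norm_coeff_lt {n : ℕ} {f : ℕ → MvPolynomial (Fin n) ℂ}
    (h : PolyTendsto f 0) {δ : ℝ} (hδ : 0 < δ) : ∀ᶠ m in atTop, ∀ d, ‖coeff d (f m)‖ < δ := by
  obtain ⟨⟨L, hL⟩, h⟩ := h
  have hfin : {β : Fin n →₀ ℕ | β.degree ≤ L}.Finite := Finsupp.finite_of_degree_le L
  have h1 : ∀ᶠ m in atTop, ∀ d ∈ hfin.toFinset, ‖coeff d (f m)‖ < δ := by
    refine (Finset.eventually_all _).2 fun d _ => ?_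
    have := (h d).norm
    rw [coeff_zero, norm_zero] at this
    exact this.eventually (gt_mem_nhds hδ)
  filter_upwards [h1] with m hm d
  by_cases hd : d.degree ≤ L
  · exact hm d (by simpa using hd)
  · rw [coeff_eq_zero_of_totalDegree_lt ((hL m).trans_lt (not_le.1 hd)), norm_zero]
    exact hδ

theorem exists_deformation {n K N ν : ℕ} {ι : Type} [Finite ι] (F : ι → MvPolynomial (Fin n) ℂ)
    (γ : Fin n → ℂ[X]) (hγ : ∀ k, Polynomial.X ∣ γ k) (i : Fin n) (hν : 0 < ν)
    (hi : Polynomial.X ^ ν ∣ γ i) (hi' : ¬ Polynomial.X ^ (ν + 1) ∣ γ i)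
    (hF : ∀ l, Polynomial.X ^ N ∣ aeval γ (F l)) (hN : ν * (K - 1) < N) {δ : ℝ} (hδ : 0 < δ) :
    ∃ (x : Fin K → Fin n → ℂ) (D : ι → MvPolynomial (Fin n) ℂ), Function.Injective x ∧
      (∀ s k, ‖x s k‖ < δ) ∧ (∀ l, (D l).totalDegree ≤ K) ∧ (∀ l d, ‖coeff d (D l)‖ < δ) ∧
      ∀ l s, eval (x s) (F l + D l) = 0 := by
  classical
  obtain ⟨q, hq⟩ := hi
  have hq0 : q.eval 0 ≠ 0 := by
    intro h0
    rw [← Polynomial.coeff_zero_eq_eval_zero, ← Polynomial.X_dvd_iff] at h0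
    obtain ⟨q', rfl⟩ := h0
    exact hi' ⟨q', by rw [hq, pow_succ, mul_assoc]⟩
  choose g hg using hF
  let ε : ℕ → ℂ := fun m => 1 / ((m : ℂ) + 1)
  have hε0 : ∀ m, ε m ≠ 0 := fun m => one_div_ne_zero (Nat.cast_add_one_ne_zero m)
  have hε : Tendsto ε atTop (𝓝 0) := tendsto_one_div_add_atTop_nhds_zero_nat
  let c : Fin K → ℂ := fun s => (s : ℕ) + 1
  have hcε : ∀ s, Tendsto (fun m => c s * ε m) atTop (𝓝 0) := fun s => by
    simpa using hε.const_mul (c s)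
  have heval : ∀ (s : Fin K) (p : ℂ[X]),
      Tendsto (fun m => p.eval (c s * ε m)) atTop (𝓝 (p.eval 0)) := fun s p =>
    (p.continuous.tendsto 0).comp (hcε s)
  let x : ℕ → Fin K → Fin n → ℂ := fun m s k => (γ k).eval (c s * ε m)
  have hx : ∀ s k, Tendsto (fun m => x m s k) atTop (𝓝 0) := fun s k => by
    have h1 := heval s (γ k)
    rwa [← Polynomial.coeff_zero_eq_eval_zero, Polynomial.X_dvd_iff.1 (hγ k)] at h1
  have hxi : ∀ s m, x m s i = ε m ^ ν * (c s ^ ν * q.eval (c s * ε m)) := fun s m => by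
    simp only [x, hq, Polynomial.eval_mul, Polynomial.eval_pow, Polynomial.eval_X, mul_pow]
    ring
  let y : ℕ → Fin K → ℂ := fun m s => c s ^ ν * q.eval (c s * ε m)
  have hy : ∀ s, Tendsto (fun m => y m s) atTop (𝓝 (c s ^ ν * q.eval 0)) := fun s =>
    (heval s q).const_mul _
  have hyne : ∀ s s', s ≠ s' → c s ^ ν * q.eval 0 - c s' ^ ν * q.eval 0 ≠ 0 := by
    intro s s' hs h0
    rw [sub_eq_zero] at h0
    have h1 := mul_right_cancel₀ hq0 h0
    have h2 : ((s : ℕ) + 1) ^ ν = ((s' : ℕ) + 1) ^ ν := by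
      simp only [c] at h1
      exact_mod_cast h1
    have h3 := Nat.pow_left_injective hν.ne' h2
    exact hs (Fin.ext (by simpa using h3))
  have hinj : ∀ᶠ m in atTop, ∀ s s', s ≠ s' → y m s - y m s' ≠ 0 := by
    refine eventually_all.2 fun s => eventually_all.2 fun s' => ?_
    by_cases hs : s = s'
    · exact Eventually.of_forall fun m h => absurd hs h
    · filter_upwards [((hy s).sub (hy s')).eventually_ne (hyne s s' hs)] with m hm _ using hm
  have hxy : ∀ m s s', x m s i - x m s' i = ε m ^ ν * (y m s - y m s') := fun m s s' => by
    rw [hxi, hxi, ← mul_sub]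
  let a : ι → ℕ → Fin K → ℂ := fun l m s => -((aeval γ (F l)).eval (c s * ε m) *
    ∏ s' ∈ Finset.univ.erase s, (x m s i - x m s' i)⁻¹)
  have ha : ∀ l s, Tendsto (fun m => a l m s) atTop (𝓝 0) := by
    intro l s
    have h1 : ∀ m, a l m s = ε m ^ (N - ν * (K - 1)) * (-(c s ^ N * (g l).eval (c s * ε m) *
        ∏ s' ∈ Finset.univ.erase s, (y m s - y m s')⁻¹)) := by
      intro m
      simp only [a, hxy, mul_inv, Finset.prod_mul_distrib, Finset.prod_const, hg,
        Polynomial.eval_mul, Polynomial.eval_pow, Polynomial.eval_X]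
      rw [Finset.card_erase_of_mem (Finset.mem_univ s), Finset.card_univ, Fintype.card_fin, inv_pow,
        ← pow_mul]
      have h2 : ε m ^ N = ε m ^ (N - ν * (K - 1)) * ε m ^ (ν * (K - 1)) := by
        rw [← pow_add, Nat.sub_add_cancel hN.le]
      rw [mul_pow, h2]
      have h3 : ε m ^ (ν * (K - 1)) ≠ 0 := pow_ne_zero _ (hε0 m)
      field_simp
    have h4 : Tendsto (fun m => ε m ^ (N - ν * (K - 1)) * (-(c s ^ N * (g l).eval (c s * ε m) *
        ∏ s' ∈ Finset.univ.erase s, (y m s - y m s')⁻¹))) atTop (𝓝 (0 ^ (N - ν * (K - 1)) *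
        (-(c s ^ N * (g l).eval 0 *
        ∏ s' ∈ Finset.univ.erase s, (c s ^ ν * q.eval 0 - c s' ^ ν * q.eval 0)⁻¹)))) := by
      refine (hε.pow _).mul (((heval s (g l)).const_mul _).mul ?_).neg
      refine tendsto_finsetProd _ fun s' hs' => ?_
      exact ((hy s).sub (hy s')).inv₀ (hyne s s' (Finset.ne_of_mem_erase hs').symm)
    rw [zero_pow (Nat.sub_pos_of_lt hN).ne', zero_mul] at h4
    exact h4.congr fun m => (h1 m).symm
  let D : ι → ℕ → MvPolynomial (Fin n) ℂ := fun l m =>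
    ∑ s, C (a l m s) * ∏ s' ∈ Finset.univ.erase s, (X i + C (-x m s' i))
  have hD : ∀ l, PolyTendsto (D l) 0 := by
    intro l
    have h1 : PolyTendsto (D l)
        (∑ s : Fin K, C 0 * ∏ s' ∈ Finset.univ.erase s, (X i + C (-0))) :=
      PolyTendsto.sum _ fun s _ => (PolyTendsto.C (ha l s)).mul (PolyTendsto.prod _ fun s' _ =>
        (PolyTendsto.const _).add (PolyTendsto.C (hx s' i).neg))
    simpa using h1
  have hDdeg : ∀ l m, (D l m).totalDegree ≤ K := by
    intro l m
    refine (totalDegree_finsetSum_le fun s _ => ?_)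
    refine (totalDegree_mul _ _).trans ?_
    rw [totalDegree_C, zero_add]
    refine (totalDegree_finsetProd _ _).trans ?_
    refine (Finset.sum_le_card_nsmul _ _ 1 fun s' _ => ?_).trans ?_
    · refine (totalDegree_add _ _).trans ?_
      rw [totalDegree_C, totalDegree_X]
      simp
    · rw [smul_eq_mul, mul_one]
      exact (Finset.card_le_univ _).trans_eq (Fintype.card_fin K)
  have hev : ∀ᶠ m in atTop, (∀ s s', s ≠ s' → y m s - y m s' ≠ 0) ∧ (∀ s k, ‖x m s k‖ < δ) ∧
      ∀ l d, ‖coeff d (D l m)‖ < δ := by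
    refine hinj.and ((eventually_all.2 fun s => eventually_all.2 fun k => ?_).and
      (eventually_all.2 fun l => (hD l).eventually_norm_coeff_lt hδ))
    have := (hx s k).norm
    rw [norm_zero] at this
    exact this.eventually (gt_mem_nhds hδ)
  obtain ⟨m, hm1, hm2, hm3⟩ := hev.exists
  have hne : ∀ s s', s ≠ s' → x m s i - x m s' i ≠ 0 := fun s s' hs => by
    rw [hxy]
    exact mul_ne_zero (pow_ne_zero _ (hε0 m)) (hm1 s s' hs)
  refine ⟨x m, fun l => D l m, fun s s' h => ?_, hm2, fun l => hDdeg l m, hm3, fun l s => ?_⟩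
  · by_contra hs
    exact hne s s' hs (by rw [h, sub_self])
  · rw [map_add, eval_aeval_arc]
    simp only [D, map_sum, map_mul, eval_C, map_prod, map_add, eval_X]
    rw [Finset.sum_eq_single s]
    · simp only [a]
      rw [neg_mul, mul_assoc, ← Finset.prod_mul_distrib, Finset.prod_eq_one, mul_one, add_neg_cancel]
      intro s' hs'
      rw [← sub_eq_add_neg]
      exact inv_mul_cancel₀ (hne s s' (Finset.ne_of_mem_erase hs').symm)
    · intro s' _ hs'
      rw [Finset.prod_eq_zero (Finset.mem_erase.2 ⟨hs'.symm, Finset.mem_univ s⟩), mul_zero]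
      exact add_neg_cancel _
    · simp

theorem card_le_of_tendsto_of_arcs {n d K : ℕ} {ι : Type} [Finite ι]
    (F : ι → MvPolynomial (Fin n) ℂ) {T : ℝ} (hT : 0 ≤ T)
    (harc : ∀ γ : Fin n → ℂ[X], (∀ j, Polynomial.X ∣ γ j) → ∀ i, ∀ e : ℕ, Polynomial.X ^ e ∣ γ i →
      ¬ Polynomial.X ^ (e + 1) ∣ γ i → ∃ l, ∃ o : ℕ, (o : ℝ) ≤ T * e ∧
        ¬ Polynomial.X ^ (o + 1) ∣ aeval γ (F l))
    (lin : Fin d → ι) (h0 : ∀ c, constantCoeff (F (lin c)) = 0)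
    (hli : LinearIndependent ℂ fun c => fun i => coeff (Finsupp.single i 1) (F (lin c)))
    (F' : ι → ℕ → MvPolynomial (Fin n) ℂ) (hF' : ∀ l, PolyTendsto (F' l) (F l))
    (harc' : ∀ j, ∃ (γ : Fin n → ℂ[X]) (i : Fin n) (ν N : ℕ), (∀ k, Polynomial.X ∣ γ k) ∧ 0 < ν ∧
      Polynomial.X ^ ν ∣ γ i ∧ ¬ Polynomial.X ^ (ν + 1) ∣ γ i ∧ ν * (K - 1) < N ∧
      ∀ l, Polynomial.X ^ N ∣ aeval γ (F' l j)) : (K : ℝ) ≤ T ^ (n - d) := by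
  have h : ∀ j : ℕ, ∃ (x : Fin K → Fin n → ℂ) (D : ι → MvPolynomial (Fin n) ℂ),
      Function.Injective x ∧ (∀ s k, ‖x s k‖ < 1 / ((j : ℝ) + 1)) ∧ (∀ l, (D l).totalDegree ≤ K) ∧
      (∀ l d, ‖coeff d (D l)‖ < 1 / ((j : ℝ) + 1)) ∧ ∀ l s, eval (x s) (F' l j + D l) = 0 := by
    intro j
    obtain ⟨γ, i, ν, N, hγ, hν, hi, hi', hN, hF⟩ := harc' j
    exact exists_deformation (fun l => F' l j) γ hγ i hν hi hi' hF hN (by positivity)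
  choose x D hinj hx hDdeg hD hzero using h
  have hD0 : ∀ l, PolyTendsto (fun j => D j l) 0 := fun l => by
    refine ⟨⟨K, fun j => hDdeg j l⟩, fun d => ?_⟩
    rw [coeff_zero]
    exact squeeze_zero_norm (fun j => (hD j l d).le) tendsto_one_div_add_atTop_nhds_zero_nat
  refine card_le_of_deformation F hT harc lin h0 hli (fun l j => F' l j + D j l) (fun l => ?_)
    (fun s j => x j s) (fun s => ?_) hinj (fun l s j => hzero j l s)
  · simpa using (hF' l).add (hD0 l)
  · refine tendsto_pi_nhds.2 fun k => ?_
    exact squeeze_zero_norm (fun j => (hx j s k).le) tendsto_one_div_add_atTop_nhds_zero_nat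

end

section

open MvPolynomial Filter Asymptotics
open scoped Topology Polynomial ComplexConjugate

theorem X_pow_dvd_of_isBigO {g : ℂ[X]} {N : ℕ}
    (h : (fun s : ℝ => g.eval (s : ℂ)) =O[𝓝[>] 0] fun s => s ^ N) : Polynomial.X ^ N ∣ g := by
  rcases eq_or_ne g 0 with rfl | hg
  · exact dvd_zero _
  obtain ⟨r, q, hq, rfl⟩ := WfDvdMonoid.max_power_factor hg Polynomial.irreducible_X
  by_contra hdvd
  have hrN : r < N := by
    by_contra hle
    exact hdvd ((pow_dvd_pow _ (not_lt.1 hle)).mul_right _)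
  refine hq (Polynomial.X_dvd_iff.2 ?_)
  rw [Polynomial.coeff_zero_eq_eval_zero]
  have hs : Tendsto (fun s : ℝ => (s : ℂ)) (𝓝[>] 0) (𝓝 0) := by
    have := (Complex.continuous_ofReal.tendsto 0).mono_left (nhdsWithin_le_nhds (s := Set.Ioi 0))
    simpa using this
  have h1 : Tendsto (fun s : ℝ => q.eval (s : ℂ)) (𝓝[>] 0) (𝓝 (q.eval 0)) :=
    (q.continuous.tendsto 0).comp hs
  refine tendsto_nhds_unique h1 ?_
  obtain ⟨c, hc⟩ := h.bound
  have h2 : Tendsto (fun s : ℝ => c * s ^ (N - r)) (𝓝[>] 0) (𝓝 0) := by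
    have h3 : Tendsto (fun s : ℝ => c * s ^ (N - r)) (𝓝 0) (𝓝 (c * 0 ^ (N - r))) :=
      (Continuous.tendsto (by fun_prop) 0)
    rw [zero_pow (by omega), mul_zero] at h3
    exact h3.mono_left nhdsWithin_le_nhds
  refine squeeze_zero_norm' ?_ h2
  filter_upwards [hc, self_mem_nhdsWithin] with s hs hs0
  have hs0' : (0 : ℝ) < s := hs0
  rw [Polynomial.eval_mul, Polynomial.eval_pow, Polynomial.eval_X, norm_mul, norm_pow, norm_pow,
    Complex.norm_real, Real.norm_of_nonneg hs0'.le] at hs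
  have h4 : s ^ N = s ^ (N - r) * s ^ r := by rw [← pow_add, Nat.sub_add_cancel hrN.le]
  rw [h4, ← mul_assoc, mul_comm (s ^ r)] at hs
  exact le_of_mul_le_mul_right hs (by positivity)

theorem eval_isBigO_of_X_pow_dvd {g : ℂ[X]} {N : ℕ} (h : Polynomial.X ^ N ∣ g) :
    (fun t : ℂ => g.eval t) =O[𝓝 0] fun t => t ^ N := by
  obtain ⟨q, rfl⟩ := h
  simp only [Polynomial.eval_mul, Polynomial.eval_pow, Polynomial.eval_X]
  have h1 : (fun t : ℂ => q.eval t) =O[𝓝 0] fun _ => (1 : ℂ) :=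
    (q.continuous.tendsto 0).isBigO_one ℂ
  simpa using (isBigO_refl (fun t : ℂ => t ^ N) (𝓝 0)).mul h1

theorem sum_coeff_mul_conj_coeff_eq_zero {B : Type*} [Fintype B] (p e : B → ℂ[X]) {N : ℕ}
    (h : (fun t : ℂ => ∑ β, (p β).eval t * conj ((e β).eval t)) =O[𝓝 0] fun t => t ^ N) {a b : ℕ}
    (hab : a + b < N) : ∑ β, (p β).coeff a * conj ((e β).coeff b) = 0 := by
  set c : ℕ → ℕ → ℂ := fun a b => ∑ β, (p β).coeff a * conj ((e β).coeff b) with hc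
  have key : ∀ ω : ℂ, ∑ x ∈ Finset.HasAntidiagonal.antidiagonal (a + b), ω ^ x.1 * conj ω ^ x.2 * c x.1 x.2 = 0 := by
    intro ω
    let g : ℂ[X] := ∑ β, (p β).comp (Polynomial.C ω * Polynomial.X) *
      ((e β).map (starRingEnd ℂ)).comp (Polynomial.C (conj ω) * Polynomial.X)
    have hg : ∀ s : ℝ, g.eval (s : ℂ) =
        ∑ β, (p β).eval (ω * s) * conj ((e β).eval (ω * s)) := by
      intro s
      simp only [g, Polynomial.eval_finsetSum, Polynomial.eval_mul, Polynomial.eval_comp,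
        Polynomial.eval_C, Polynomial.eval_X]
      refine Finset.sum_congr rfl fun β _ => ?_
      congr 1
      have h1 : conj ω * (s : ℂ) = conj (ω * s) := by rw [map_mul, Complex.conj_ofReal]
      rw [Polynomial.eval_map, h1]
      exact Polynomial.eval₂_at_apply _ _
    have hω : Tendsto (fun s : ℝ => ω * (s : ℂ)) (𝓝[>] 0) (𝓝 0) := by
      have h1 : Continuous fun s : ℝ => ω * (s : ℂ) := by fun_prop
      have h2 := (h1.tendsto 0).mono_left (nhdsWithin_le_nhds (s := Set.Ioi 0))
      simpa using h2
    have hO : (fun s : ℝ => g.eval (s : ℂ)) =O[𝓝[>] 0] fun s => s ^ N := by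
      have h1 := h.comp_tendsto hω
      refine (isBigO_congr (Eventually.of_forall fun s => (hg s).symm) EventuallyEq.rfl).1
        (h1.trans ?_)
      refine IsBigO.of_bound (‖ω‖ ^ N) (Eventually.of_forall fun s => ?_)
      simp [mul_pow]
    obtain ⟨q, hq⟩ := X_pow_dvd_of_isBigO hO
    have h0 : g.coeff (a + b) = 0 := by
      rw [hq, Polynomial.coeff_X_pow_mul', if_neg (by omega)]
    rw [← h0]
    simp only [g, Polynomial.finsetSum_coeff, Polynomial.coeff_mul, Polynomial.comp_C_mul_X_coeff,
      Polynomial.coeff_map, hc, Finset.mul_sum]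
    rw [Finset.sum_comm]
    refine Finset.sum_congr rfl fun β _ => Finset.sum_congr rfl fun x _ => ?_
    ring
  let Q : ℂ[X] := ∑ x ∈ Finset.HasAntidiagonal.antidiagonal (a + b), Polynomial.monomial x.1 (c x.1 x.2)
  have hroot : ∀ y : ℝ, Q.IsRoot ((1 + y * Complex.I) / (1 - y * Complex.I)) := by
    intro y
    have hne : (1 - y * Complex.I : ℂ) ≠ 0 := fun h => by
      have := congrArg Complex.re h
      simp at this
    have hconj : conj (1 + y * Complex.I : ℂ) = 1 - y * Complex.I := by
      simp [sub_eq_add_neg]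
    have h1 := key (1 + y * Complex.I)
    rw [hconj] at h1
    have h2 : (1 - y * Complex.I : ℂ) ^ (a + b) * Q.eval ((1 + y * Complex.I) / (1 - y * Complex.I))
        = 0 := by
      rw [← h1]
      simp only [Q, Polynomial.eval_finsetSum, Polynomial.eval_monomial, Finset.mul_sum]
      refine Finset.sum_congr rfl fun x hx => ?_
      rw [← Finset.HasAntidiagonal.mem_antidiagonal.1 hx, pow_add, div_pow]
      field_simp
    exact (mul_eq_zero.1 h2).resolve_left (pow_ne_zero _ hne)
  have hinj : Function.Injective fun y : ℝ => (1 + y * Complex.I : ℂ) / (1 - y * Complex.I) := by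
    intro y y' hyy
    have hne : ∀ y : ℝ, (1 - y * Complex.I : ℂ) ≠ 0 := fun y h => by
      have := congrArg Complex.re h
      simp at this
    simp only at hyy
    rw [div_eq_div_iff (hne y) (hne y')] at hyy
    have := congrArg Complex.im hyy
    simp at this
    linarith
  have hQ : Q = 0 := Polynomial.eq_zero_of_infinite_isRoot Q
    ((Set.infinite_range_of_injective hinj).mono (by rintro _ ⟨y, rfl⟩; exact hroot y))
  have h3 : Q.coeff a = c a b := by
    simp only [Q, Polynomial.finsetSum_coeff, Polynomial.coeff_monomial]
    rw [Finset.sum_eq_single (a, b)]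
    · simp
    · rintro ⟨a', b'⟩ hx hne
      rw [if_neg]
      rintro rfl
      have := Finset.HasAntidiagonal.mem_antidiagonal.1 hx
      exact hne (by simp at this; rw [this])
    · simp
  exact h3.symm.trans (by rw [hQ, Polynomial.coeff_zero])

theorem exists_hermitian_projection {B : Type*} [Fintype B] [DecidableEq B]
    (S : Set (EuclideanSpace ℂ B)) (S' : Set (EuclideanSpace ℂ B))
    (h : ∀ x ∈ S, ∀ y ∈ S', inner ℂ x y = 0) :
    ∃ H : B → B → ℂ, (∀ β β', H β β' = conj (H β' β)) ∧ (∀ β β', ‖H β β'‖ ≤ 1) ∧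
      (∀ x ∈ S, ∀ β, ∑ β', H β β' * x β' = 0) ∧ (∀ y ∈ S', ∀ β, ∑ β', H β β' * y β' = y β) := by
  let W : Submodule ℂ (EuclideanSpace ℂ B) := Submodule.span ℂ S
  let P := Wᗮ.starProjection
  let E : B → EuclideanSpace ℂ B := fun β => EuclideanSpace.single β 1
  have hsum : ∀ x : EuclideanSpace ℂ B, ∀ β, ∑ β', P (E β') β * x β' = P x β := by
    intro x β
    have hx : x = ∑ β', x β' • E β' := by
      ext β
      simp [E, Finset.sum_apply, Pi.single_apply]
    conv_rhs => rw [hx]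
    rw [map_sum, WithLp.ofLp_sum, Finset.sum_apply]
    simp [mul_comm]
  have hin : ∀ (x : EuclideanSpace ℂ B) β, inner ℂ (E β) x = x β := by
    intro x β
    simp [E, EuclideanSpace.inner_single_left]
  refine ⟨fun β β' => P (E β') β, fun β β' => ?_, fun β β' => ?_, fun x hx β => ?_,
    fun y hy β => ?_⟩
  · have h1 : inner ℂ (P (E β)) (E β') = inner ℂ (E β) (P (E β')) :=
      Submodule.inner_starProjection_left_eq_right _ _ _
    show P (E β') β = conj (P (E β) β')
    rw [← hin, ← h1, ← hin, inner_conj_symm]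
  · have h1 : ‖P (E β')‖ ≤ ‖E β'‖ := Submodule.norm_starProjection_apply_le _ _
    have h2 : ‖E β'‖ = 1 := by simp [E]
    exact (PiLp.norm_apply_le _ _).trans (h1.trans h2.le)
  · rw [hsum]
    have : P x = 0 := by
      rw [Submodule.starProjection_apply_eq_zero_iff]
      exact Submodule.le_orthogonal_orthogonal _ (Submodule.subset_span hx)
    simp [this]
  · rw [hsum]
    have : P y = y := by
      rw [Submodule.starProjection_eq_self_iff, Submodule.mem_orthogonal]
      intro u hu
      induction hu using Submodule.span_induction with
      | mem x hx => exact h x hx y hy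
      | zero => simp
      | add u v _ _ hu hv => rw [inner_add_left, hu, hv, add_zero]
      | smul a u _ hu => rw [inner_smul_left, hu, mul_zero]
    rw [this]

/-- The polynomials `q - H q` and `H z` attached to a Hermitian matrix `H`, where `z` is the
vector of monomials indexed by `B`. -/
noncomputable def projFamily {n : ℕ} {κ B : Type*} [Fintype B] (ex : B → Fin n →₀ ℕ)
    (H : B → B → ℂ) (q : κ → B → MvPolynomial (Fin n) ℂ) :
    (κ × B) ⊕ B → MvPolynomial (Fin n) ℂ
  | Sum.inl (i, β) => q i β - ∑ β', C (H β β') * q i β'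
  | Sum.inr β => ∑ β', C (H β β') * monomial (ex β') 1

theorem X_pow_dvd_of_coeff {g : ℂ[X]} {N : ℕ} (h : ∀ a < N, g.coeff a = 0) :
    Polynomial.X ^ N ∣ g := Polynomial.X_pow_dvd_iff.2 h

theorem exists_projFamily_dvd {n : ℕ} {κ B : Type*} [Fintype B]
    (ex : B → Fin n →₀ ℕ) (hex : Function.Injective ex) (β₀ : B) (hβ₀ : ex β₀ = 0)
    (q : κ → B → MvPolynomial (Fin n) ℂ) (γ : Fin n → ℂ[X]) (hγ : ∀ k, Polynomial.X ∣ γ k)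
    {N N' : ℕ} (hN : 2 * N' ≤ N + 1) (hN' : 1 ≤ N')
    (h : ∀ i, (fun t : ℂ => ∑ β, (aeval γ (q i β)).eval t *
      conj ((aeval γ (monomial (ex β) (1 : ℂ))).eval t)) =O[𝓝 0] fun t => t ^ N) :
    ∃ H : B → B → ℂ, (∀ β β', H β β' = conj (H β' β)) ∧ (∀ β β', ‖H β β'‖ ≤ 1) ∧
      (∀ β, H β β₀ = 0) ∧ ∀ l, Polynomial.X ^ N' ∣ aeval γ (projFamily ex H q l) := by
  classical
  let e : B → ℂ[X] := fun β => aeval γ (monomial (ex β) (1 : ℂ))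
  let S : Set (EuclideanSpace ℂ B) :=
    {x | ∃ b < N', x = WithLp.toLp 2 fun β => (e β).coeff b}
  let S' : Set (EuclideanSpace ℂ B) :=
    {x | ∃ i, ∃ a < N', x = WithLp.toLp 2 fun β => (aeval γ (q i β)).coeff a}
  obtain ⟨H, h1, h2, h3, h4⟩ := exists_hermitian_projection S S' (by
    rintro _ ⟨b, hb, rfl⟩ _ ⟨i, a, ha, rfl⟩
    rw [PiLp.inner_apply]
    simpa using sum_coeff_mul_conj_coeff_eq_zero _ e (h i) (a := a) (b := b) (by omega))
  refine ⟨H, h1, h2, fun β => ?_, ?_⟩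
  · have := h3 _ ⟨0, hN', rfl⟩ β
    rw [Finset.sum_eq_single β₀] at this
    · simpa [e, hβ₀] using this
    · intro β' _ hne
      have hne' : ex β' ≠ 0 := fun h => hne (hex (h.trans hβ₀.symm))
      obtain ⟨k, hk⟩ := Finsupp.ne_iff.1 hne'
      have : Polynomial.X ∣ e β' := by
        simp only [e, aeval_monomial, map_one, one_mul]
        rw [Finsupp.prod_fintype _ _ (by simp)]
        exact ((hγ k).trans (dvd_pow_self _ hk)).trans (Finset.dvd_prod_of_mem _ (Finset.mem_univ k))
      simp [Polynomial.X_dvd_iff.1 this]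
    · simp
  · rintro (⟨i, β⟩ | β) <;> refine X_pow_dvd_of_coeff fun a ha => ?_
    · have := h4 _ ⟨i, a, ha, rfl⟩ β
      simp only [projFamily, map_sub, map_sum, map_mul, algHom_C, Polynomial.algebraMap_eq,
        Polynomial.coeff_sub, Polynomial.finsetSum_coeff, Polynomial.coeff_C_mul]
      simp only at this
      rw [this, sub_self]
    · have := h3 _ ⟨a, ha, rfl⟩ β
      simpa only [projFamily, map_sub, map_sum, map_mul, algHom_C, Polynomial.algebraMap_eq,
        Polynomial.coeff_sub, Polynomial.finsetSum_coeff, Polynomial.coeff_C_mul] using this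

theorem sum_isBigO_of_projFamily_dvd {n : ℕ} {κ B : Type*} [Fintype B]
    (ex : B → Fin n →₀ ℕ) (q : κ → B → MvPolynomial (Fin n) ℂ) (γ : Fin n → ℂ[X])
    {H : B → B → ℂ} (hH : ∀ β β', H β β' = conj (H β' β)) {N : ℕ}
    (h : ∀ l, Polynomial.X ^ N ∣ aeval γ (projFamily ex H q l)) (i : κ) :
    (fun t : ℂ => ∑ β, (aeval γ (q i β)).eval t *
      conj ((aeval γ (monomial (ex β) (1 : ℂ))).eval t)) =O[𝓝 0] fun t => t ^ N := by
  have hbdd : ∀ g : ℂ[X], (fun t : ℂ => g.eval t) =O[𝓝 0] fun _ => (1 : ℂ) := fun g =>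
    (g.continuous.tendsto 0).isBigO_one ℂ
  have hconj : ∀ {g : ℂ → ℂ} {f : ℂ → ℂ}, g =O[𝓝 0] f → (fun t => conj (g t)) =O[𝓝 0] f := by
    intro g f hg
    rw [← isBigO_norm_left] at hg ⊢
    simpa using hg
  have h1 : (fun t : ℂ => ∑ β, (aeval γ (projFamily ex H q (Sum.inl (i, β)))).eval t *
      conj ((aeval γ (monomial (ex β) (1 : ℂ))).eval t)) =O[𝓝 0] fun t => t ^ N := by
    refine IsBigO.fun_sum fun β _ => ?_
    simpa using (eval_isBigO_of_X_pow_dvd (h (Sum.inl (i, β)))).mul (hconj (hbdd _))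
  have h2 : (fun t : ℂ => ∑ β, (aeval γ (q i β)).eval t *
      conj ((aeval γ (projFamily ex H q (Sum.inr β))).eval t)) =O[𝓝 0] fun t => t ^ N := by
    refine IsBigO.fun_sum fun β _ => ?_
    simpa using (hbdd (aeval γ (q i β))).mul (hconj (eval_isBigO_of_X_pow_dvd (h (Sum.inr β))))
  refine (h1.add h2).congr_left fun t => ?_
  simp only [projFamily, map_sub, map_sum, map_mul, algHom_C, Polynomial.algebraMap_eq,
    Polynomial.eval_sub, Polynomial.eval_finsetSum, Polynomial.eval_mul, Polynomial.eval_C, sub_mul,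
    Finset.sum_sub_distrib, Finset.mul_sum, Finset.sum_mul]
  have : ∑ β, ∑ β', H β β' * (aeval γ (q i β')).eval t *
      conj ((aeval γ (monomial (ex β) (1 : ℂ))).eval t) =
      ∑ β, ∑ β', (aeval γ (q i β)).eval t *
        (conj (H β β') * conj ((aeval γ (monomial (ex β') (1 : ℂ))).eval t)) := by
    rw [Finset.sum_comm]
    refine Finset.sum_congr rfl fun β _ => Finset.sum_congr rfl fun β' _ => ?_
    rw [hH β' β]
    ring
  rw [this]
  ring

theorem projFamily_inl_of_zero {n : ℕ} {κ B : Type*} [Fintype B] (ex : B → Fin n →₀ ℕ)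
    (q : κ → B → MvPolynomial (Fin n) ℂ) {H : B → B → ℂ} (hH : ∀ β β', H β β' = conj (H β' β))
    {β₀ : B} (h : ∀ β, H β β₀ = 0) (i : κ) : projFamily ex H q (Sum.inl (i, β₀)) = q i β₀ := by
  have : ∀ β, H β₀ β = 0 := fun β => by rw [hH, h, map_zero]
  simp [projFamily, this]

theorem PolyTendsto.projFamily {n : ℕ} {κ B : Type*} [Fintype B] (ex : B → Fin n →₀ ℕ)
    {q : ℕ → κ → B → MvPolynomial (Fin n) ℂ} {q' : κ → B → MvPolynomial (Fin n) ℂ}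
    (hq : ∀ i β, PolyTendsto (fun j => q j i β) (q' i β)) {H : ℕ → B → B → ℂ} {H' : B → B → ℂ}
    (hH : ∀ β β', Tendsto (fun j => H j β β') atTop (𝓝 (H' β β'))) (l : (κ × B) ⊕ B) :
    PolyTendsto (fun j => projFamily ex (H j) (q j) l) (projFamily ex H' q' l) := by
  rcases l with ⟨i, β⟩ | β
  · have h1 := (hq i β).add ((PolyTendsto.const (MvPolynomial.C (-1))).mul
      (PolyTendsto.sum Finset.univ fun β' _ => (PolyTendsto.C (n := n) (hH β β')).mul (hq i β')))
    simpa [_root_.projFamily, sub_eq_add_neg] using h1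
  · exact PolyTendsto.sum Finset.univ fun β' _ => (PolyTendsto.C (hH β β')).mul (PolyTendsto.const _)

/-- Words of length at most `k` in the `2 n` real coordinate directions of `ℂⁿ`. -/
abbrev JetIndex (n k : ℕ) : Type := Σ j : Fin (k + 1), (Fin j → Fin n × Bool)

/-- The real coordinate directions of `ℂⁿ`. -/
noncomputable def realDir {n : ℕ} (a : Fin n × Bool) : Fin n → ℂ :=
  Pi.single a.1 (if a.2 then Complex.I else 1)

/-- The real coordinates on `ℂⁿ`. -/
noncomputable def realCoord {n : ℕ} (ζ : Fin n → ℂ) (a : Fin n × Bool) : ℝ :=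
  if a.2 then (ζ a.1).im else (ζ a.1).re

theorem sum_realCoord_smul_realDir {n : ℕ} (ζ : Fin n → ℂ) :
    ∑ a, realCoord ζ a • realDir a = ζ := by
  ext i
  rw [Finset.sum_apply, Fintype.sum_prod_type]
  simp only [realCoord, realDir, Fintype.sum_bool, Pi.smul_apply, Complex.real_smul]
  rw [Finset.sum_eq_single i]
  · simp [add_comm, mul_comm]
    simpa [mul_comm] using Complex.re_add_im (ζ i)
  · intro j _ hj
    simp [hj.symm]
  · simp

/-- The coefficients of the Taylor polynomial of order `k` in real coordinates. -/
noncomputable def jet (n k : ℕ) (r : (Fin n → ℂ) → ℝ) (p : Fin n → ℂ) (w : JetIndex n k) : ℝ :=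
  (w.1.val.factorial : ℝ)⁻¹ * iteratedFDeriv ℝ w.1 r p fun m => realDir (w.2 m)

theorem taylorPoly_eq_sum_jet (n k : ℕ) (r : (Fin n → ℂ) → ℝ) (p ζ : Fin n → ℂ) :
    taylorPoly n k r p (p + ζ) = ∑ w : JetIndex n k, jet n k r p w * ∏ m, realCoord ζ (w.2 m) := by
  rw [taylorPoly, Finset.sum_range, Fintype.sum_sigma]
  refine Finset.sum_congr rfl fun j _ => ?_
  have h1 : (fun _ : Fin j => p + ζ - p) = fun _ => ∑ a, realCoord ζ a • realDir a := by
    rw [sum_realCoord_smul_realDir]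
    simp
  rw [h1]
  have h2 := (iteratedFDeriv ℝ j r p).toMultilinearMap.map_sum
    (fun _ a => realCoord ζ a • realDir a)
  simp only [ContinuousMultilinearMap.coe_coe] at h2
  rw [h2, smul_eq_mul, Finset.mul_sum]
  refine Finset.sum_congr rfl fun w _ => ?_
  rw [ContinuousMultilinearMap.map_smul_univ, smul_eq_mul, jet]
  ring

/-- The real coordinates as polynomials in `ζ̄` with coefficients in the polynomials in `ζ`. -/
noncomputable def polarizedCoord {n : ℕ} (a : Fin n × Bool) :
    MvPolynomial (Fin n) (MvPolynomial (Fin n) ℂ) :=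
  if a.2 then C (C (-(Complex.I / 2))) * (C (X a.1) - X a.1) else C (C 2⁻¹) * (C (X a.1) + X a.1)

theorem eval₂_polarizedCoord {n : ℕ} (ζ : Fin n → ℂ) (a : Fin n × Bool) :
    eval₂ (eval ζ) (fun i => conj (ζ i)) (polarizedCoord a) = realCoord ζ a := by
  rcases a with ⟨i, _ | _⟩
  · simp [polarizedCoord, realCoord, Complex.re_eq_add_conj]
    ring
  · simp [polarizedCoord, realCoord, Complex.im_eq_sub_conj, div_eq_mul_inv]
    ring

/-- The product of polarized coordinates attached to a word. -/
noncomputable def polarWord {n k : ℕ} (w : JetIndex n k) :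
    MvPolynomial (Fin n) (MvPolynomial (Fin n) ℂ) := ∏ m, polarizedCoord (w.2 m)

open Classical in
/-- The exponents of `ζ̄` occurring in real polynomials of degree at most `k`. -/
noncomputable def polarSupport (n k : ℕ) : Finset (Fin n →₀ ℕ) :=
  insert 0 (Finset.univ.biUnion fun w : JetIndex n k => (polarWord w).support)

/-- The coefficient of `ζ̄ ^ β` in the real polynomial with jet coefficients `c`. -/
noncomputable def jetCoeff {n k : ℕ} (c : JetIndex n k → ℝ) (β : Fin n →₀ ℕ) :
    MvPolynomial (Fin n) ℂ := ∑ w, C (c w : ℂ) * coeff β (polarWord w)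

theorem sum_jetCoeff_mul_conj {n k : ℕ} (c : JetIndex n k → ℝ) (ζ : Fin n → ℂ) :
    ∑ β : polarSupport n k, eval ζ (jetCoeff c β) * conj (eval ζ (monomial (β : Fin n →₀ ℕ) 1)) =
      ((∑ w, c w * ∏ m, realCoord ζ (w.2 m) : ℝ) : ℂ) := by
  rw [Finset.sum_coe_sort (polarSupport n k) fun β => eval ζ (jetCoeff c β) *
    conj (eval ζ (monomial β 1))]
  simp only [jetCoeff, map_sum, Finset.sum_mul]
  rw [Finset.sum_comm, Complex.ofReal_sum]
  refine Finset.sum_congr rfl fun w _ => ?_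
  rw [Complex.ofReal_mul, Complex.ofReal_prod]
  simp only [← eval₂_polarizedCoord]
  rw [← eval₂_prod, ← polarWord]
  rw [eval₂_eq, Finset.mul_sum]
  symm
  refine Finset.sum_subset_zero_on_sdiff ?_ ?_ ?_
  · intro β hβ
    exact Finset.mem_insert_of_mem (Finset.mem_biUnion.2 ⟨w, Finset.mem_univ _, hβ⟩)
  · intro β hβ
    have : coeff β (polarWord w) = 0 := by simpa using (Finset.mem_sdiff.1 hβ).2
    simp [this]
  · intro β _
    have : eval ζ (monomial β 1) = ∏ i ∈ β.support, ζ i ^ β i := by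
      simp [eval_monomial, Finsupp.prod]
    simp [this, mul_assoc]

theorem constantCoeff_polarizedCoord_false {n : ℕ} (i : Fin n) :
    constantCoeff (polarizedCoord (i, false)) = C (1 / 2) * X i := by
  simp [polarizedCoord]

theorem constantCoeff_polarizedCoord_true {n : ℕ} (i : Fin n) :
    constantCoeff (polarizedCoord (i, true)) = C (-(Complex.I / 2)) * X i := by
  simp [polarizedCoord]

theorem isHomogeneous_coeff_zero_polarWord {n k : ℕ} (w : JetIndex n k) :
    (coeff 0 (polarWord w)).IsHomogeneous w.1 := by
  have h0 : coeff 0 (polarWord w) = ∏ m, constantCoeff (polarizedCoord (w.2 m)) := by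
    rw [← map_prod, ← polarWord, constantCoeff_eq]
  rw [h0]
  have h1 : (∏ m, constantCoeff (polarizedCoord (w.2 m))).IsHomogeneous (∑ _m : Fin w.1, 1) := by
    refine IsHomogeneous.prod _ _ _ fun m _ => ?_
    rcases w.2 m with ⟨i, _ | _⟩
    · rw [constantCoeff_polarizedCoord_false]
      exact (isHomogeneous_X ℂ i).C_mul _
    · rw [constantCoeff_polarizedCoord_true]
      exact (isHomogeneous_X ℂ i).C_mul _
  simpa using h1

theorem constantCoeff_jetCoeff_zero {n k : ℕ} (c : JetIndex n k → ℝ) :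
    constantCoeff (jetCoeff c 0) = c ⟨⟨0, by omega⟩, Fin.elim0⟩ := by
  rw [jetCoeff, map_sum, Fintype.sum_sigma, Finset.sum_eq_single ⟨0, by omega⟩]
  · rw [Finset.sum_eq_single Fin.elim0]
    · simp [polarWord]
    · exact fun w _ hw => absurd (funext fun m => m.elim0) hw
    · exact fun h => absurd (Finset.mem_univ _) h
  · intro j _ hj
    refine Finset.sum_eq_zero fun w _ => ?_
    rw [map_mul, constantCoeff_eq, (isHomogeneous_coeff_zero_polarWord _).coeff_eq_zero,
      mul_zero]
    simpa using fun h => hj (Fin.ext h.symm)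
  · simp

theorem coeff_single_jetCoeff_zero {n k : ℕ} (hk : 0 < k) (c : JetIndex n k → ℝ) (i : Fin n) :
    coeff (Finsupp.single i 1) (jetCoeff c 0) =
      (1 / 2 : ℂ) * (c ⟨⟨1, by omega⟩, fun _ => (i, false)⟩ -
        Complex.I * c ⟨⟨1, by omega⟩, fun _ => (i, true)⟩) := by
  have hcoeff : ∀ a, coeff 0 (polarWord (⟨⟨1, by omega⟩, fun _ => a⟩ : JetIndex n k)) =
      constantCoeff (polarizedCoord a) := by
    intro a
    rw [← constantCoeff_eq, polarWord, map_prod]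
    simp
  rw [jetCoeff, coeff_sum, Fintype.sum_sigma, Finset.sum_eq_single ⟨1, by omega⟩]
  · have h1 := Fintype.sum_equiv (Equiv.funUnique (Fin 1) (Fin n × Bool)).symm
      (fun a => coeff (Finsupp.single i 1) (C (c ⟨⟨1, by omega⟩, fun _ => a⟩ : ℂ) *
        coeff 0 (polarWord (⟨⟨1, by omega⟩, fun _ => a⟩ : JetIndex n k))))
      (fun w => coeff (Finsupp.single i 1) (C (c ⟨⟨1, by omega⟩, w⟩ : ℂ) *
        coeff 0 (polarWord (⟨⟨1, by omega⟩, w⟩ : JetIndex n k)))) (fun a => rfl)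
    refine h1.symm.trans ?_
    simp only [hcoeff]
    rw [Fintype.sum_prod_type, Finset.sum_eq_single i]
    · simp only [Fintype.sum_bool, constantCoeff_polarizedCoord_false,
        constantCoeff_polarizedCoord_true, coeff_C_mul, coeff_X, if_true]
      ring
    · intro j _ hj
      have hX : coeff (Finsupp.single i 1) (X j : MvPolynomial (Fin n) ℂ) = 0 := by
        rw [coeff_X, if_neg]
        exact fun h => hj (Finsupp.single_left_injective one_ne_zero h)
      simp only [Fintype.sum_bool, constantCoeff_polarizedCoord_false,
        constantCoeff_polarizedCoord_true, coeff_C_mul, hX]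
      ring
    · simp
  · intro j _ hj
    refine Finset.sum_eq_zero fun w _ => ?_
    rw [coeff_C_mul, (isHomogeneous_coeff_zero_polarWord _).coeff_eq_zero, mul_zero]
    simpa using fun h => hj (Fin.ext h.symm)
  · simp

theorem polyTendsto_jetCoeff {n k : ℕ} {c : ℕ → JetIndex n k → ℝ} {c' : JetIndex n k → ℝ}
    (h : ∀ w, Tendsto (fun j => c j w) atTop (𝓝 (c' w))) (β : Fin n →₀ ℕ) :
    PolyTendsto (fun j => jetCoeff (c j) β) (jetCoeff c' β) :=
  PolyTendsto.sum Finset.univ fun w _ => (PolyTendsto.C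
    ((Complex.continuous_ofReal.tendsto _).comp (h w))).mul (PolyTendsto.const _)

end

section

open Filter Asymptotics
open scoped Topology ContDiff Nat

section Taylor

variable {E F : Type*} [NormedAddCommGroup E] [NormedSpace ℝ E] [NormedAddCommGroup F]
  [NormedSpace ℝ F]

theorem taylor_remainder_isBigO [CompleteSpace F] {f : E → F} {p : E} {k : ℕ}
    (hf : ContDiffAt ℝ (k + 1) f p) :
    (fun x => f (p + x) - ∑ j ∈ Finset.range (k + 1),
      (j ! : ℝ)⁻¹ • iteratedFDeriv ℝ j f p fun _ => x) =O[𝓝 0] fun x => ‖x‖ ^ (k + 1) := by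
  have h1 : ∀ᶠ z in 𝓝 p, ContDiffAt ℝ (k + 1) f z := by
    have := hf.eventually (by simp)
    exact_mod_cast this
  have hc : ContinuousAt (iteratedFDeriv ℝ (k + 1) f) p := by
    have : ContDiffAt ℝ ((k + 1 : ℕ) : ℕ∞ω) f p := by exact_mod_cast hf
    exact (this.iteratedFDeriv_right (i := k + 1) (m := 0) (by simp)).continuousAt
  set K := ‖iteratedFDeriv ℝ (k + 1) f p‖ + 1
  have h2 : ∀ᶠ z in 𝓝 p, ‖iteratedFDeriv ℝ (k + 1) f z‖ < K :=
    hc.norm.eventually (gt_mem_nhds (lt_add_one _))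
  obtain ⟨ε, hε, hball⟩ := Metric.eventually_nhds_iff_ball.1 (h1.and h2)
  refine IsBigO.of_bound ((k ! : ℝ)⁻¹ * K) ?_
  filter_upwards [Metric.ball_mem_nhds (0 : E) hε] with x hx
  have hmem : ∀ t ∈ Set.Icc (0 : ℝ) 1, p + t • x ∈ Metric.ball p ε := by
    intro t ht
    rw [mem_ball_iff_norm, add_sub_cancel_left, norm_smul, Real.norm_of_nonneg ht.1]
    refine lt_of_le_of_lt ?_ (mem_ball_zero_iff.1 hx)
    exact mul_le_of_le_one_left (norm_nonneg _) ht.2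
  rw [map_add_eq_sum_add_integral_iteratedFDeriv fun t ht => (hball _ (hmem t ht)).1,
    add_sub_cancel_left, norm_smul, norm_inv, RCLike.norm_natCast, norm_pow, norm_norm, mul_assoc]
  gcongr
  have h3 := intervalIntegral.norm_integral_le_of_norm_le_const (a := (0 : ℝ)) (b := 1)
    (C := K * ‖x‖ ^ (k + 1))
    (f := fun t : ℝ => (1 - t) ^ k • iteratedFDeriv ℝ (k + 1) f (p + t • x) fun _ => x) (by
      intro t ht
      rw [Set.uIoc_of_le zero_le_one] at ht
      rw [norm_smul, norm_pow, Real.norm_of_nonneg (by linarith [ht.2])]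
      have h4 : (1 - t) ^ k ≤ 1 := pow_le_one₀ (by linarith [ht.2]) (by linarith [ht.1])
      refine (mul_le_of_le_one_left (norm_nonneg _) h4).trans ?_
      refine (ContinuousMultilinearMap.le_opNorm _ _).trans ?_
      rw [Finset.prod_const, Finset.card_univ, Fintype.card_fin]
      gcongr
      exact (hball _ (hmem t ⟨ht.1.le, ht.2⟩)).2.le)
  simpa using h3

theorem isBigO_of_iteratedFDeriv_eq_zero [CompleteSpace F] {f : E → F} {N : ℕ}
    (hf : ContDiffAt ℝ N f 0)
    (h : ∀ m < N, iteratedFDeriv ℝ m f 0 = 0) : f =O[𝓝 0] fun x => ‖x‖ ^ N := by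
  rcases N with _ | k
  · simpa using hf.continuousAt.isBigO_one ℝ
  · have h1 := taylor_remainder_isBigO (k := k) (by exact_mod_cast hf)
    refine h1.congr_left fun x => ?_
    rw [Finset.sum_eq_zero fun j hj => ?_]
    · simp
    · simp [h j (Finset.mem_range.1 hj)]

theorem iteratedFDeriv_comp_swap {f : E → F} (m : ℕ) : ∀ {p : E}, ContDiffAt ℝ (m + 1 : ℕ) f p →
    ∀ (i : Fin m) (v : Fin (m + 1) → E),
      iteratedFDeriv ℝ (m + 1) f p (v ∘ Equiv.swap i.castSucc i.succ) =
        iteratedFDeriv ℝ (m + 1) f p v := by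
  induction m with
  | zero => exact fun _ i => i.elim0
  | succ m ih =>
  intro p hf i v
  have hev : ∀ᶠ y in 𝓝 p, ContDiffAt ℝ (m + 1 + 1 : ℕ) f y := hf.eventually (by simp)
  have hd : ∀ k ≤ m + 1, ∀ {y}, ContDiffAt ℝ (m + 1 + 1 : ℕ) f y →
      DifferentiableAt ℝ (iteratedFDeriv ℝ k f) y :=
    fun k hk y hy => hy.differentiableAt_iteratedFDeriv (by exact_mod_cast Nat.lt_succ_of_le hk)
  induction i using Fin.cases with
  | zero =>
    have hsm : ∀ w : Fin (m + 2) → E,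
        ContDiffAt ℝ 2 (fun y => iteratedFDeriv ℝ m f y (Fin.tail (Fin.tail w))) p := by
      intro w
      have h1 : ContDiffAt ℝ 2 (iteratedFDeriv ℝ m f) p :=
        hf.iteratedFDeriv_right (by norm_cast; omega)
      exact (ContinuousMultilinearMap.apply ℝ (fun _ : Fin m => E) F _).contDiff.contDiffAt.comp p h1
    have key : ∀ w : Fin (m + 2) → E, iteratedFDeriv ℝ (m + 2) f p w =
        fderiv ℝ (fderiv ℝ fun y => iteratedFDeriv ℝ m f y (Fin.tail (Fin.tail w))) p (w 0)
          (w 1) := by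
      intro w
      rw [(hd (m + 1) le_rfl hf).iteratedFDeriv_succ_apply_left']
      have h1 : (fun y => iteratedFDeriv ℝ (m + 1) f y (Fin.tail w)) =ᶠ[𝓝 p]
          fun y => fderiv ℝ (fun y => iteratedFDeriv ℝ m f y (Fin.tail (Fin.tail w))) y (w 1) := by
        filter_upwards [hev] with y hy
        rw [(hd m (Nat.le_succ m) hy).iteratedFDeriv_succ_apply_left']
        rfl
      rw [h1.fderiv_eq, fderiv_clm_apply (((hsm w).fderiv_right (m := 1) (by
        norm_num)).differentiableAt (by simp)) (by fun_prop)]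
      simp
    rw [key, key]
    have ht : Fin.tail (Fin.tail (v ∘ Equiv.swap (Fin.castSucc (0 : Fin (m + 1))) (Fin.succ 0))) =
        Fin.tail (Fin.tail v) := by
      ext k
      simp only [Fin.tail, Function.comp_apply]
      rw [Equiv.swap_apply_of_ne_of_ne]
      · simp
      · simp [Fin.ext_iff]
    rw [ht]
    have hsymm : IsSymmSndFDerivAt ℝ
        (fun y => iteratedFDeriv ℝ m f y (Fin.tail (Fin.tail v))) p := by
      refine ContDiffAt.isSymmSndFDerivAt (n := 2) (hsm v) (by simp)
    simpa using hsymm.eq _ _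
  | succ i =>
    rw [(hd (m + 1) le_rfl hf).iteratedFDeriv_succ_apply_left',
      (hd (m + 1) le_rfl hf).iteratedFDeriv_succ_apply_left']
    have ht : Fin.tail (v ∘ Equiv.swap i.succ.castSucc i.succ.succ) =
        Fin.tail v ∘ Equiv.swap i.castSucc i.succ := by
      ext k
      simp only [Fin.tail, Function.comp_apply, ← Fin.succ_castSucc]
      rw [(Fin.succ_injective _).swap_apply]
    rw [ht]
    have h1 : (fun y => iteratedFDeriv ℝ (m + 1) f y (Fin.tail v ∘ Equiv.swap i.castSucc i.succ))
        =ᶠ[𝓝 p] fun y => iteratedFDeriv ℝ (m + 1) f y (Fin.tail v) := by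
      filter_upwards [hev] with y hy
      exact ih (hy.of_le (by exact_mod_cast Nat.le_succ _)) i _
    rw [h1.fderiv_eq]
    simp only [Function.comp_apply]
    rw [Equiv.swap_apply_of_ne_of_ne]
    · simp [Fin.ext_iff]
    · simp [Fin.ext_iff]

theorem ContDiffAt.iteratedFDeriv_comp_perm_of_top {f : E → F} {p : E} (hf : ContDiffAt ℝ ∞ f p)
    {m : ℕ} (σ : Equiv.Perm (Fin m)) (v : Fin m → E) :
    iteratedFDeriv ℝ m f p (v ∘ σ) = iteratedFDeriv ℝ m f p v := by
  rcases m with _ | m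
  · congr 1
    exact Subsingleton.elim _ _
  · have hσ : σ ∈ Submonoid.closure
        (Set.range fun i : Fin m => Equiv.swap i.castSucc i.succ) := by
      rw [Equiv.Perm.mclosure_swap_castSucc_succ]
      trivial
    induction hσ using Submonoid.closure_induction generalizing v with
    | mem _ h =>
      obtain ⟨i, rfl⟩ := h
      exact iteratedFDeriv_comp_swap m (hf.of_le (by exact_mod_cast le_top)) i v
    | one => rfl
    | mul σ τ _ _ hσ hτ =>
      rw [Equiv.Perm.coe_mul, ← Function.comp_assoc, hτ, hσ]

theorem iteratedFDeriv_eq_zero_of_forall_diag {f : E → F} {p : E} {m : ℕ}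
    (hf : ContDiffAt ℝ ∞ f p) (h : ∀ x, iteratedFDeriv ℝ m f p (fun _ => x) = 0) :
    iteratedFDeriv ℝ m f p = 0 := by
  ext v
  have h1 := (iteratedFDeriv ℝ m f p).iteratedFDeriv_comp_diagonal (0 : E) v
  simp only [h] at h1
  have h2 : ∀ σ : Equiv.Perm (Fin m), iteratedFDeriv ℝ m f p (fun i => v (σ i)) =
      iteratedFDeriv ℝ m f p v := fun σ => hf.iteratedFDeriv_comp_perm_of_top σ v
  simp only [h2, Finset.sum_const, Finset.card_univ] at h1
  have h3 : iteratedFDeriv ℝ m (fun _ : E => (0 : F)) 0 = 0 := by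
    simp [iteratedFDeriv_fun_zero]
  rw [h3, zero_apply, ← Nat.cast_smul_eq_nsmul ℝ] at h1
  exact (smul_eq_zero.1 h1.symm).resolve_left (by simp [Fintype.card_ne_zero])

theorem iteratedFDeriv_eq_zero_of_isBigO [CompleteSpace F] {f : E → F}
    (hf : ContDiffAt ℝ ∞ f 0) {N : ℕ}
    (h : f =O[𝓝 0] fun x => ‖x‖ ^ N) : ∀ m < N, iteratedFDeriv ℝ m f 0 = 0 := by
  intro m
  induction m using Nat.strong_induction_on with
  | _ m ih =>
  intro hm
  have hfm : ContDiffAt ℝ (m + 1) f 0 := hf.of_le (by exact_mod_cast le_top)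
  refine iteratedFDeriv_eq_zero_of_forall_diag hf fun x => ?_
  have h1 := taylor_remainder_isBigO hfm
  simp only [zero_add] at h1
  have h2 : f =O[𝓝 0] fun x => ‖x‖ ^ (m + 1) := by
    refine h.trans (IsBigO.of_bound 1 ?_)
    filter_upwards [Metric.ball_mem_nhds (0 : E) one_pos] with x hx
    rw [norm_pow, norm_pow, norm_norm, one_mul]
    exact pow_le_pow_of_le_one (norm_nonneg _) (mem_ball_zero_iff.1 hx).le hm
  have h3 : (fun x => iteratedFDeriv ℝ m f 0 fun _ => x) =O[𝓝 0] fun x => ‖x‖ ^ (m + 1) := by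
    have h4 := (h2.sub h1).const_smul_left (m ! : ℝ)
    refine h4.congr_left fun x => ?_
    rw [Pi.smul_apply, sub_sub_cancel]
    rw [Finset.sum_range_succ, Finset.sum_eq_zero fun j hj => ?_]
    · simp [smul_smul, Nat.factorial_ne_zero]
    · have := Finset.mem_range.1 hj
      simp [ih j this (by omega)]
  have hs : Tendsto (fun s : ℝ => s • x) (𝓝[>] 0) (𝓝 0) := by
    have : Continuous fun s : ℝ => s • x := by fun_prop
    simpa using (this.tendsto 0).mono_left (nhdsWithin_le_nhds (s := Set.Ioi 0))
  obtain ⟨c, hc⟩ := (h3.comp_tendsto hs).bound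
  have h5 : Tendsto (fun s : ℝ => s * (c * ‖x‖ ^ (m + 1))) (𝓝[>] 0) (𝓝 0) := by
    have : Continuous fun s : ℝ => s * (c * ‖x‖ ^ (m + 1)) := by fun_prop
    simpa using (this.tendsto 0).mono_left (nhdsWithin_le_nhds (s := Set.Ioi 0))
  rw [← norm_le_zero_iff]
  refine ge_of_tendsto h5 ?_
  filter_upwards [hc, self_mem_nhdsWithin] with s hs hs0
  have hs0' : (0 : ℝ) < s := hs0
  have h6 : (iteratedFDeriv ℝ m f 0 fun _ => s • x) = s ^ m • iteratedFDeriv ℝ m f 0 fun _ => x := by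
    simpa using (iteratedFDeriv ℝ m f 0).map_smul_univ (fun _ => s) (fun _ => x)
  simp only [Function.comp_apply, h6, norm_smul, norm_pow, norm_mul, norm_norm,
    Real.norm_of_nonneg hs0'.le] at hs
  refine le_of_mul_le_mul_left ?_ (pow_pos hs0' m)
  refine hs.trans_eq ?_
  ring

end Taylor

end

section

open Filter Asymptotics MvPolynomial
open scoped Topology ContDiff ENNReal Polynomial ComplexConjugate

theorem natCast_le_vOrder_iff {E F : Type*} [NormedAddCommGroup E] [NormedSpace ℝ E]
    [NormedAddCommGroup F] [NormedSpace ℝ F] {f : E → F} {N : ℕ} :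
    (N : ℝ≥0∞) ≤ vOrder f ↔ ∀ m < N, iteratedFDeriv ℝ m f 0 = 0 := by
  simp only [vOrder, le_iInf_iff, Set.mem_ofPred_eq, Nat.cast_le]
  exact forall_congr' fun m => ⟨fun h hm => by_contra fun h0 => absurd (h h0) (not_le.2 hm),
    fun h h0 => not_lt.1 fun hm => h0 (h hm)⟩

theorem natCast_le_vOrder_of_isBigO {E F : Type*} [NormedAddCommGroup E] [NormedSpace ℝ E]
    [NormedAddCommGroup F] [NormedSpace ℝ F] [CompleteSpace F] {f : E → F}
    (hf : ContDiffAt ℝ ∞ f 0) {N : ℕ} (h : f =O[𝓝 0] fun x => ‖x‖ ^ N) :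
    (N : ℝ≥0∞) ≤ vOrder f :=
  natCast_le_vOrder_iff.2 (iteratedFDeriv_eq_zero_of_isBigO hf h)

theorem isBigO_of_natCast_le_vOrder {E F : Type*} [NormedAddCommGroup E] [NormedSpace ℝ E]
    [NormedAddCommGroup F] [NormedSpace ℝ F] [CompleteSpace F] {f : E → F}
    (hf : ContDiffAt ℝ ∞ f 0) {N : ℕ} (h : (N : ℝ≥0∞) ≤ vOrder f) :
    f =O[𝓝 0] fun x => ‖x‖ ^ N :=
  isBigO_of_iteratedFDeriv_eq_zero (hf.of_le (by exact_mod_cast le_top))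
    (natCast_le_vOrder_iff.1 h)

theorem floor_add_one_le_vOrder {E F : Type*} [NormedAddCommGroup E] [NormedSpace ℝ E]
    [NormedAddCommGroup F] [NormedSpace ℝ F] {f : E → F} {x : ℝ} 
    (h : ENNReal.ofReal x < vOrder f) : ((⌊x⌋₊ + 1 : ℕ) : ℝ≥0∞) ≤ vOrder f := by
  simp only [vOrder, le_iInf_iff]
  intro m hm
  have h1 : ENNReal.ofReal x < m := h.trans_le (iInf₂_le m hm)
  have h2 : x < m := by
    by_contra hx
    refine absurd h1 (not_lt.2 ?_)
    rw [← ENNReal.ofReal_natCast]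
    exact ENNReal.ofReal_le_ofReal (not_lt.1 hx)
  have h3 : ⌊x⌋₊ < m :=
    ((Nat.floor_lt' (by rintro rfl; simp at h1)).2 h2)
  exact_mod_cast h3

/-- Evaluation of a polynomial arc. -/
noncomputable def arcEval {n : ℕ} (γ : Fin n → ℂ[X]) (t : ℂ) : Fin n → ℂ := fun k => (γ k).eval t

theorem arcEval_zero {n : ℕ} {γ : Fin n → ℂ[X]} (hγ : ∀ k, Polynomial.X ∣ γ k) :
    arcEval γ 0 = 0 := by
  ext k
  simpa [arcEval, Polynomial.coeff_zero_eq_eval_zero] using Polynomial.X_dvd_iff.1 (hγ k)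

theorem analyticAt_arcEval {n : ℕ} (γ : Fin n → ℂ[X]) (t : ℂ) : AnalyticAt ℂ (arcEval γ) t := by
  refine AnalyticAt.pi fun k => ?_
  exact (γ k).differentiable.analyticAt t 

theorem arcEval_isBigO {n : ℕ} {γ : Fin n → ℂ[X]} {ν : ℕ} (hγ : ∀ k, Polynomial.X ^ ν ∣ γ k) :
    arcEval γ =O[𝓝 0] fun t => ‖t‖ ^ ν := by
  refine isBigO_pi.2 fun k => ?_
  have h := (eval_isBigO_of_X_pow_dvd (hγ k)).norm_right
  simp only [norm_pow] at h
  exact h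

theorem comp_arcEval_isBigO_iff {n k : ℕ} {r : (Fin n → ℂ) → ℝ} {p : Fin n → ℂ}
    (hr : ContDiffAt ℝ ∞ r p) {γ : Fin n → ℂ[X]} (hγ₀ : ∀ k, Polynomial.X ∣ γ k) {ν N : ℕ}
    (hγ : ∀ k, Polynomial.X ^ ν ∣ γ k) (hN : N ≤ ν * (k + 1)) :
    ((fun t => r (p + arcEval γ t)) =O[𝓝 0] fun t => ‖t‖ ^ N) ↔
      (fun t : ℂ => ∑ β : polarSupport n k, (aeval γ (jetCoeff (jet n k r p) β)).eval t *
        conj ((aeval γ (monomial (β : Fin n →₀ ℕ) (1 : ℂ))).eval t)) =O[𝓝 0] fun t => t ^ N := by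
  have h1 : ∀ t : ℂ, ∑ β : polarSupport n k, (aeval γ (jetCoeff (jet n k r p) β)).eval t *
      conj ((aeval γ (monomial (β : Fin n →₀ ℕ) (1 : ℂ))).eval t) =
      (taylorPoly n k r p (p + arcEval γ t) : ℂ) := by
    intro t
    rw [taylorPoly_eq_sum_jet, ← sum_jetCoeff_mul_conj]
    simp only [← eval_aeval_arc]
    rfl
  have hlim : Tendsto (arcEval γ) (𝓝 0) (𝓝 0) := by
    have := (analyticAt_arcEval γ 0).continuousAt.tendsto
    rwa [arcEval_zero hγ₀] at this
  have h2 : (fun t => r (p + arcEval γ t) - taylorPoly n k r p (p + arcEval γ t)) =O[𝓝 0]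
      fun t => ‖t‖ ^ N := by
    have h3 := (taylor_remainder_isBigO (k := k) (f := r) (p := p)
      (hr.of_le (by exact_mod_cast le_top))).comp_tendsto hlim
    have h4 : (fun t => ‖arcEval γ t‖ ^ (k + 1)) =O[𝓝 0] fun t : ℂ => ‖t‖ ^ N := by
      refine ((arcEval_isBigO hγ).norm_left.pow (k + 1)).trans (IsBigO.of_bound 1 ?_)
      filter_upwards [Metric.ball_mem_nhds (0 : ℂ) one_pos] with x hx
      rw [← pow_mul, norm_pow, norm_pow, norm_norm, one_mul]
      exact pow_le_pow_of_le_one (norm_nonneg _) (mem_ball_zero_iff.1 hx).le hN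
    refine (h3.trans h4).congr_left fun t => ?_
    simp [taylorPoly]
  have h5 : ((fun t => taylorPoly n k r p (p + arcEval γ t)) =O[𝓝 0] fun t => ‖t‖ ^ N) ↔
      (fun t : ℂ => (taylorPoly n k r p (p + arcEval γ t) : ℂ)) =O[𝓝 0] fun t => t ^ N := by
    rw [← isBigO_norm_left, ← isBigO_norm_left (E' := ℂ), ← isBigO_norm_right (g' := fun t => t ^ N)]
    simp only [norm_pow, Complex.norm_real]
  simp only [h1]
  rw [← h5]
  exact ⟨fun h => (h.sub h2).congr_left fun t => by ring, fun h => (h.add h2).congr_left fun t => by ring⟩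

theorem exists_arc_of_mem_curves {n : ℕ} {p : Fin n → ℂ} {c : ℂ → Fin n → ℂ}
    (hc : c ∈ Curves n p) : ∃ ν : ℕ, 0 < ν ∧ (ν : ℝ≥0∞) ≤ nuCurve c p ∧ ∀ N, ∃ γ : Fin n → ℂ[X],
      (∀ k, Polynomial.X ^ ν ∣ γ k) ∧ (∃ i, ¬ Polynomial.X ^ (ν + 1) ∣ γ i) ∧
      (fun t => c t - (p + arcEval γ t)) =O[𝓝 0] fun t => ‖t‖ ^ N := by
  obtain ⟨han, hc0, hne⟩ := hc
  obtain ⟨P, hP⟩ := han.sub (analyticAt_const (v := p))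
  have hP0 : P ≠ 0 := by
    rintro rfl
    refine hne ?_
    filter_upwards [hP.eventually_eq_zero] with t ht
    exact sub_eq_zero.1 ht
  have hν : 0 < P.order := by
    rw [pos_iff_ne_zero, Ne, FormalMultilinearSeries.order_eq_zero_iff hP0, not_not]
    refine ContinuousMultilinearMap.ext fun v => ?_
    rw [hP.coeff_zero v]
    simp [hc0]
  have key : ∀ N, ∃ γ : Fin n → ℂ[X], (∀ k, Polynomial.X ^ P.order ∣ γ k) ∧
      (P.order < N → ∃ i, ¬ Polynomial.X ^ (P.order + 1) ∣ γ i) ∧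
      (fun t => c t - (p + arcEval γ t)) =O[𝓝 0] fun t => ‖t‖ ^ N := by
    intro N
    have hcoeff : ∀ k d, (∑ m ∈ Finset.range N, Polynomial.monomial m (P.coeff m k)).coeff d =
        if d < N then P.coeff d k else 0 := by
      intro k d
      simp [Polynomial.finsetSum_coeff, Polynomial.coeff_monomial]
    refine ⟨fun k => ∑ m ∈ Finset.range N, Polynomial.monomial m (P.coeff m k), fun k => ?_,
      fun hlt => ?_, ?_⟩
    · refine Polynomial.X_pow_dvd_iff.2 fun d hd => ?_
      rw [hcoeff, FormalMultilinearSeries.coeff_eq_zero.2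
        (FormalMultilinearSeries.apply_eq_zero_of_lt_order hd)]
      simp
    · by_contra! hdvd
      refine FormalMultilinearSeries.apply_order_ne_zero hP0
        (FormalMultilinearSeries.coeff_eq_zero.1 (funext fun k => ?_))
      have := Polynomial.X_pow_dvd_iff.1 (hdvd k) P.order (Nat.lt_succ_self _)
      rwa [hcoeff, if_pos hlt] at this
    · refine (hP.isBigO_sub_partialSum_pow N).congr_left fun t => ?_
      ext k
      simp only [zero_add, FormalMultilinearSeries.partialSum, Pi.sub_apply, Pi.add_apply, arcEval,
        Finset.sum_apply, Polynomial.eval_finsetSum, Polynomial.eval_monomial,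
        FormalMultilinearSeries.apply_eq_pow_smul_coeff, Pi.smul_apply, smul_eq_mul]
      simp only [mul_comm]
      ring
  refine ⟨P.order, hν, le_iInf fun i => natCast_le_vOrder_of_isBigO ?_ ?_, fun N => ?_⟩
  · have h1 : AnalyticAt ℂ (fun t => c t i) 0 := (analyticAt_pi_iff.1 han) i
    exact (h1.restrictScalars (𝕜 := ℝ)).contDiffAt.sub contDiffAt_const
  · obtain ⟨γ, h1, -, h3⟩ := key P.order
    refine isBigO_pi.1 ((h3.add (arcEval_isBigO h1)).congr_left (f₂ := fun t => c t - p)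
      fun t => ?_) i
    abel
  · obtain ⟨γ, h1, h2, h3⟩ := key (max N (P.order + 1))
    refine ⟨γ, h1, h2 (by omega), h3.trans (IsBigO.of_bound 1 ?_)⟩
    filter_upwards [Metric.ball_mem_nhds (0 : ℂ) one_pos] with x hx
    rw [norm_pow, norm_pow, norm_norm, one_mul]
    exact pow_le_pow_of_le_one (norm_nonneg _) (mem_ball_zero_iff.1 hx).le (le_max_left _ _)

theorem nuCurve_arcEval_le {n : ℕ} {γ : Fin n → ℂ[X]} (p : Fin n → ℂ) {i : Fin n} {e : ℕ}
    (h : ¬ Polynomial.X ^ (e + 1) ∣ γ i) : nuCurve (fun t => p + arcEval γ t) p ≤ e := by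
  refine (iInf_le _ i).trans ?_
  by_contra hlt
  have h1 := floor_add_one_le_vOrder (x := e) (by rw [ENNReal.ofReal_natCast]; exact not_le.1 hlt)
  rw [Nat.floor_natCast] at h1
  refine h (X_pow_dvd_of_isBigO ?_)
  have h2 := isBigO_of_natCast_le_vOrder ?_ h1
  · have hs : Tendsto (fun s : ℝ => (s : ℂ)) (𝓝[>] 0) (𝓝 0) := by
      have := (Complex.continuous_ofReal.tendsto 0).mono_left
        (nhdsWithin_le_nhds (s := Set.Ioi 0))
      simpa using this
    have h3 := (h2.comp_tendsto hs).norm_right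
    refine (h3.congr_left (f₂ := fun s : ℝ => (γ i).eval (s : ℂ)) fun s => ?_).trans ?_
    · simp [arcEval]
    · exact IsBigO.of_bound 1 (Eventually.of_forall fun s => by simp)
  · simp only [Pi.add_apply, add_sub_cancel_left, arcEval]
    exact ((γ i).differentiable.analyticAt 0).restrictScalars.contDiffAt

theorem comp_isBigO_of_sub_isBigO {n N : ℕ} {r : (Fin n → ℂ) → ℝ} {p : Fin n → ℂ}
    (hr : ContDiffAt ℝ ∞ r p) {c c' : ℂ → Fin n → ℂ} (hc : Tendsto c (𝓝 0) (𝓝 p))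
    (hc' : Tendsto c' (𝓝 0) (𝓝 p)) (h : (fun t => c t - c' t) =O[𝓝 0] fun t => ‖t‖ ^ N) :
    ((fun t => r (c t)) =O[𝓝 0] fun t => ‖t‖ ^ N) →
      (fun t => r (c' t)) =O[𝓝 0] fun t => ‖t‖ ^ N := by
  have h1 := (hr.hasStrictFDerivAt (by simp)).isBigO_sub.comp_tendsto
    (by simpa only [nhds_prod_eq] using hc.prodMk hc')
  intro h2
  refine (h2.sub (h1.trans h)).congr_left fun t => ?_
  simp

theorem exists_fin_span_image {X V : Type*} [AddCommGroup V] [Module ℝ V] [FiniteDimensional ℝ V]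
    (I : Set X) (J : X → V) : ∃ (m : ℕ) (r : Fin m → X), (∀ i, r i ∈ I) ∧
      ∀ x ∈ I, J x ∈ Submodule.span ℝ (Set.range fun i => J (r i)) := by
  obtain ⟨s, hs, hspan⟩ := (Submodule.fg_span_iff_fg_span_finset_subset (R := ℝ) (J '' I)).1
    (IsNoetherian.noetherian _)
  choose r hr using fun i : Fin s.card => hs (s.equivFin.symm i).2
  refine ⟨s.card, r, fun i => (hr i).1, fun x hx => ?_⟩
  have h1 : J x ∈ Submodule.span ℝ (s : Set V) :=
    hspan ▸ Submodule.subset_span (Set.mem_image_of_mem J hx)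
  refine Submodule.span_mono ?_ h1
  intro v hv
  refine ⟨s.equivFin ⟨v, hv⟩, ?_⟩
  simp [(hr _).2]

theorem contDiffAt_of_mem_IMp {n : ℕ} {M : Set (Fin n → ℂ)} {p : Fin n → ℂ}
    {r : (Fin n → ℂ) → ℝ} (hr : r ∈ IMp n M p) : ContDiffAt ℝ ∞ r p := by
  obtain ⟨U, hU, hp, h, -⟩ := hr
  exact h.contDiffAt (hU.mem_nhds hp)

theorem eq_zero_of_mem_IMp {n : ℕ} {M : Set (Fin n → ℂ)} {p : Fin n → ℂ} (hp : p ∈ M)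
    {r : (Fin n → ℂ) → ℝ} (hr : r ∈ IMp n M p) : r p = 0 := by
  obtain ⟨U, -, hpU, -, h⟩ := hr
  exact h p ⟨hp, hpU⟩

theorem eventually_mem_IMp {n : ℕ} {M : Set (Fin n → ℂ)} {p : Fin n → ℂ}
    {r : (Fin n → ℂ) → ℝ} (hr : r ∈ IMp n M p) : ∀ᶠ q in 𝓝 p, r ∈ IMp n M q := by
  obtain ⟨U, hU, hpU, h⟩ := hr
  filter_upwards [hU.mem_nhds hpU] with q hq
  exact ⟨U, hU, hq, h⟩

theorem tendsto_jet {n k : ℕ} {r : (Fin n → ℂ) → ℝ} {p : Fin n → ℂ} (hr : ContDiffAt ℝ ∞ r p)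
    {q : ℕ → Fin n → ℂ} (hq : Tendsto q atTop (𝓝 p)) (w : JetIndex n k) :
    Tendsto (fun j => jet n k r (q j) w) atTop (𝓝 (jet n k r p w)) := by
  have h1 : ContDiffAt ℝ 0 (iteratedFDeriv ℝ w.1 r) p :=
    hr.iteratedFDeriv_right (by simpa using by exact_mod_cast le_top)
  have h2 := h1.continuousAt.tendsto.comp hq
  exact (((continuous_eval_const fun m => realDir (w.2 m)).tendsto _).comp h2).const_mul _

theorem coeff_single_jetCoeff_jet {n k : ℕ} (hk : 0 < k) (r : (Fin n → ℂ) → ℝ) (p : Fin n → ℂ)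
    (i : Fin n) : coeff (Finsupp.single i 1) (jetCoeff (jet n k r p) 0) = delVec n r p i := by
  rw [coeff_single_jetCoeff_zero hk, delVec]
  simp [jet, realDir]

theorem constantCoeff_jetCoeff_jet {n k : ℕ} (r : (Fin n → ℂ) → ℝ) (p : Fin n → ℂ) :
    constantCoeff (jetCoeff (jet n k r p) 0) = r p := by
  rw [constantCoeff_jetCoeff_zero]
  simp [jet]

theorem sum_jetCoeff_isBigO_of_mem_span {n k N : ℕ} {κ : Type*} {c : κ → JetIndex n k → ℝ}
    {γ : Fin n → ℂ[X]}
    (h : ∀ i, (fun t : ℂ => ∑ β : polarSupport n k, (aeval γ (jetCoeff (c i) β)).eval t *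
      conj ((aeval γ (monomial (β : Fin n →₀ ℕ) (1 : ℂ))).eval t)) =O[𝓝 0] fun t => t ^ N)
    {x : JetIndex n k → ℝ} (hx : x ∈ Submodule.span ℝ (Set.range c)) :
    (fun t : ℂ => ∑ β : polarSupport n k, (aeval γ (jetCoeff x β)).eval t *
      conj ((aeval γ (monomial (β : Fin n →₀ ℕ) (1 : ℂ))).eval t)) =O[𝓝 0] fun t => t ^ N := by
  simp only [← eval_aeval_arc, sum_jetCoeff_mul_conj] at h ⊢
  induction hx using Submodule.span_induction with
  | mem x hx =>
    obtain ⟨i, rfl⟩ := hx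
    exact h i
  | zero => simpa using isBigO_zero _ _
  | add x y _ _ hx hy =>
    refine (hx.add hy).congr_left fun t => ?_
    simp [add_mul, Finset.sum_add_distrib]
  | smul a x _ hx =>
    refine (hx.const_mul_left (a : ℂ)).congr_left fun t => ?_
    simp [Finset.mul_sum, mul_assoc]

theorem arc_mem_curves {n : ℕ} {γ : Fin n → ℂ[X]} (p : Fin n → ℂ)
    (hγ : ∀ k, Polynomial.X ∣ γ k) {i : Fin n} {e : ℕ} (he : ¬ Polynomial.X ^ e ∣ γ i) :
    (fun t => p + arcEval γ t) ∈ Curves n p := by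
  refine ⟨analyticAt_const.add (analyticAt_arcEval γ 0), by simp [arcEval_zero hγ], fun h => he ?_⟩
  refine X_pow_dvd_of_isBigO ?_
  have hs : Tendsto (fun s : ℝ => (s : ℂ)) (𝓝[>] 0) (𝓝 0) := by
    have := (Complex.continuous_ofReal.tendsto 0).mono_left
      (nhdsWithin_le_nhds (s := Set.Ioi 0))
    simpa using this
  refine EventuallyEq.trans_isBigO (f₂ := fun _ : ℝ => (0 : ℂ)) ?_
    (isBigO_zero _ _)
  filter_upwards [hs.eventually h] with s hs
  simpa [arcEval] using congrFun hs i

theorem tendsto_add_arcEval {n : ℕ} {γ : Fin n → ℂ[X]} (p : Fin n → ℂ)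
    (hγ : ∀ k, Polynomial.X ∣ γ k) : Tendsto (fun t => p + arcEval γ t) (𝓝 0) (𝓝 p) := by
  have := ((analyticAt_arcEval γ 0).continuousAt.tendsto).const_add p
  rwa [arcEval_zero hγ, add_zero] at this

/-- Along arcs through a point of type at most `T`, the projected jets vanish to order
at most `T` times the order of the arc. -/
theorem exists_not_dvd_of_Delta_le {n k : ℕ} {M : Set (Fin n → ℂ)} {p : Fin n → ℂ} (hp : p ∈ M)
    {T : ℝ} (hT : 0 ≤ T) (hΔ : Delta n M p ≤ ENNReal.ofReal T) (hk : T < k + 1) {κ : Type*}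
    {r : κ → (Fin n → ℂ) → ℝ}
    (hspan : ∀ f ∈ IMp n M p, jet n k f p ∈ Submodule.span ℝ (Set.range fun i => jet n k (r i) p))
    {H : polarSupport n k → polarSupport n k → ℂ} (hH : ∀ β β', H β β' = conj (H β' β))
    {γ : Fin n → ℂ[X]} (hγ : ∀ k, Polynomial.X ∣ γ k) {i : Fin n} {e : ℕ}
    (he : ¬ Polynomial.X ^ (e + 1) ∣ γ i) :
    ∃ l, ∃ o : ℕ, (o : ℝ) ≤ T * e ∧ ¬ Polynomial.X ^ (o + 1) ∣
      aeval γ (projFamily Subtype.val H (fun i β => jetCoeff (jet n k (r i) p) β) l) := by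
  classical
  have hex : ∃ m, ∃ i, ¬ Polynomial.X ^ (m + 1) ∣ γ i := ⟨e, i, he⟩
  obtain ⟨ν, hν0, hνe, hdvd, i', hi'⟩ : ∃ ν, 0 < ν ∧ ν ≤ e ∧ (∀ k, Polynomial.X ^ ν ∣ γ k) ∧
      ∃ i', ¬ Polynomial.X ^ (ν + 1) ∣ γ i' := by
    have hpos : 0 < Nat.find hex := by
      rw [Nat.find_pos]
      simpa using hγ
    refine ⟨Nat.find hex, hpos, Nat.find_min' hex ⟨i, he⟩, fun k => ?_, Nat.find_spec hex⟩
    have := Nat.find_min hex (Nat.sub_lt hpos one_pos)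
    push Not at this
    rw [show Nat.find hex - 1 + 1 = Nat.find hex by omega] at this
    exact this k
  have hν : (0 : ℝ) < ν := Nat.cast_pos.2 hν0
  by_contra! hcon
  have ho : ((⌊T * ν⌋₊ : ℕ) : ℝ) ≤ T * ν := Nat.floor_le (by positivity)
  have ho' : T * ν < (⌊T * ν⌋₊ : ℕ) + 1 := Nat.lt_floor_add_one _
  have hN : ⌊T * ν⌋₊ + 1 ≤ ν * (k + 1) := by
    have : ((⌊T * ν⌋₊ : ℕ) : ℝ) < (ν * (k + 1) : ℕ) := by
      push_cast
      nlinarith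
    exact_mod_cast this
  have hfam := sum_isBigO_of_projFamily_dvd Subtype.val
    (fun i β => jetCoeff (jet n k (r i) p) β) γ hH (N := ⌊T * ν⌋₊ + 1) fun l => hcon l _
      (ho.trans (mul_le_mul_of_nonneg_left (Nat.cast_le.2 hνe) hT))
  have hc := arc_mem_curves p hγ hi'
  have hlt : ENNReal.ofReal T < ((⌊T * ν⌋₊ + 1 : ℕ) : ℝ≥0∞) / ν := by
    rw [← ENNReal.ofReal_natCast, ← ENNReal.ofReal_natCast, ← ENNReal.ofReal_div_of_pos hν,
      ENNReal.ofReal_lt_ofReal_iff (by positivity), lt_div_iff₀ hν]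
    exact_mod_cast ho'
  refine absurd hΔ (not_le.2 (hlt.trans_le (le_iSup₂_of_le _ hc (le_iInf₂ fun f hf => ?_))))
  have hfs := contDiffAt_of_mem_IMp hf
  refine ENNReal.div_le_div ?_ (nuCurve_arcEval_le p hi')
  refine natCast_le_vOrder_of_isBigO ?_ ?_
  · refine ContDiffAt.sub ?_ contDiffAt_const
    refine ContDiffAt.comp (0 : ℂ) (f := fun t => p + arcEval γ t) ?_
      (hc.1.restrictScalars (𝕜 := ℝ)).contDiffAt
    simpa [arcEval_zero hγ] using hfs
  · rw [eq_zero_of_mem_IMp hp hf]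
    simp only [sub_zero]
    exact (comp_arcEval_isBigO_iff hfs hγ hdvd hN).2
      (sum_jetCoeff_isBigO_of_mem_span hfam (hspan f hf))

/-- A point of type larger than `2 A` admits a Hermitian projection and an arc along which the
projected jets vanish to order larger than `⌊A⌋` times the order of the arc. -/
theorem exists_arc_of_lt_Delta {n k : ℕ} {M : Set (Fin n → ℂ)} {p : Fin n → ℂ} (hp : p ∈ M)
    {A : ℝ} (hA : 0 ≤ A) (hΔ : ENNReal.ofReal (2 * A) < Delta n M p) (hk : 2 * A ≤ k) {κ : Type*}
    {r : κ → (Fin n → ℂ) → ℝ} (hr : ∀ i, r i ∈ IMp n M p) {β₀ : polarSupport n k}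
    (hβ₀ : (β₀ : Fin n →₀ ℕ) = 0) :
    ∃ H : polarSupport n k → polarSupport n k → ℂ, (∀ β β', H β β' = conj (H β' β)) ∧
      (∀ β β', ‖H β β'‖ ≤ 1) ∧ (∀ β, H β β₀ = 0) ∧
      ∃ (γ : Fin n → ℂ[X]) (i : Fin n) (ν N : ℕ), (∀ k, Polynomial.X ∣ γ k) ∧ 0 < ν ∧
        Polynomial.X ^ ν ∣ γ i ∧ ¬ Polynomial.X ^ (ν + 1) ∣ γ i ∧ ν * ⌊A⌋₊ < N ∧
        ∀ l, Polynomial.X ^ N ∣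
          aeval γ (projFamily Subtype.val H (fun i β => jetCoeff (jet n k (r i) p) β) l) := by
  obtain ⟨c, hΔc⟩ := lt_iSup_iff.1 hΔ
  obtain ⟨hc, hlt⟩ := lt_iSup_iff.1 hΔc
  obtain ⟨ν, hν0, hνc, harc⟩ := exists_arc_of_mem_curves hc
  have hν : (1 : ℝ) ≤ ν := Nat.one_le_cast.2 hν0
  set N := ⌊2 * A * ν⌋₊ + 1 with hNdef
  obtain ⟨γ, hγ, ⟨i, hi⟩, hcγ⟩ := harc N
  have hγ₀ : ∀ k, Polynomial.X ∣ γ k := fun k => (dvd_pow_self _ hν0.ne').trans (hγ k)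
  have hN : N ≤ ν * (k + 1) := by
    have h1 : ((⌊2 * A * ν⌋₊ : ℕ) : ℝ) ≤ 2 * A * ν := Nat.floor_le (by positivity)
    have : (N : ℝ) ≤ (ν * (k + 1) : ℕ) := by
      push_cast [hNdef]
      nlinarith
    exact_mod_cast this
  have hO : ∀ i, (fun t : ℂ => ∑ β : polarSupport n k,
      (aeval γ (jetCoeff (jet n k (r i) p) β)).eval t *
        conj ((aeval γ (monomial (β : Fin n →₀ ℕ) (1 : ℂ))).eval t)) =O[𝓝 0] fun t => t ^ N := by
    intro i
    have hs := contDiffAt_of_mem_IMp (hr i)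
    refine (comp_arcEval_isBigO_iff hs hγ₀ hγ hN).1 ?_
    have hct : Tendsto c (𝓝 0) (𝓝 p) := by simpa [hc.2.1] using hc.1.continuousAt.tendsto
    refine comp_isBigO_of_sub_isBigO hs hct (tendsto_add_arcEval p hγ₀) hcγ ?_
    have h1 : ENNReal.ofReal (2 * A * ν) < vOrder fun t => r i (c t) - r i p := by
      rw [ENNReal.ofReal_mul (by positivity), ENNReal.ofReal_natCast]
      exact (mul_le_mul_right hνc _).trans_lt
        (ENNReal.mul_lt_of_lt_div (hlt.trans_le (iInf₂_le _ (hr i))))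
    have h2 := isBigO_of_natCast_le_vOrder ?_ (floor_add_one_le_vOrder h1)
    · simpa only [eq_zero_of_mem_IMp hp (hr i), sub_zero] using h2
    · refine ContDiffAt.sub ?_ contDiffAt_const
      refine ContDiffAt.comp (0 : ℂ) ?_ (hc.1.restrictScalars (𝕜 := ℝ)).contDiffAt
      simpa [hc.2.1] using hs
  obtain ⟨H, h1, h2, h3, h4⟩ := exists_projFamily_dvd Subtype.val Subtype.val_injective β₀ hβ₀
    (fun i (β : polarSupport n k) => jetCoeff (jet n k (r i) p) β) γ hγ₀ (N := N)
    (N' := (N + 1) / 2) (by omega) (by omega) hO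
  refine ⟨H, h1, h2, h3, γ, i, ν, (N + 1) / 2, hγ₀, hν0, hγ i, hi, ?_, h4⟩
  have h5 : 2 * (ν * ⌊A⌋₊) ≤ ⌊2 * A * ν⌋₊ := by
    refine Nat.le_floor ?_
    push_cast
    nlinarith [Nat.floor_le hA]
  omega

/-- If `M ⊆ ℂⁿ` is contained in a generic smooth real submanifold of real codimension `d`
and `p₀ ∈ M` is a point of finite type, then there is a neighborhood `V` of `p₀` with
`Δ(M, p) ≤ 2 (Δ(M, p₀))^(n-d)` for all `p ∈ M ∩ V`. -/
theorem finite_type_openness_generic (n d : ℕ) (M N : Set (Fin n → ℂ)) (hMN : M ⊆ N)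
    (hN : IsGenericSubmanifold n d N) (p₀ : Fin n → ℂ) (hp₀ : p₀ ∈ M)
    (hfin : Delta n M p₀ < ⊤) :
    ∃ V : Set (Fin n → ℂ), IsOpen V ∧ p₀ ∈ V ∧
      ∀ p ∈ M ∩ V, Delta n M p ≤ 2 * (Delta n M p₀) ^ (n - d) := by
  set T : ℝ := (Delta n M p₀).toReal with hTdef
  have hT : 0 ≤ T := ENNReal.toReal_nonneg
  have hΔ : Delta n M p₀ = ENNReal.ofReal T := (ENNReal.ofReal_toReal hfin.ne).symm
  have hA : 0 ≤ T ^ (n - d) := by positivity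
  have hbound : 2 * Delta n M p₀ ^ (n - d) = ENNReal.ofReal (2 * T ^ (n - d)) := by
    rw [hΔ, ENNReal.ofReal_mul zero_le_two, ENNReal.ofReal_pow hT, ENNReal.ofReal_ofNat]
  rw [hbound]
  suffices h : ∀ᶠ p in 𝓝 p₀, p ∈ M → Delta n M p ≤ ENNReal.ofReal (2 * T ^ (n - d)) by
    obtain ⟨V, hV, hVo, hpV⟩ := eventually_nhds_iff.1 h
    exact ⟨V, hVo, hpV, fun p hp => hV p hp.2 hp.1⟩
  by_contra hcon
  rw [not_eventually] at hcon
  obtain ⟨k₁, hk₁⟩ := exists_nat_gt (max T (2 * T ^ (n - d)))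
  obtain ⟨k, hk0, hk1, hk2⟩ : ∃ k : ℕ, 0 < k ∧ T < k + 1 ∧ 2 * T ^ (n - d) ≤ k :=
    ⟨k₁ + 1, by omega, by push_cast; linarith [le_max_left T (2 * T ^ (n - d))],
      by push_cast; linarith [le_max_right T (2 * T ^ (n - d))]⟩
  obtain ⟨U, ρ, hU, hpU, hρ, hNU, hli⟩ := hN p₀ (hMN hp₀)
  have hρI : ∀ c, ρ c ∈ IMp n M p₀ := fun c => ⟨U, hU, hpU, hρ c, fun z hz => by
    have : z ∈ N ∩ U := ⟨hMN hz.1, hz.2⟩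
    rw [hNU] at this
    exact this.2 c⟩
  obtain ⟨m, s, hs, hspan⟩ := exists_fin_span_image (IMp n M p₀) fun f => jet n k f p₀
  let r : Fin d ⊕ Fin m → (Fin n → ℂ) → ℝ := Sum.elim ρ s
  have hr : ∀ i, r i ∈ IMp n M p₀ := by
    rintro (c | c)
    · exact hρI c
    · exact hs c
  have hspan' : ∀ f ∈ IMp n M p₀,
      jet n k f p₀ ∈ Submodule.span ℝ (Set.range fun i => jet n k (r i) p₀) := fun f hf =>
    Submodule.span_mono (by rintro _ ⟨i, rfl⟩; exact ⟨Sum.inr i, rfl⟩) (hspan f hf)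
  let β₀ : polarSupport n k := ⟨0, by simp [polarSupport]⟩
  have hfreq : ∃ᶠ p in 𝓝 p₀, p ∈ M ∧ ENNReal.ofReal (2 * T ^ (n - d)) < Delta n M p ∧
      ∀ i, r i ∈ IMp n M p := by
    refine (hcon.and_eventually (eventually_all.2 fun i => eventually_mem_IMp (hr i))).mono ?_
    rintro p ⟨h1, h2⟩
    push Not at h1
    exact ⟨h1.1, h1.2, h2⟩
  obtain ⟨p, hp, hpM⟩ := exists_seq_forall_of_frequently hfreq
  choose H hHherm hHle hH0 hHarc using fun j =>
    exists_arc_of_lt_Delta (hpM j).1 hA (hpM j).2.1 hk2 (hpM j).2.2 (β₀ := β₀) rfl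
  obtain ⟨H₀, -, φ, hφ, hlim⟩ := tendsto_subseq_of_bounded (x := H)
    (s := Metric.closedBall 0 1) Metric.isBounded_closedBall fun j => by
      rw [mem_closedBall_zero_iff, pi_norm_le_iff_of_nonneg zero_le_one]
      exact fun β => (pi_norm_le_iff_of_nonneg zero_le_one).2 fun β' => hHle j β β'
  have hlim' : ∀ β β', Tendsto (fun j => H (φ j) β β') atTop (𝓝 (H₀ β β')) := fun β β' =>
    tendsto_pi_nhds.1 (tendsto_pi_nhds.1 hlim β) β'
  have hherm₀ : ∀ β β', H₀ β β' = conj (H₀ β' β) := fun β β' =>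
    tendsto_nhds_unique (hlim' β β')
      (((Complex.continuous_conj.tendsto _).comp (hlim' β' β)).congr fun j =>
        (hHherm (φ j) β β').symm)
  have hzero₀ : ∀ β, H₀ β β₀ = 0 := fun β =>
    tendsto_nhds_unique (hlim' β β₀) (tendsto_const_nhds.congr fun j => (hH0 (φ j) β).symm)
  have hlin : ∀ c, projFamily Subtype.val H₀ (fun i β => jetCoeff (jet n k (r i) p₀) β)
      (Sum.inl (Sum.inl c, β₀)) = jetCoeff (jet n k (ρ c) p₀) 0 := fun c =>
    projFamily_inl_of_zero _ _ hherm₀ hzero₀ _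
  have hcard := card_le_of_tendsto_of_arcs (K := ⌊T ^ (n - d)⌋₊ + 1)
    (projFamily Subtype.val H₀ fun i β => jetCoeff (jet n k (r i) p₀) β) hT
    (fun γ hγ i e _ he => exists_not_dvd_of_Delta_le hp₀ hT hΔ.le hk1 hspan' hherm₀ hγ he)
    (fun c : Fin d => Sum.inl (Sum.inl c, β₀))
    (fun c => by
      rw [hlin, constantCoeff_jetCoeff_jet, eq_zero_of_mem_IMp hp₀ (hρI c), Complex.ofReal_zero])
    (by
      simp only [hlin, coeff_single_jetCoeff_jet hk0]
      exact hli p₀ hpU)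
    (fun l j => projFamily Subtype.val (H (φ j))
      (fun i β => jetCoeff (jet n k (r i) (p (φ j))) β) l)
    (fun l => PolyTendsto.projFamily (B := polarSupport n k) _ (fun i β => polyTendsto_jetCoeff
      (tendsto_jet (contDiffAt_of_mem_IMp (hr i)) (hp.comp hφ.tendsto_atTop)) β) hlim' l)
    (fun j => by simpa using hHarc (φ j))
  push_cast at hcard
  linarith [Nat.lt_floor_add_one (T ^ (n - d))]

end
end

section
/- Let M ⊂ ℂⁿ be a subset containing a point p, let k be a positive integer, and let γ be a nonconstant germ at 0 ∈ ℂ of a holomorphic curve with γ(0) = p. If inf_{r ∈ I_M(p)} ν(r∘γ)/ν(γ) < k + 1, then inf_{r ∈ I_M(p)} ν(r_k∘γ)/ν(γ) ≤ inf_{r ∈ I_M(p)} ν(r∘γ)/ν(γ). -/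
open scoped ENNReal Topology

section IteratedDerivatives

variable {E F G : Type*} [NormedAddCommGroup E] [NormedSpace ℝ E]
  [NormedAddCommGroup F] [NormedSpace ℝ F] [NormedAddCommGroup G] [NormedSpace ℝ G]

theorem iteratedFDeriv_add_two_apply_eq_fderiv_fderiv {f : E → F} {x : E} {n : ℕ}
    (v : Fin (n + 2) → E) :
    iteratedFDeriv ℝ (n + 2) f x v =
      fderiv ℝ (fderiv ℝ (iteratedFDeriv ℝ n f)) x (v 0) (v 1) (Fin.tail (Fin.tail v)) := by
  let I := (continuousMultilinearCurryLeftEquiv ℝ (fun _ : Fin (n + 1) => E) F).symm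
  have h : fderiv ℝ (iteratedFDeriv ℝ (n + 1) f) x =
      (I : _ →L[ℝ] _).comp (fderiv ℝ (fderiv ℝ (iteratedFDeriv ℝ n f)) x) := by
    rw [iteratedFDeriv_succ_eq_comp_left]
    exact LinearIsometryEquiv.comp_fderiv (𝕜 := ℝ) (E := E →L[ℝ] E [×n]→L[ℝ] F)
      (F := E [×(n + 1)]→L[ℝ] F) (G := E) I
  rw [iteratedFDeriv_succ_apply_left, h]
  rfl

/-- The iterated derivatives of a real `C^n` function are symmetric. -/
theorem ContDiffAt.iteratedFDeriv_real_comp_perm {f : E → F} {x : E} {n : ℕ}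
    (hf : ContDiffAt ℝ n f x) (v : Fin n → E) (σ : Equiv.Perm (Fin n)) :
    iteratedFDeriv ℝ n f x (v ∘ σ) = iteratedFDeriv ℝ n f x v := by
  induction n generalizing x with
  | zero => exact congrArg _ (Subsingleton.elim _ _)
  | succ n ih =>
    have hσ : σ ∈ Submonoid.closure
        (Set.range fun i : Fin n => Equiv.swap i.castSucc i.succ) := by
      rw [Equiv.Perm.mclosure_swap_castSucc_succ]; trivial
    induction hσ using Submonoid.closure_induction generalizing v with
    | one => rfl
    | mul σ τ _ _ hσ hτ =>
      rw [Equiv.Perm.coe_mul, ← Function.comp_assoc, hτ, hσ]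
    | mem σ hσ =>
      obtain ⟨i, rfl⟩ := hσ
      cases n with
      | zero => exact i.elim0
      | succ n =>
        induction i using Fin.cases with
        | zero =>
          have hsym : IsSymmSndFDerivAt ℝ (iteratedFDeriv ℝ n f) x := by
            refine ContDiffAt.isSymmSndFDerivAt (n := 2) ?_ (by simp)
            exact hf.iteratedFDeriv_right (by norm_cast; omega)
          rw [iteratedFDeriv_add_two_apply_eq_fderiv_fderiv,
            iteratedFDeriv_add_two_apply_eq_fderiv_fderiv]
          have htail : Fin.tail (Fin.tail
              (v ∘ Equiv.swap (0 : Fin (n + 1)).castSucc (0 : Fin (n + 1)).succ)) =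
              Fin.tail (Fin.tail v) := by
            ext j
            simp only [Fin.tail, Function.comp_apply]
            rw [Equiv.swap_apply_of_ne_of_ne] <;> simp [Fin.ext_iff]
          rw [htail]
          have := hsym.eq (v 0) (v 1)
          simp [this]
        | succ j =>
          have hd : DifferentiableAt ℝ (iteratedFDeriv ℝ (n + 1) f) x :=
            hf.differentiableAt_iteratedFDeriv (by norm_cast; omega)
          rw [hd.iteratedFDeriv_succ_apply_left', hd.iteratedFDeriv_succ_apply_left']
          have h0 : (v ∘ Equiv.swap j.succ.castSucc j.succ.succ) 0 = v 0 := by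
            simp only [Function.comp_apply]
            rw [Equiv.swap_apply_of_ne_of_ne] <;> simp [Fin.ext_iff]
          have htail : Fin.tail (v ∘ Equiv.swap j.succ.castSucc j.succ.succ) =
              Fin.tail v ∘ Equiv.swap j.castSucc j.succ := by
            ext l
            simp only [Fin.tail, Function.comp_apply]
            rw [← Fin.succ_castSucc, (Fin.succ_injective _).swap_apply]
          rw [h0, htail]
          have hev : ∀ᶠ y in 𝓝 x, ContDiffAt ℝ (n + 1 : ℕ) f y :=
            (hf.of_le (by norm_cast; omega)).eventually (by simp)
          have : (fun y => iteratedFDeriv ℝ (n + 1) f y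
                (Fin.tail v ∘ Equiv.swap j.castSucc j.succ)) =ᶠ[𝓝 x]
              fun y => iteratedFDeriv ℝ (n + 1) f y (Fin.tail v) :=
            hev.mono fun y hy => ih hy _ _
          rw [this.fderiv_eq]

/-- If `g` vanishes to order `k` at `f x` and the derivatives of `f` of positive order less than
`a` vanish at `x`, then the derivatives of `g ∘ f` of order less than `a * (k + 1)` vanish. -/
theorem iteratedFDeriv_comp_eq_zero {g : F → G} {f : E → F} {x : E} {a k m : ℕ}
    (hg : ContDiffAt ℝ m g (f x)) (hf : ContDiffAt ℝ m f x)
    (hg0 : ∀ j ≤ k, iteratedFDeriv ℝ j g (f x) = 0)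
    (hf0 : ∀ i, 0 < i → i < a → iteratedFDeriv ℝ i f x = 0) (hm : m < a * (k + 1)) :
    iteratedFDeriv ℝ m (g ∘ f) x = 0 := by
  rw [iteratedFDeriv_comp hg hf le_rfl]
  refine Finset.sum_eq_zero fun c _ => ?_
  ext v
  rw [FormalMultilinearSeries.compAlongOrderedFinpartition_apply]
  by_cases hc : c.length ≤ k
  · simp [ftaylorSeries, hg0 _ hc]
  · obtain ⟨i, hi⟩ : ∃ i, c.partSize i < a := by
      by_contra! H
      have hsum : ∑ i, c.partSize i = m := by
        simpa using Fintype.card_congr c.equivSigma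
      have : c.length * a ≤ ∑ i, c.partSize i := by
        simpa using Finset.sum_le_sum fun i (_ : i ∈ Finset.univ) => H i
      nlinarith
    refine (ftaylorSeries ℝ g (f x) c.length).map_coord_zero i ?_
    simp [OrderedFinpartition.applyOrderedFinpartition_apply, ftaylorSeries,
      hf0 _ (c.partSize_pos i) hi]

end IteratedDerivatives

section VanishingOrder

variable {E F : Type*} [NormedAddCommGroup E] [NormedSpace ℝ E]
  [NormedAddCommGroup F] [NormedSpace ℝ F]

theorem vOrder_le_of_iteratedFDeriv_ne_zero {f : E → F} {m : ℕ}
    (h : iteratedFDeriv ℝ m f 0 ≠ 0) : vOrder f ≤ m :=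
  iInf₂_le m h

theorem iteratedFDeriv_eq_zero_of_lt_vOrder {f : E → F} {m : ℕ} (h : (m : ℝ≥0∞) < vOrder f) :
    iteratedFDeriv ℝ m f 0 = 0 := by
  by_contra hne
  exact (vOrder_le_of_iteratedFDeriv_ne_zero hne).not_gt h

theorem exists_vOrder_eq_natCast {f : E → F} (h : vOrder f ≠ ⊤) :
    ∃ m : ℕ, vOrder f = m ∧ iteratedFDeriv ℝ m f 0 ≠ 0 := by
  classical
  have hex : ∃ m : ℕ, iteratedFDeriv ℝ m f 0 ≠ 0 := by
    by_contra! H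
    exact h (by simp [vOrder, H])
  refine ⟨Nat.find hex, le_antisymm (vOrder_le_of_iteratedFDeriv_ne_zero (Nat.find_spec hex)) ?_,
    Nat.find_spec hex⟩
  exact le_iInf₂ fun m hm => by exact_mod_cast Nat.find_min' hex hm

end VanishingOrder

theorem exists_nuCurve_eq_natCast {n : ℕ} {γ : ℂ → Fin n → ℂ} {p : Fin n → ℂ} (hγ : γ 0 = p)
    (h : nuCurve γ p ≠ ⊤) : ∃ a : ℕ, 0 < a ∧ nuCurve γ p = a := by
  have : Nonempty (Fin n) := by
    by_contra hn
    rw [not_nonempty_iff] at hn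
    exact h (by simp [nuCurve])
  obtain ⟨i, hi⟩ := exists_eq_ciInf_of_finite (f := fun i => vOrder fun t => γ t i - p i)
  change vOrder (fun t => γ t i - p i) = nuCurve γ p at hi
  obtain ⟨a, ha, ha0⟩ := exists_vOrder_eq_natCast (hi ▸ h)
  refine ⟨a, Nat.pos_of_ne_zero ?_, hi ▸ ha⟩
  rintro rfl
  refine ha0 ?_
  ext v
  simp [hγ]

theorem iteratedFDeriv_eq_zero_of_lt_nuCurve {n : ℕ} {γ : ℂ → Fin n → ℂ} {p : Fin n → ℂ}
    {j : ℕ} (hγ : ContDiffAt ℝ j γ 0) (hj : 0 < j) (h : (j : ℝ≥0∞) < nuCurve γ p) :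
    iteratedFDeriv ℝ j γ 0 = 0 := by
  ext v i
  have hi : iteratedFDeriv ℝ j (fun t => γ t i - p i) 0 = 0 :=
    iteratedFDeriv_eq_zero_of_lt_vOrder (h.trans_le (iInf_le _ i))
  have hcomp := (ContinuousLinearMap.proj (R := ℝ) (φ := fun _ : Fin n => ℂ)
    i).iteratedFDeriv_comp_left hγ le_rfl
  have hproj : ContDiffAt ℝ j (fun t => γ t i) 0 := contDiffAt_pi.1 hγ i
  rw [fun_iteratedFDeriv_sub_apply hproj contDiffAt_const,
    iteratedFDeriv_const_of_ne hj.ne', Pi.zero_apply, sub_zero] at hi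
  have := DFunLike.congr_fun (hcomp.symm.trans hi) v
  simpa using this

section TaylorPolynomial

variable {n : ℕ}

theorem hasFiniteFPowerSeriesOnBall_taylorPoly (k : ℕ) (r : (Fin n → ℂ) → ℝ) (p : Fin n → ℂ) :
    HasFiniteFPowerSeriesOnBall (taylorPoly n k r p)
      (fun j => if j < k + 1 then ((j.factorial : ℝ))⁻¹ • iteratedFDeriv ℝ j r p else 0)
      p (k + 1) ⊤ := by
  refine HasFiniteFPowerSeriesOnBall.mk' (fun m hm => by simp [hm.not_gt]) (by simp) fun y _ => ?_
  refine Finset.sum_congr rfl fun j hj => ?_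
  simp [Finset.mem_range.1 hj]

/-- The Taylor polynomial of order `k` has the same derivatives up to order `k`. -/
theorem iteratedFDeriv_taylorPoly {k j : ℕ} (hj : j ≤ k) {r : (Fin n → ℂ) → ℝ} {p : Fin n → ℂ}
    (hr : ContDiffAt ℝ j r p) :
    iteratedFDeriv ℝ j (taylorPoly n k r p) p = iteratedFDeriv ℝ j r p := by
  ext v
  rw [(hasFiniteFPowerSeriesOnBall_taylorPoly k r
    p).toHasFPowerSeriesOnBall.iteratedFDeriv_eq_sum_of_completeSpace]
  have hterm (σ : Equiv.Perm (Fin j)) :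
      iteratedFDeriv ℝ j r p (fun i => v (σ i)) = iteratedFDeriv ℝ j r p v :=
    hr.iteratedFDeriv_real_comp_perm v σ
  have hfac : (j.factorial : ℝ) ≠ 0 := by positivity
  simp [Nat.lt_succ_of_le hj, hterm, Fintype.card_perm, hfac]

theorem contDiffAt_taylorPoly (k : ℕ) (r : (Fin n → ℂ) → ℝ) (p : Fin n → ℂ) (m : ℕ) :
    ContDiffAt ℝ m (taylorPoly n k r p) p :=
  (hasFiniteFPowerSeriesOnBall_taylorPoly k r p).toHasFPowerSeriesOnBall.analyticAt.contDiffAt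

theorem vOrder_taylorPoly_comp_le {k : ℕ} {r : (Fin n → ℂ) → ℝ} {p : Fin n → ℂ}
    {γ : ℂ → Fin n → ℂ} (hr : ∀ m : ℕ, ContDiffAt ℝ m r p) (hγ : ∀ m : ℕ, ContDiffAt ℝ m γ 0)
    (hγ0 : γ 0 = p)
    (h : vOrder (fun t => r (γ t) - r p) / nuCurve γ p < (k : ℝ≥0∞) + 1) :
    vOrder (fun t => taylorPoly n k r p (γ t) - taylorPoly n k r p p) / nuCurve γ p ≤
      vOrder (fun t => r (γ t) - r p) / nuCurve γ p := by
  by_cases hν : nuCurve γ p = ⊤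
  · simp [hν]
  obtain ⟨a, ha, hνa⟩ := exists_nuCurve_eq_natCast hγ0 hν
  have ha' : (a : ℝ≥0∞) ≠ 0 := by exact_mod_cast ha.ne'
  rw [hνa, ENNReal.div_lt_iff (.inl ha') (.inl (by simp))] at h
  obtain ⟨m, hm, hm0⟩ := exists_vOrder_eq_natCast h.ne_top
  rw [hm] at h
  have hma : m < a * (k + 1) := by rw [mul_comm]; exact_mod_cast h
  gcongr
  rw [hm]
  refine vOrder_le_of_iteratedFDeriv_ne_zero fun h0 => hm0 ?_
  subst hγ0
  set q := taylorPoly n k r (γ 0) with hq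
  have hqs (m : ℕ) : ContDiffAt ℝ m q (γ 0) := contDiffAt_taylorPoly k r (γ 0) m
  have hvan : ∀ j ≤ k, iteratedFDeriv ℝ j (r - q) (γ 0) = 0 := fun j hj => by
    rw [iteratedFDeriv_sub_apply (hr j) (hqs j), hq, iteratedFDeriv_taylorPoly hj (hr j), sub_self]
  have hrem : iteratedFDeriv ℝ m ((r - q) ∘ γ) 0 = 0 :=
    iteratedFDeriv_comp_eq_zero ((hr m).sub (hqs m)) (hγ m) hvan
      (fun i hi hia => iteratedFDeriv_eq_zero_of_lt_nuCurve (hγ i) hi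
        (by rw [hνa]; exact_mod_cast hia)) hma
  have hval : r (γ 0) = q (γ 0) := by
    have := DFunLike.congr_fun (hvan 0 k.zero_le) 0
    simpa [sub_eq_zero] using this
  have hdecomp : (fun t => r (γ t) - r (γ 0)) =
      (r - q) ∘ γ + fun t => q (γ t) - q (γ 0) := by
    ext t
    simp [hval]
  have hrs : ContDiffAt ℝ m ((r - q) ∘ γ) 0 := ((hr m).sub (hqs m)).comp 0 (hγ m)
  have hqγ : ContDiffAt ℝ m (fun t => q (γ t) - q (γ 0)) 0 :=
    ((hqs m).comp 0 (hγ m)).sub contDiffAt_const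
  rw [hdecomp, iteratedFDeriv_add_apply hrs hqγ, hrem, h0, add_zero]

end TaylorPolynomial

/-- If `inf_{r ∈ I_M(p)} ν(r∘γ)/ν(γ) < k + 1` for a nonconstant holomorphic curve germ `γ`
through `p ∈ M`, then `inf_{r ∈ I_M(p)} ν(r_k∘γ)/ν(γ) ≤ inf_{r ∈ I_M(p)} ν(r∘γ)/ν(γ)`. -/
theorem inf_taylor_le_inf (n : ℕ) (M : Set (Fin n → ℂ)) (p : Fin n → ℂ) (hp : p ∈ M)
    (k : ℕ) (hk : 0 < k) (γ : ℂ → Fin n → ℂ) (hγ : γ ∈ Curves n p)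
    (h : (⨅ r ∈ IMp n M p, vOrder (fun t => r (γ t) - r p) / nuCurve γ p) <
      (k : ℝ≥0∞) + 1) :
    (⨅ r ∈ IMp n M p,
        vOrder (fun t => taylorPoly n k r p (γ t) - taylorPoly n k r p p) / nuCurve γ p) ≤
      ⨅ r ∈ IMp n M p, vOrder (fun t => r (γ t) - r p) / nuCurve γ p := by
  obtain ⟨hγa, hγ0, -⟩ := hγ
  have hγs (m : ℕ) : ContDiffAt ℝ m γ 0 := (hγa.restrictScalars (𝕜 := ℝ)).contDiffAt
  have key : ∀ r ∈ IMp n M p,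
      vOrder (fun t => r (γ t) - r p) / nuCurve γ p < (k : ℝ≥0∞) + 1 →
      (⨅ r ∈ IMp n M p,
        vOrder (fun t => taylorPoly n k r p (γ t) - taylorPoly n k r p p) / nuCurve γ p) ≤
      vOrder (fun t => r (γ t) - r p) / nuCurve γ p := by
    intro r hr hlt
    have ⟨U, hU, hpU, hrU, _⟩ := hr
    refine (iInf₂_le r hr).trans (vOrder_taylorPoly_comp_le (fun m => ?_) hγs hγ0 hlt)
    exact (hrU.contDiffAt (hU.mem_nhds hpU)).of_le (by exact_mod_cast le_top)
  obtain ⟨r₀, hr₀, hlt₀⟩ : ∃ r ∈ IMp n M p,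
      vOrder (fun t => r (γ t) - r p) / nuCurve γ p < (k : ℝ≥0∞) + 1 := by
    simpa [iInf_lt_iff] using h
  refine le_iInf₂ fun r hr => ?_
  rcases lt_or_ge (vOrder (fun t => r (γ t) - r p) / nuCurve γ p) ((k : ℝ≥0∞) + 1) with hlt | hge
  · exact key r hr hlt
  · exact (key r₀ hr₀ hlt₀).trans (hlt₀.le.trans hge)
end
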